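/- Let ε>0 and let r₀≥200 be an integer. There exists ε₀>0 such that for every irrational α there is a measurable set Q(α)⊂𝕋 whose complement has Lebesgue measure less than ε, with the following property: if A₀∈C^∞(𝕋,SL(2,ℝ)), R∈SO(2,ℝ), the fibered rotation number ρ(α,A₀) belongs to Q(α), and ‖A₀−R‖_{50r₀}<ε₀, then there exist B∈C^∞(𝕋,SL(2,ℝ)) and φ∈C^∞(𝕋,ℝ) such that B(x+α)A₀(x)B(x)⁻¹=R_{φ(x)} for all x∈𝕋, and, for a suitable representative ρ∈ℝ of ρ(α,A₀), ‖φ−ρ‖_{r₀}<√ε₀ and ‖B−Id‖_{r₀}<√ε₀. -/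

import Mathlib

open Real MeasureTheory Filter Finset

attribute [local instance] Matrix.frobeniusNormedAddCommGroup Matrix.frobeniusNormedSpace

/-- The rotation matrix `R_θ` by angle `2πθ`. -/
noncomputable def Rot (θ : ℝ) : Matrix (Fin 2) (Fin 2) ℝ :=
  !![Real.cos (2*π*θ), -Real.sin (2*π*θ); Real.sin (2*π*θ), Real.cos (2*π*θ)]

/-- `|f|₀ = sup_x ‖f x‖`. -/
noncomputable def C0norm {E : Type*} [NormedAddCommGroup E] (f : ℝ → E) : ℝ := ⨆ x, ‖f x‖

/-- `‖f‖_k = ∑_{h=0}^{k} sup_x ‖D^h f x‖`. -/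
noncomputable def Cnorm {E : Type*} [NormedAddCommGroup E] [NormedSpace ℝ E]
    (k : ℕ) (f : ℝ → E) : ℝ :=
  ∑ h ∈ Finset.range (k+1), ⨆ x, ‖iteratedDeriv h f x‖

/-- `‖x‖ = dist(x, ℤ)`. -/
noncomputable def distToInt (x : ℝ) : ℝ := |x - round x|

/-- `q` is the sequence of denominators of best rational approximations of `α`. -/
def IsBestApproxDenoms (α : ℝ) (q : ℕ → ℕ) : Prop :=
  q 0 = 1 ∧
  (∀ n : ℕ, ∀ k : ℕ, 1 ≤ k → k < q (n+1) → distToInt ((q n : ℝ) * α) ≤ distToInt ((k : ℝ) * α)) ∧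
  (∀ n : ℕ, 1 / ((q (n+1) : ℝ) + (q n : ℝ)) < distToInt ((q n : ℝ) * α) ∧
    distToInt ((q n : ℝ) * α) < 1 / (q (n+1) : ℝ))

/-- The selected subsequence `(n_h)` of Definition 1: `n₀ = 0`; if some `q_k` lies in
`[q_{n_h+1}², q_{n_h+1}⁴)` then `n_{h+1}` is the smallest such `k`, otherwise
`n_{h+1} = max {k : q_k ≤ q_{n_h+1}²}`. -/
def IsSelectedSubseq (q : ℕ → ℕ) (nseq : ℕ → ℕ) : Prop :=
  nseq 0 = 0 ∧ ∀ h : ℕ,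
    ((∃ k, (q (nseq h + 1))^2 ≤ q k ∧ q k < (q (nseq h + 1))^4) →
      ((q (nseq h + 1))^2 ≤ q (nseq (h+1)) ∧ q (nseq (h+1)) < (q (nseq h + 1))^4 ∧
        ∀ k, (q (nseq h + 1))^2 ≤ q k → q k < (q (nseq h + 1))^4 → nseq (h+1) ≤ k)) ∧
    ((¬ ∃ k, (q (nseq h + 1))^2 ≤ q k ∧ q k < (q (nseq h + 1))^4) →
      (q (nseq (h+1)) ≤ (q (nseq h + 1))^2 ∧
        ∀ k, q k ≤ (q (nseq h + 1))^2 → k ≤ nseq (h+1)))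

/-- Birkhoff sums `S_m f (x) = ∑_{j<m} f (x + jα)`. -/
noncomputable def birkhoff (α : ℝ) (f : ℝ → ℝ) (m : ℕ) (x : ℝ) : ℝ :=
  ∑ j ∈ Finset.range m, f (x + j * α)

/-- Iterated cocycle `A^{(m)}(x) = A(x+(m-1)α) ⋯ A(x+α) A(x)`. -/
noncomputable def cocycleIter (α : ℝ) (A : ℝ → Matrix (Fin 2) (Fin 2) ℝ) :
    ℕ → ℝ → Matrix (Fin 2) (Fin 2) ℝ
  | 0, _ => 1
  | (m+1), x => A (x + m * α) * cocycleIter α A m x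

/-- The unit vector `(cos 2πy, sin 2πy)`. -/
noncomputable def unitVec (y : ℝ) : Fin 2 → ℝ := ![Real.cos (2*π*y), Real.sin (2*π*y)]

/-- The orbit of the second coordinate under the lift `G̃(x,y) = (x+α, y + f(x,y))`. -/
noncomputable def liftOrbit (f : ℝ → ℝ → ℝ) (α x y : ℝ) : ℕ → ℝ
  | 0 => y
  | (i+1) => liftOrbit f α x y i + f (x + i * α) (liftOrbit f α x y i)

/-- `ρ` is a representative of the fibered rotation number of the cocycle `(α, A)`:
there is a continuous lift `G̃(x,y) = (x+α, y + f(x,y))` of the projectivized cocycle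
(with `f` 1-periodic in both variables) whose Birkhoff averages converge to `ρ`. -/
def IsRotNumRep (α : ℝ) (A : ℝ → Matrix (Fin 2) (Fin 2) ℝ) (ρ : ℝ) : Prop :=
  ∃ f : ℝ → ℝ → ℝ, Continuous (Function.uncurry f) ∧
    (∀ x y, f (x + 1) y = f x y ∧ f x (y + 1) = f x y) ∧
    (∀ x y, ∃ r : ℝ, 0 < r ∧ (A x).mulVec (unitVec y) = r • unitVec (y + f x y)) ∧
    (∀ x y : ℝ, Tendsto
      (fun n : ℕ => (∑ i ∈ Finset.range n, f (x + i * α) (liftOrbit f α x y i)) / n)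
      atTop (nhds ρ))

/-- The character `x ↦ e^{2πikx}`. -/
noncomputable def ee (k : ℤ) (x : ℝ) : ℂ := Complex.exp (2 * π * Complex.I * k * x)

/-- Smooth `1`-periodic complex functions. -/
def SP (u : ℝ → ℂ) : Prop := ContDiff ℝ (⊤ : ℕ∞) u ∧ Function.Periodic u 1

/-- Fourier coefficients of a `1`-periodic function. -/
noncomputable def fc (u : ℝ → ℂ) (k : ℤ) : ℂ := ∫ x in (0:ℝ)..1, ee (-k) x * u x

lemma ee_add_arg (k : ℤ) (x y : ℝ) : ee k (x + y) = ee k x * ee k y := by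
  simp only [ee, ← Complex.exp_add]; push_cast; ring_nf

lemma ee_add (j k : ℤ) (x : ℝ) : ee (j + k) x = ee j x * ee k x := by
  simp only [ee, ← Complex.exp_add]; push_cast; ring_nf

@[simp] lemma ee_zero (x : ℝ) : ee 0 x = 1 := by simp [ee]

@[simp] lemma ee_zero_arg (k : ℤ) : ee k 0 = 1 := by simp [ee]

lemma ee_neg (k : ℤ) (x : ℝ) : ee (-k) x = (starRingEnd ℂ) (ee k x) := by
  simp only [ee, ← Complex.exp_conj]; simp [map_ofNat]

@[simp] lemma norm_ee (k : ℤ) (x : ℝ) : ‖ee k x‖ = 1 := by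
  rw [ee, Complex.norm_exp]; simp

@[simp] lemma ee_one (k : ℤ) : ee k 1 = 1 := by
  rw [ee, Complex.exp_eq_one_iff]; exact ⟨k, by push_cast; ring⟩

lemma hasDerivAt_ee (k : ℤ) (x : ℝ) :
    HasDerivAt (ee k) (2 * π * Complex.I * k * ee k x) x := by
  have h : HasDerivAt (fun z : ℂ => Complex.exp (2 * π * Complex.I * k * z))
      (Complex.exp (2 * π * Complex.I * k * x) * (2 * π * Complex.I * k)) (x : ℂ) := by
    have := ((hasDerivAt_id (x : ℂ)).const_mul (2 * π * Complex.I * (k:ℂ))).cexp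
    simpa using this
  have := h.comp_ofReal
  rw [mul_comm]
  exact this

lemma contDiff_ee (k : ℤ) : ContDiff ℝ (⊤ : ℕ∞) (ee k) := by
  unfold ee
  exact ((contDiff_const.mul Complex.ofRealCLM.contDiff)).cexp

lemma continuous_ee (k : ℤ) : Continuous (ee k) := (contDiff_ee k).continuous

lemma SP_ee (k : ℤ) : SP (ee k) := ⟨contDiff_ee k, fun x => by rw [ee_add_arg]; simp⟩

lemma SP.cont {u : ℝ → ℂ} (hu : SP u) : Continuous u := hu.1.continuous

lemma SP_const (c : ℂ) : SP (fun _ => c) := ⟨contDiff_const, fun _ => rfl⟩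

lemma SP.add {u v : ℝ → ℂ} (hu : SP u) (hv : SP v) : SP (fun x => u x + v x) :=
  ⟨hu.1.add hv.1, fun x => by simp only [hu.2 x, hv.2 x]⟩

lemma SP.sub {u v : ℝ → ℂ} (hu : SP u) (hv : SP v) : SP (fun x => u x - v x) :=
  ⟨hu.1.sub hv.1, fun x => by simp only [hu.2 x, hv.2 x]⟩

lemma SP.mul {u v : ℝ → ℂ} (hu : SP u) (hv : SP v) : SP (fun x => u x * v x) :=
  ⟨hu.1.mul hv.1, fun x => by simp only [hu.2 x, hv.2 x]⟩

lemma SP.neg {u : ℝ → ℂ} (hu : SP u) : SP (fun x => - u x) :=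
  ⟨hu.1.neg, fun x => by simp only [hu.2 x]⟩

lemma SP.pow {u : ℝ → ℂ} (hu : SP u) (n : ℕ) : SP (fun x => u x ^ n) :=
  ⟨hu.1.pow n, fun x => by simp only [hu.2 x]⟩

lemma SP.conj {u : ℝ → ℂ} (hu : SP u) : SP (fun x => (starRingEnd ℂ) (u x)) :=
  ⟨Complex.conjCLE.toContinuousLinearMap.contDiff.comp hu.1, fun x => by simp only [hu.2 x]⟩

lemma SP.shift {u : ℝ → ℂ} (hu : SP u) (a : ℝ) : SP (fun x => u (x + a)) :=
  ⟨hu.1.comp (contDiff_id.add contDiff_const), fun x => by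
    have := hu.2 (x + a); simp only [← this]; ring_nf⟩

lemma SP.cexp {u : ℝ → ℂ} (hu : SP u) : SP (fun x => Complex.exp (u x)) :=
  ⟨hu.1.cexp, fun x => by simp only [hu.2 x]⟩

lemma SP.sum {ι : Type*} (t : Finset ι) {u : ι → ℝ → ℂ} (hu : ∀ i ∈ t, SP (u i)) :
    SP (fun x => ∑ i ∈ t, u i x) :=
  ⟨ContDiff.sum fun i hi => (hu i hi).1, fun x =>
    Finset.sum_congr rfl fun i hi => (hu i hi).2 x⟩

lemma SP.deriv {u : ℝ → ℂ} (hu : SP u) : SP (deriv u) := by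
  refine ⟨?_, ?_⟩
  · have h := hu.1
    rw [show ((⊤ : ℕ∞) : WithTop ℕ∞) = ((⊤ : ℕ∞) : WithTop ℕ∞) + 1 from rfl,
      contDiff_succ_iff_deriv] at h
    exact h.2.2
  · intro x
    rw [← deriv_comp_add_const]
    congr 1
    funext y
    exact hu.2 y

lemma SP.iteratedDeriv {u : ℝ → ℂ} (hu : SP u) (n : ℕ) : SP (iteratedDeriv n u) := by
  induction n with
  | zero => simpa using hu
  | succ n ih => rw [iteratedDeriv_succ]; exact ih.deriv

lemma SP.hasDerivAt {u : ℝ → ℂ} (hu : SP u) (x : ℝ) : HasDerivAt u (_root_.deriv u x) x :=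
  ((hu.1.differentiable (by simp)) x).hasDerivAt

lemma intervalIntegrable_ee_mul {u : ℝ → ℂ} (hu : Continuous u) (k : ℤ) :
    IntervalIntegrable (fun x => ee k x * u x) volume 0 1 :=
  ((continuous_ee k).mul hu).intervalIntegrable _ _

lemma integral_ee (k : ℤ) : ∫ x in (0:ℝ)..1, ee k x = if k = 0 then 1 else 0 := by
  split_ifs with h
  · subst h; simp
  · have hk : (2 * π * Complex.I * k : ℂ) ≠ 0 := by
      simp [Real.pi_ne_zero, h]
    have h1 : ∫ x in (0:ℝ)..1, (2 * π * Complex.I * k : ℂ) * ee k x = ee k 1 - ee k 0 :=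
      intervalIntegral.integral_eq_sub_of_hasDerivAt (fun x _ => hasDerivAt_ee k x)
        ((continuous_const.mul (continuous_ee k)).intervalIntegrable _ _)
    rw [intervalIntegral.integral_const_mul] at h1
    simpa [hk] using h1

lemma fc_add {u v : ℝ → ℂ} (hu : SP u) (hv : SP v) (k : ℤ) :
    fc (fun x => u x + v x) k = fc u k + fc v k := by
  simp only [fc, mul_add]
  exact intervalIntegral.integral_add (intervalIntegrable_ee_mul hu.cont _)
    (intervalIntegrable_ee_mul hv.cont _)

lemma fc_const_mul (c : ℂ) (u : ℝ → ℂ) (k : ℤ) : fc (fun x => c * u x) k = c * fc u k := by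
  simp only [fc, ← intervalIntegral.integral_const_mul]
  congr 1; funext x; ring

lemma fc_neg (u : ℝ → ℂ) (k : ℤ) : fc (fun x => - u x) k = - fc u k := by
  have := fc_const_mul (-1) u k
  simpa using this

lemma fc_sub {u v : ℝ → ℂ} (hu : SP u) (hv : SP v) (k : ℤ) :
    fc (fun x => u x - v x) k = fc u k - fc v k := by
  have := fc_add hu hv.neg k
  simpa [sub_eq_add_neg, fc_neg] using this

lemma fc_ee (j k : ℤ) : fc (ee j) k = if k = j then 1 else 0 := by
  simp only [fc, ← ee_add, integral_ee]
  congr 1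
  rw [eq_iff_iff]; constructor <;> intro h <;> omega

lemma fc_const (c : ℂ) (k : ℤ) : fc (fun _ => c) k = if k = 0 then c else 0 := by
  have := fc_const_mul c (ee 0) k
  simp only [ee_zero, mul_one, fc_ee] at this
  rw [this]; split_ifs <;> simp

lemma fc_sum {ι : Type*} (t : Finset ι) {u : ι → ℝ → ℂ} (hu : ∀ i ∈ t, SP (u i)) (k : ℤ) :
    fc (fun x => ∑ i ∈ t, u i x) k = ∑ i ∈ t, fc (u i) k := by
  simp only [fc, Finset.mul_sum]
  exact intervalIntegral.integral_finsetSum fun i hi =>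
    intervalIntegrable_ee_mul (hu i hi).cont _

lemma fc_deriv {u : ℝ → ℂ} (hu : SP u) (k : ℤ) :
    fc (deriv u) k = 2 * π * Complex.I * k * fc u k := by
  have h := intervalIntegral.integral_mul_deriv_eq_deriv_mul (a := (0:ℝ)) (b := 1)
    (u := ee (-k)) (v := u) (u' := fun x => 2 * π * Complex.I * ((-k : ℤ) : ℂ) * ee (-k) x)
    (v' := deriv u) (fun x _ => hasDerivAt_ee (-k) x) (fun x _ => hu.hasDerivAt x)
    ((continuous_const.mul (continuous_ee _)).intervalIntegrable _ _)
    (hu.deriv.cont.intervalIntegrable _ _)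
  have h0 : u 1 = u 0 := by simpa using hu.2 0
  simp only [fc]
  rw [h]
  simp only [ee_one, ee_zero_arg, one_mul, h0, sub_self, zero_sub, mul_assoc]
  rw [← intervalIntegral.integral_neg]
  simp only [← intervalIntegral.integral_const_mul]
  congr 1; funext x; push_cast; ring

lemma fc_iteratedDeriv {u : ℝ → ℂ} (hu : SP u) (n : ℕ) (k : ℤ) :
    fc (iteratedDeriv n u) k = (2 * π * Complex.I * k) ^ n * fc u k := by
  induction n with
  | zero => simp
  | succ n ih => rw [iteratedDeriv_succ, fc_deriv (hu.iteratedDeriv n), ih]; ring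

lemma norm_fc_le {u : ℝ → ℂ} {H : ℝ} (hH : ∀ x, ‖u x‖ ≤ H) (k : ℤ) : ‖fc u k‖ ≤ H := by
  have := intervalIntegral.norm_integral_le_of_norm_le_const (a := (0:ℝ)) (b := 1)
    (f := fun x => ee (-k) x * u x) (C := H) (fun x _ => by simpa using hH x)
  simpa [fc] using this

lemma norm_fc_iteratedDeriv {u : ℝ → ℂ} (hu : SP u) (n : ℕ) (k : ℤ) :
    ‖fc (iteratedDeriv n u) k‖ = (2 * π * |(k:ℝ)|) ^ n * ‖fc u k‖ := by
  rw [fc_iteratedDeriv hu, norm_mul, norm_pow]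
  congr 2
  simp [abs_of_pos Real.pi_pos]

lemma fc_shift {u : ℝ → ℂ} (hu : SP u) (a : ℝ) (k : ℤ) :
    fc (fun x => u (x + a)) k = ee k a * fc u k := by
  have h1 : ∀ x, ee (-k) x * u (x + a) = ee k a * (ee (-k) (x + a) * u (x + a)) := by
    intro x
    have : ee k a * ee (-k) a = 1 := by rw [← ee_add]; simp
    rw [ee_add_arg]
    linear_combination (-(ee (-k) x * u (x+a))) * this
  simp only [fc, h1, intervalIntegral.integral_const_mul]
  congr 1
  have hp : Function.Periodic (fun x => ee (-k) x * u x) 1 := ((SP_ee (-k)).mul hu).2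
  rw [intervalIntegral.integral_comp_add_right (fun x => ee (-k) x * u x)]
  have := hp.intervalIntegral_add_eq a 0
  simpa [add_comm] using this

lemma fc_conj (u : ℝ → ℂ) (k : ℤ) :
    fc (fun x => (starRingEnd ℂ) (u x)) k = (starRingEnd ℂ) (fc u (-k)) := by
  simp only [fc, intervalIntegral.integral_of_le zero_le_one, ← integral_conj]
  congr 1; funext x
  rw [map_mul, ← ee_neg]; simp

lemma SP.bounded {u : ℝ → ℂ} (hu : SP u) : ∃ H, 0 ≤ H ∧ ∀ x, ‖u x‖ ≤ H := by
  obtain ⟨H, hH⟩ := (isCompact_Icc (a := (0:ℝ)) (b := 1)).exists_bound_of_continuousOn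
    hu.cont.continuousOn
  refine ⟨H, (norm_nonneg _).trans (hH 0 (by simp)), fun x => ?_⟩
  obtain ⟨y, hy, hxy⟩ := hu.2.exists_mem_Ico₀ zero_lt_one x
  rw [hxy]; exact hH y ⟨hy.1, hy.2.le⟩

/-- Weighted Wiener norm `∑ (1+|k|/M)^s |û(k)|`. -/
noncomputable def wn (M : ℝ) (s : ℕ) (u : ℝ → ℂ) : ℝ :=
  ∑' k : ℤ, (1 + |(k:ℝ)| / M) ^ s * ‖fc u k‖

/-- The Wiener norm `∑ |û(k)|`. -/
noncomputable def n0 (u : ℝ → ℂ) : ℝ := ∑' k : ℤ, ‖fc u k‖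

lemma wn_zero (M : ℝ) (u : ℝ → ℂ) : wn M 0 u = n0 u := by simp [wn, n0]

lemma summable_inv_one_add_abs_sq {M : ℝ} (hM : 1 ≤ M) :
    Summable (fun k : ℤ => ((1 + |(k:ℝ)| / M) ^ 2)⁻¹) ∧
      ∑' k : ℤ, ((1 + |(k:ℝ)| / M) ^ 2)⁻¹ ≤ 4 * M ^ 2 := by
  have hM0 : 0 < M := by linarith
  have key : HasSum (fun n : ℕ => ((n:ℝ) + 1)⁻¹ - ((n:ℝ) + 1 + 1)⁻¹) 1 := by
    have h1 : Tendsto (fun n : ℕ => ((n:ℝ) + 1)⁻¹) atTop (nhds 0) :=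
      tendsto_inv_atTop_zero.comp
        (tendsto_atTop_add_const_right _ _ tendsto_natCast_atTop_atTop)
    rw [hasSum_iff_tendsto_nat_of_nonneg]
    · have h2 : ∀ n : ℕ, ∑ i ∈ Finset.range n, (((i:ℝ) + 1)⁻¹ - ((i:ℝ) + 1 + 1)⁻¹)
          = 1 - ((n:ℝ) + 1)⁻¹ := by
        intro n
        induction n with
        | zero => simp
        | succ n ih => rw [Finset.sum_range_succ, ih]; push_cast; ring
      simp only [h2]
      simpa using h1.const_sub 1
    · intro n
      rw [sub_nonneg]
      gcongr
      linarith
  have hb : ∀ n : ℕ, ((1 + (n:ℝ)) ^ 2)⁻¹ ≤ 2 * (((n:ℝ) + 1)⁻¹ - ((n:ℝ) + 1 + 1)⁻¹) := by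
    intro n
    have hn : (0:ℝ) ≤ n := n.cast_nonneg
    rw [inv_sub_inv (by positivity) (by positivity), ← mul_div_assoc, inv_eq_one_div,
      div_le_div_iff₀ (by positivity) (by positivity)]
    nlinarith
  have hs : Summable (fun n : ℕ => ((1 + (n:ℝ)) ^ 2)⁻¹) :=
    Summable.of_nonneg_of_le (fun n => by positivity) hb (key.summable.mul_left 2)
  have hle : ∑' n : ℕ, ((1 + (n:ℝ)) ^ 2)⁻¹ ≤ 2 := by
    refine (hs.tsum_le_tsum hb (key.summable.mul_left 2)).trans ?_
    rw [tsum_mul_left, key.tsum_eq]; norm_num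
  have hZ : HasSum (fun k : ℤ => ((1 + |(k:ℝ)|) ^ 2)⁻¹)
      (∑' n : ℕ, ((1 + (n:ℝ)) ^ 2)⁻¹ + ∑' n : ℕ, ((1 + ((n:ℝ) + 1)) ^ 2)⁻¹) := by
    have h2 : Summable (fun n : ℕ => ((1 + ((n:ℝ) + 1)) ^ 2)⁻¹) := by
      have := (summable_nat_add_iff 1).2 hs
      simpa using this
    refine HasSum.of_nat_of_neg_add_one ?_ ?_
    · simpa using hs.hasSum
    · have h3 := h2.hasSum
      convert h3 using 4 with n
      push_cast
      rw [abs_neg, abs_of_nonneg (by positivity)]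
  have hle2 : ∑' n : ℕ, ((1 + ((n:ℝ) + 1)) ^ 2)⁻¹ ≤ 2 := by
    refine le_trans ?_ hle
    refine Summable.tsum_le_tsum (fun n => ?_) ?_ hs
    · gcongr; linarith
    · have := (summable_nat_add_iff 1).2 hs
      simpa using this
  have hcmp : ∀ k : ℤ, ((1 + |(k:ℝ)| / M) ^ 2)⁻¹ ≤ M ^ 2 * ((1 + |(k:ℝ)|) ^ 2)⁻¹ := by
    intro k
    have hk := abs_nonneg (k:ℝ)
    have : (1 + |(k:ℝ)|) ≤ M * (1 + |(k:ℝ)| / M) := by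
      rw [mul_add, mul_div_cancel₀ _ hM0.ne']; linarith
    rw [← div_eq_mul_inv, inv_eq_one_div, div_le_div_iff₀ (by positivity) (by positivity), one_mul,
      ← mul_pow]
    gcongr
  have hs2 : Summable (fun k : ℤ => ((1 + |(k:ℝ)| / M) ^ 2)⁻¹) :=
    Summable.of_nonneg_of_le (fun n => by positivity) hcmp (hZ.summable.mul_left _)
  refine ⟨hs2, (hs2.tsum_le_tsum hcmp (hZ.summable.mul_left _)).trans ?_⟩
  rw [tsum_mul_left, hZ.tsum_eq]
  nlinarith [sq_nonneg M]

/-- Decay of the Fourier coefficients from bounds on derivatives. -/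
lemma weighted_fc_le {u : ℝ → ℂ} (hu : SP u) {M H : ℝ} (hM : 1 ≤ M) (s : ℕ)
    (h0 : ∀ x, ‖u x‖ ≤ H) (hs : ∀ x, ‖iteratedDeriv s u x‖ ≤ H * M ^ s) (k : ℤ) :
    (1 + |(k:ℝ)| / M) ^ s * ‖fc u k‖ ≤ 2 ^ (s + 1) * H := by
  have hM0 : 0 < M := by linarith
  have hH : 0 ≤ H := (norm_nonneg _).trans (h0 0)
  have hk := abs_nonneg (k:ℝ)
  have h1 := norm_fc_le h0 k
  have h2 := norm_fc_le hs k
  rw [norm_fc_iteratedDeriv hu] at h2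
  have h3 : (|(k:ℝ)| / M) ^ s * ‖fc u k‖ ≤ H := by
    have : |(k:ℝ)| ^ s * ‖fc u k‖ ≤ H * M ^ s := by
      refine le_trans ?_ h2
      gcongr
      nlinarith [Real.pi_gt_three]
    rw [div_pow, div_mul_eq_mul_div, div_le_iff₀ (by positivity)]
    exact this
  have h4 : (1 + |(k:ℝ)| / M) ^ s ≤ 2 ^ s * (1 + (|(k:ℝ)| / M) ^ s) := by
    have hx : 0 ≤ |(k:ℝ)| / M := by positivity
    rcases le_total (|(k:ℝ)| / M) 1 with h | h
    · calc (1 + |(k:ℝ)| / M) ^ s ≤ 2 ^ s := by gcongr; linarith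
        _ ≤ _ := by
          have : 0 ≤ (|(k:ℝ)| / M) ^ s := by positivity
          have : (0:ℝ) < 2 ^ s := by positivity
          nlinarith
    · calc (1 + |(k:ℝ)| / M) ^ s ≤ (2 * (|(k:ℝ)| / M)) ^ s := by gcongr; linarith
        _ = 2 ^ s * (|(k:ℝ)| / M) ^ s := by rw [mul_pow]
        _ ≤ _ := by gcongr; linarith
  calc (1 + |(k:ℝ)| / M) ^ s * ‖fc u k‖ ≤ 2 ^ s * (1 + (|(k:ℝ)| / M) ^ s) * ‖fc u k‖ := by gcongr
    _ = 2 ^ s * (‖fc u k‖ + (|(k:ℝ)| / M) ^ s * ‖fc u k‖) := by ring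
    _ ≤ 2 ^ s * (H + H) := by gcongr
    _ = _ := by ring

lemma wn_summable_and_le {u : ℝ → ℂ} (hu : SP u) {M H : ℝ} (hM : 1 ≤ M) (s : ℕ)
    (h0 : ∀ x, ‖u x‖ ≤ H) (hs : ∀ x, ‖iteratedDeriv (s + 2) u x‖ ≤ H * M ^ (s + 2)) :
    Summable (fun k : ℤ => (1 + |(k:ℝ)| / M) ^ s * ‖fc u k‖) ∧
      wn M s u ≤ 2 ^ (s + 5) * M ^ 2 * H := by
  have hM0 : 0 < M := by linarith
  have hH : 0 ≤ H := (norm_nonneg _).trans (h0 0)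
  obtain ⟨S1, S2⟩ := summable_inv_one_add_abs_sq hM
  have hc : ∀ k : ℤ, (1 + |(k:ℝ)| / M) ^ s * ‖fc u k‖ ≤
      2 ^ (s + 3) * H * ((1 + |(k:ℝ)| / M) ^ 2)⁻¹ := by
    intro k
    have hk := abs_nonneg (k:ℝ)
    have := weighted_fc_le hu hM (s + 2) h0 hs k
    rw [← div_eq_mul_inv, le_div_iff₀ (by positivity)]
    calc _ = (1 + |(k:ℝ)| / M) ^ (s + 2) * ‖fc u k‖ := by ring
      _ ≤ _ := this
  have hsum : Summable (fun k : ℤ => (1 + |(k:ℝ)| / M) ^ s * ‖fc u k‖) :=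
    Summable.of_nonneg_of_le (fun k => by positivity) hc (S1.mul_left _)
  refine ⟨hsum, (hsum.tsum_le_tsum hc (S1.mul_left _)).trans ?_⟩
  rw [tsum_mul_left]
  calc _ ≤ 2 ^ (s + 3) * H * (4 * M ^ 2) := by gcongr
    _ = _ := by ring

lemma SP.summable {u : ℝ → ℂ} (hu : SP u) {M : ℝ} (hM : 1 ≤ M) (s : ℕ) :
    Summable (fun k : ℤ => (1 + |(k:ℝ)| / M) ^ s * ‖fc u k‖) := by
  obtain ⟨H1, hp1, hH1⟩ := hu.bounded
  obtain ⟨H2, hp2, hH2⟩ := (hu.iteratedDeriv (s + 2)).bounded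
  refine (wn_summable_and_le hu (H := H1 + H2) hM s (fun x => (hH1 x).trans (by linarith))
    fun x => (hH2 x).trans ?_).1
  have : (1:ℝ) ≤ M ^ (s + 2) := one_le_pow₀ hM
  nlinarith

lemma SP.summable0 {u : ℝ → ℂ} (hu : SP u) : Summable (fun k : ℤ => ‖fc u k‖) := by
  simpa using hu.summable le_rfl 0

lemma SP.hasSum {u : ℝ → ℂ} (hu : SP u) (x : ℝ) : HasSum (fun k : ℤ => fc u k * ee k x) (u x) := by
  let f : C(AddCircle (1:ℝ), ℂ) := ⟨hu.2.lift, by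
    exact continuous_coinduced_dom.mpr (by exact hu.cont)⟩
  have hf : ∀ y : ℝ, f (y : AddCircle (1:ℝ)) = u y := fun y => rfl
  have he : ∀ (k : ℤ) (y : ℝ), fourier k (y : AddCircle (1:ℝ)) = ee k y := by
    intro k y
    rw [fourier_coe_apply, ee]; congr 1; push_cast; ring
  have hc : ∀ k, fourierCoeff f k = fc u k := by
    intro k
    rw [fourierCoeff_eq_intervalIntegral _ k 0]
    simp [fc, hf, he]
  have hs : Summable (fourierCoeff f) := by
    refine Summable.of_norm ?_
    simp only [hc]
    exact hu.summable0
  have := has_pointwise_sum_fourier_series_of_summable hs (x : AddCircle (1:ℝ))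
  simpa [hc, he, hf] using this

lemma n0_nonneg (u : ℝ → ℂ) : 0 ≤ n0 u := tsum_nonneg fun _ => norm_nonneg _

lemma wn_nonneg {M : ℝ} (hM : 1 ≤ M) (s : ℕ) (u : ℝ → ℂ) : 0 ≤ wn M s u :=
  tsum_nonneg fun k => by positivity

lemma norm_le_n0 {u : ℝ → ℂ} (hu : SP u) (x : ℝ) : ‖u x‖ ≤ n0 u := by
  rw [← (hu.hasSum x).tsum_eq]
  refine (norm_tsum_le_tsum_norm ?_).trans_eq ?_
  · simpa using hu.summable0
  · simp [n0]

lemma fc_mul {u v : ℝ → ℂ} (hu : SP u) (hv : SP v) (k : ℤ) :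
    HasSum (fun j : ℤ => fc u j * fc v (k - j)) (fc (fun x => u x * v x) k) := by
  obtain ⟨H, hH0, hH⟩ := hv.bounded
  have h : HasSum (fun j : ℤ => ∫ x in (0:ℝ)..1, ee (-k) x * (fc u j * ee j x * v x))
      (∫ x in (0:ℝ)..1, ee (-k) x * (u x * v x)) := by
    refine intervalIntegral.hasSum_integral_of_dominated_convergence
      (fun j _ => ‖fc u j‖ * H) (fun j => ?_) (fun j => ?_) ?_ ?_ ?_
    · exact ((continuous_ee _).mul ((continuous_const.mul (continuous_ee _)).mul
        hv.cont)).aestronglyMeasurable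
    · refine Eventually.of_forall fun x _ => ?_
      simp only [norm_mul, norm_ee, one_mul, mul_one]
      gcongr
      exact hH x
    · exact Eventually.of_forall fun x _ => hu.summable0.mul_right H
    · exact intervalIntegrable_const
    · exact Eventually.of_forall fun x _ => ((hu.hasSum x).mul_right _).mul_left _
  have e : (fun j : ℤ => fc u j * fc v (k - j)) =
      fun j : ℤ => ∫ x in (0:ℝ)..1, ee (-k) x * (fc u j * ee j x * v x) := by
    funext j
    change fc u j * (∫ x in (0:ℝ)..1, ee (-(k-j)) x * v x) = _
    rw [← intervalIntegral.integral_const_mul]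
    congr 1; funext x
    rw [neg_sub, sub_eq_neg_add, ee_add]; ring
  rw [e]
  exact h

lemma one_le_wt {M : ℝ} (hM : 1 ≤ M) (k : ℤ) : 1 ≤ 1 + |(k:ℝ)| / M := by
  have : 0 ≤ |(k:ℝ)| / M := by positivity
  linarith

lemma wt_nonneg {M : ℝ} (hM : 1 ≤ M) (k : ℤ) : 0 ≤ 1 + |(k:ℝ)| / M :=
  zero_le_one.trans (one_le_wt hM k)

lemma wt_le_add {M : ℝ} (hM : 1 ≤ M) (k j : ℤ) :
    1 + |(k:ℝ)| / M ≤ (1 + |(j:ℝ)| / M) + (1 + |((k - j : ℤ):ℝ)| / M) := by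
  have h : |(k:ℝ)| ≤ |(j:ℝ)| + |((k - j : ℤ):ℝ)| := by
    have := abs_add_le (j:ℝ) ((k - j : ℤ):ℝ)
    simpa using this
  have : |(k:ℝ)| / M ≤ |(j:ℝ)| / M + |((k - j : ℤ):ℝ)| / M := by
    rw [← add_div]; gcongr
  linarith

lemma wt_le_mul {M : ℝ} (hM : 1 ≤ M) (k j : ℤ) :
    1 + |(k:ℝ)| / M ≤ (1 + |(j:ℝ)| / M) * (1 + |((k - j : ℤ):ℝ)| / M) := by
  have h1 : 0 ≤ |(j:ℝ)| / M := by positivity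
  have h2 : 0 ≤ |((k - j : ℤ):ℝ)| / M := by positivity
  have h : |(k:ℝ)| / M ≤ |(j:ℝ)| / M + |((k - j : ℤ):ℝ)| / M := by
    have := abs_add_le (j:ℝ) ((k - j : ℤ):ℝ)
    rw [← add_div]; gcongr; simpa using this
  nlinarith [mul_nonneg h1 h2]

lemma wn_le_of_fc_le {M : ℝ} (hM : 1 ≤ M) (s : ℕ) {u v : ℝ → ℂ} (hv : SP v) {C : ℝ}
    (h : ∀ k, ‖fc u k‖ ≤ C * ‖fc v k‖) : wn M s u ≤ C * wn M s v := by
  have hw := wt_nonneg hM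
  have h1 : ∀ k : ℤ, (1 + |(k:ℝ)| / M) ^ s * ‖fc u k‖ ≤
      C * ((1 + |(k:ℝ)| / M) ^ s * ‖fc v k‖) := fun k => by
    calc _ ≤ (1 + |(k:ℝ)| / M) ^ s * (C * ‖fc v k‖) := by gcongr; exact h k
      _ = _ := by ring
  rw [wn, wn, ← tsum_mul_left]
  have hs := (hv.summable hM s).mul_left C
  exact Summable.tsum_le_tsum h1 (Summable.of_nonneg_of_le
    (fun k => mul_nonneg (pow_nonneg (hw k) s) (norm_nonneg _)) h1 hs) hs

lemma wn_congr_norm {M : ℝ} (s : ℕ) {u v : ℝ → ℂ}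
    (h : ∀ k, ‖fc u k‖ = ‖fc v k‖) : wn M s u = wn M s v := by
  simp only [wn, h]

lemma wn_add_le {M : ℝ} (hM : 1 ≤ M) (s : ℕ) {u v : ℝ → ℂ} (hu : SP u) (hv : SP v) :
    wn M s (fun x => u x + v x) ≤ wn M s u + wn M s v := by
  rw [wn, wn, wn, ← (hu.summable hM s).tsum_add (hv.summable hM s)]
  refine Summable.tsum_le_tsum (fun k => ?_) ((hu.add hv).summable hM s)
    ((hu.summable hM s).add (hv.summable hM s))
  rw [fc_add hu hv, ← mul_add]
  have := wt_nonneg hM k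
  gcongr
  exact norm_add_le _ _

lemma wn_const_mul (M : ℝ) (s : ℕ) (c : ℂ) (u : ℝ → ℂ) :
    wn M s (fun x => c * u x) = ‖c‖ * wn M s u := by
  simp only [wn, ← tsum_mul_left, fc_const_mul, norm_mul]
  congr 1; funext k; ring

lemma wn_neg (M : ℝ) (s : ℕ) (u : ℝ → ℂ) : wn M s (fun x => - u x) = wn M s u :=
  wn_congr_norm s fun k => by rw [fc_neg, norm_neg]

lemma wn_sub_le {M : ℝ} (hM : 1 ≤ M) (s : ℕ) {u v : ℝ → ℂ} (hu : SP u) (hv : SP v) :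
    wn M s (fun x => u x - v x) ≤ wn M s u + wn M s v := by
  have := wn_add_le hM s hu hv.neg
  rw [wn_neg] at this
  simpa [sub_eq_add_neg] using this

lemma wn_shift (M : ℝ) (s : ℕ) {u : ℝ → ℂ} (hu : SP u) (a : ℝ) :
    wn M s (fun x => u (x + a)) = wn M s u :=
  wn_congr_norm s fun k => by rw [fc_shift hu, norm_mul, norm_ee, one_mul]

lemma wn_conj (M : ℝ) (s : ℕ) (u : ℝ → ℂ) :
    wn M s (fun x => (starRingEnd ℂ) (u x)) = wn M s u := by
  simp only [wn, fc_conj, RCLike.norm_conj]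
  rw [← (Equiv.neg ℤ).tsum_eq]
  congr 1; funext k; simp

lemma wn_const (M : ℝ) (s : ℕ) (c : ℂ) : wn M s (fun _ => c) = ‖c‖ := by
  rw [wn, tsum_eq_single 0]
  · simp [fc_const]
  · intro k hk; simp [fc_const, hk]

lemma n0_le_wn {M : ℝ} (hM : 1 ≤ M) (s : ℕ) {u : ℝ → ℂ} (hu : SP u) : n0 u ≤ wn M s u := by
  refine Summable.tsum_le_tsum (fun k => ?_) hu.summable0 (hu.summable hM s)
  exact le_mul_of_one_le_left (norm_nonneg _) (one_le_pow₀ (one_le_wt hM k))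

lemma wn_mono {M : ℝ} (hM : 1 ≤ M) {r s : ℕ} (h : r ≤ s) {u : ℝ → ℂ} (hu : SP u) :
    wn M r u ≤ wn M s u := by
  refine Summable.tsum_le_tsum (fun k => ?_) (hu.summable hM r) (hu.summable hM s)
  gcongr
  exact one_le_wt hM k

lemma wn_antitone {M M' : ℝ} (hM : 1 ≤ M) (h : M ≤ M') (s : ℕ) {u : ℝ → ℂ} (hu : SP u) :
    wn M' s u ≤ wn M s u := by
  refine Summable.tsum_le_tsum (fun k => ?_) (hu.summable (hM.trans h) s) (hu.summable hM s)
  have := wt_nonneg (hM.trans h) k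
  gcongr

lemma wn_one_le {M : ℝ} (hM : 1 ≤ M) (s : ℕ) {u : ℝ → ℂ} (hu : SP u) :
    wn 1 s u ≤ M ^ s * wn M s u := by
  rw [wn, wn, ← tsum_mul_left]
  refine Summable.tsum_le_tsum (fun k => ?_) (hu.summable le_rfl s)
    ((hu.summable hM s).mul_left _)
  rw [← mul_assoc, ← mul_pow]
  have hk := abs_nonneg (k:ℝ)
  gcongr
  rw [mul_add, mul_div_cancel₀ _ (by linarith)]
  simp only [div_one]; linarith

lemma wn_interp {M L : ℝ} (hM : 1 ≤ M) (hL : 1 ≤ L) {r s : ℕ} (h : r ≤ s) {u : ℝ → ℂ}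
    (hu : SP u) : L ^ s * wn M r u ≤ L ^ (r + s) * n0 u + L ^ r * wn M s u := by
  rw [wn, n0, wn, ← tsum_mul_left, ← tsum_mul_left, ← tsum_mul_left,
    ← (hu.summable0.mul_left _).tsum_add ((hu.summable hM s).mul_left _)]
  refine Summable.tsum_le_tsum (fun k => ?_) ((hu.summable hM r).mul_left _)
    ((hu.summable0.mul_left _).add ((hu.summable hM s).mul_left _))
  have h1 := one_le_wt hM k
  set t := 1 + |(k:ℝ)| / M
  have h0 : 0 ≤ t := by linarith
  rw [← mul_assoc, ← mul_assoc, ← add_mul]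
  gcongr
  rcases le_total t L with h2 | h2
  · calc L ^ s * t ^ r ≤ L ^ s * L ^ r := by gcongr
      _ = L ^ (r + s) := by ring
      _ ≤ _ := le_add_of_nonneg_right (by positivity)
  · obtain ⟨n, rfl⟩ := Nat.exists_eq_add_of_le h
    calc L ^ (r + n) * t ^ r = L ^ r * (t ^ r * L ^ n) := by ring
      _ ≤ L ^ r * (t ^ r * t ^ n) := by gcongr
      _ = L ^ r * t ^ (r + n) := by ring
      _ ≤ _ := le_add_of_nonneg_left (by positivity)

/-- Convolution of nonnegative summable sequences on `ℤ`. -/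
lemma summable_conv {f g : ℤ → ℝ} (hf0 : ∀ k, 0 ≤ f k) (hg0 : ∀ k, 0 ≤ g k) (hf : Summable f)
    (hg : Summable g) :
    Summable (fun p : ℤ × ℤ => f p.2 * g (p.1 - p.2)) ∧
      ∑' p : ℤ × ℤ, f p.2 * g (p.1 - p.2) = (∑' k, f k) * ∑' k, g k := by
  have h := hf.mul_of_nonneg hg hf0 hg0
  let e : ℤ × ℤ ≃ ℤ × ℤ :=
    ⟨fun p => (p.2, p.1 - p.2), fun p => (p.1 + p.2, p.1), fun p => by simp, fun p => by simp⟩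
  refine ⟨(e.summable_iff (f := fun x : ℤ × ℤ => f x.1 * g x.2)).2 h, ?_⟩
  rw [hf.tsum_mul_tsum hg h]
  exact e.tsum_eq (fun x : ℤ × ℤ => f x.1 * g x.2)

lemma tsum_conv_le {f g : ℤ → ℝ} (hf0 : ∀ k, 0 ≤ f k) (hg0 : ∀ k, 0 ≤ g k) (hf : Summable f)
    (hg : Summable g) :
    Summable (fun k => ∑' j, f j * g (k - j)) ∧ (∀ k, Summable fun j => f j * g (k - j)) ∧
      ∑' k, ∑' j, f j * g (k - j) = (∑' k, f k) * ∑' k, g k := by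
  obtain ⟨h1, h2⟩ := summable_conv hf0 hg0 hf hg
  exact ⟨h1.prod, fun k => h1.prod_factor k, by rw [← h2, h1.tsum_prod]⟩

lemma norm_fc_mul_le {u v : ℝ → ℂ} (hu : SP u) (hv : SP v) (k : ℤ) :
    ‖fc (fun x => u x * v x) k‖ ≤ ∑' j, ‖fc u j‖ * ‖fc v (k - j)‖ := by
  rw [← (fc_mul hu hv k).tsum_eq]
  have h := (tsum_conv_le (fun k => norm_nonneg (fc u k)) (fun k => norm_nonneg (fc v k))
    hu.summable0 hv.summable0).2.1 k
  refine (norm_tsum_le_tsum_norm ?_).trans_eq ?_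
  · simpa using h
  · simp

lemma wn_mul_le {M : ℝ} (hM : 1 ≤ M) (s : ℕ) {u v : ℝ → ℂ} (hu : SP u) (hv : SP v) :
    wn M s (fun x => u x * v x) ≤ wn M s u * wn M s v := by
  have hw := wt_nonneg hM
  have n1 : ∀ {w : ℝ → ℂ} (k : ℤ), 0 ≤ (1 + |(k:ℝ)| / M) ^ s * ‖fc w k‖ :=
    fun k => mul_nonneg (pow_nonneg (hw k) _) (norm_nonneg _)
  obtain ⟨h1, h2, h3⟩ := tsum_conv_le n1 n1 (hu.summable hM s) (hv.summable hM s)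
  have h0 := (tsum_conv_le (fun k => norm_nonneg (fc u k)) (fun k => norm_nonneg (fc v k))
    hu.summable0 hv.summable0).2.1
  rw [wn, wn, wn, ← h3]
  refine Summable.tsum_le_tsum (fun k => ?_) ((hu.mul hv).summable hM s) h1
  calc _ ≤ (1 + |(k:ℝ)| / M) ^ s * ∑' j, ‖fc u j‖ * ‖fc v (k - j)‖ := by
        gcongr; exact norm_fc_mul_le hu hv k
    _ = ∑' j, (1 + |(k:ℝ)| / M) ^ s * (‖fc u j‖ * ‖fc v (k - j)‖) := by rw [tsum_mul_left]
    _ ≤ _ := by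
      refine Summable.tsum_le_tsum (fun j => ?_) ((h0 k).mul_left _) (h2 k)
      calc _ ≤ ((1 + |(j:ℝ)| / M) * (1 + |((k - j : ℤ):ℝ)| / M)) ^ s *
            (‖fc u j‖ * ‖fc v (k - j)‖) := by gcongr; exact wt_le_mul hM k j
        _ = _ := by rw [mul_pow]; ring

lemma n0_mul_le {u v : ℝ → ℂ} (hu : SP u) (hv : SP v) :
    n0 (fun x => u x * v x) ≤ n0 u * n0 v := by
  simpa only [wn_zero] using wn_mul_le le_rfl 0 hu hv

lemma add_pow_le_two_pow_mul {a b : ℝ} (ha : 0 ≤ a) (hb : 0 ≤ b) (s : ℕ) :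
    (a + b) ^ s ≤ 2 ^ s * (a ^ s + b ^ s) := by
  rcases le_total a b with h | h
  · calc (a + b) ^ s ≤ (2 * b) ^ s := by gcongr; linarith
      _ = 2 ^ s * b ^ s := by rw [mul_pow]
      _ ≤ _ := by gcongr; exact le_add_of_nonneg_left (by positivity)
  · calc (a + b) ^ s ≤ (2 * a) ^ s := by gcongr; linarith
      _ = 2 ^ s * a ^ s := by rw [mul_pow]
      _ ≤ _ := by gcongr; exact le_add_of_nonneg_right (by positivity)

/-- Tame product estimate. -/
lemma wn_mul_tame {M : ℝ} (hM : 1 ≤ M) (s : ℕ) {u v : ℝ → ℂ} (hu : SP u) (hv : SP v) :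
    wn M s (fun x => u x * v x) ≤ 2 ^ s * (wn M s u * n0 v + n0 u * wn M s v) := by
  have hw := wt_nonneg hM
  have n1 : ∀ {w : ℝ → ℂ} (k : ℤ), 0 ≤ (1 + |(k:ℝ)| / M) ^ s * ‖fc w k‖ :=
    fun k => mul_nonneg (pow_nonneg (hw k) _) (norm_nonneg _)
  have n2 : ∀ {w : ℝ → ℂ} (k : ℤ), 0 ≤ ‖fc w k‖ := fun k => norm_nonneg _
  obtain ⟨a1, a2, a3⟩ := tsum_conv_le n1 n2 (hu.summable hM s) hv.summable0
  obtain ⟨b1, b2, b3⟩ := tsum_conv_le n2 n1 hu.summable0 (hv.summable hM s)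
  have h0 := (tsum_conv_le n2 n2 hu.summable0 hv.summable0).2.1
  rw [wn, wn, wn, n0, n0, ← a3, ← b3, ← a1.tsum_add b1, ← tsum_mul_left]
  refine Summable.tsum_le_tsum (fun k => ?_) ((hu.mul hv).summable hM s)
    ((a1.add b1).mul_left _)
  calc _ ≤ (1 + |(k:ℝ)| / M) ^ s * ∑' j, ‖fc u j‖ * ‖fc v (k - j)‖ := by
        gcongr; exact norm_fc_mul_le hu hv k
    _ = ∑' j, (1 + |(k:ℝ)| / M) ^ s * (‖fc u j‖ * ‖fc v (k - j)‖) := by rw [tsum_mul_left]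
    _ ≤ _ := by
      rw [← (a2 k).tsum_add (b2 k), ← tsum_mul_left]
      refine Summable.tsum_le_tsum (fun j => ?_) ((h0 k).mul_left _)
        (((a2 k).add (b2 k)).mul_left _)
      calc _ ≤ (2 ^ s * ((1 + |(j:ℝ)| / M) ^ s + (1 + |((k - j : ℤ):ℝ)| / M) ^ s)) *
            (‖fc u j‖ * ‖fc v (k - j)‖) := by
              gcongr
              refine (pow_le_pow_left₀ (hw k) (wt_le_add hM k j) s).trans ?_
              exact add_pow_le_two_pow_mul (hw _) (hw _) s
        _ = _ := by ring

lemma SP_trig (t : Finset ℤ) (c : ℤ → ℂ) : SP (fun x => ∑ k ∈ t, c k * ee k x) :=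
  SP.sum t fun k _ => (SP_const (c k)).mul (SP_ee k)

lemma fc_trig (t : Finset ℤ) (c : ℤ → ℂ) (k : ℤ) :
    fc (fun x => ∑ j ∈ t, c j * ee j x) k = if k ∈ t then c k else 0 := by
  rw [fc_sum t fun k _ => (SP_const (c k)).mul (SP_ee k)]
  simp only [fc_const_mul, fc_ee, mul_ite, mul_one, mul_zero, Finset.sum_ite_eq]

lemma n0_trig (t : Finset ℤ) (c : ℤ → ℂ) :
    n0 (fun x => ∑ j ∈ t, c j * ee j x) = ∑ j ∈ t, ‖c j‖ := by
  rw [n0, tsum_eq_sum (s := t)]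
  · exact Finset.sum_congr rfl fun k hk => by rw [fc_trig, if_pos hk]
  · intro k hk; rw [fc_trig, if_neg hk, norm_zero]

/-- High Fourier modes are controlled by weighted norms. -/
lemma n0_high_le {M : ℝ} (hM : 1 ≤ M) {N : ℝ} (hN : 0 < N) (s : ℕ) {u v : ℝ → ℂ} (hu : SP u)
    (h : ∀ k : ℤ, fc v k ≠ 0 → N ≤ |(k:ℝ)| ∧ ‖fc v k‖ ≤ ‖fc u k‖) (hv : SP v) :
    n0 v ≤ (M / N) ^ s * wn M s u := by
  have hM0 : 0 < M := by linarith
  rw [n0, wn, ← tsum_mul_left]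
  refine Summable.tsum_le_tsum (fun k => ?_) hv.summable0 ((hu.summable hM s).mul_left _)
  by_cases hk : fc v k = 0
  · rw [hk, norm_zero]
    have := wt_nonneg hM k
    positivity
  · obtain ⟨h1, h2⟩ := h k hk
    rw [← mul_assoc, ← mul_pow]
    refine h2.trans (le_mul_of_one_le_left (norm_nonneg _) (one_le_pow₀ ?_))
    rw [mul_add, mul_comm (M / N) (_ / M), div_mul_div_cancel₀ hM0.ne', mul_one]
    have : 1 ≤ |(k:ℝ)| / N := by rwa [le_div_iff₀ hN, one_mul]
    have : 0 ≤ M / N := by positivity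
    linarith

lemma norm_iteratedDeriv_le {u : ℝ → ℂ} (hu : SP u) (r : ℕ) (x : ℝ) :
    ‖iteratedDeriv r u x‖ ≤ (2 * π) ^ r * wn 1 r u := by
  have h := norm_le_n0 (hu.iteratedDeriv r) x
  refine h.trans ?_
  rw [n0, wn, ← tsum_mul_left]
  refine Summable.tsum_le_tsum (fun k => ?_) (hu.iteratedDeriv r).summable0
    ((hu.summable le_rfl r).mul_left _)
  rw [norm_fc_iteratedDeriv hu, ← mul_assoc, ← mul_pow]
  have hk := abs_nonneg (k:ℝ)
  gcongr
  simp

lemma fc_series {U : ℕ → ℝ → ℂ} {v : ℝ → ℂ} (hU : ∀ n, SP (U n))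
    (h : ∀ x, HasSum (fun n => U n x) (v x)) (hs : Summable fun n => n0 (U n)) (k : ℤ) :
    HasSum (fun n => fc (U n) k) (fc v k) := by
  refine intervalIntegral.hasSum_integral_of_dominated_convergence
      (fun n _ => n0 (U n)) (fun n => ?_) (fun n => ?_) ?_ ?_ ?_
  · exact ((continuous_ee _).mul (hU n).cont).aestronglyMeasurable
  · refine Eventually.of_forall fun x _ => ?_
    simp only [norm_mul, norm_ee, one_mul]
    exact norm_le_n0 (hU n) x
  · exact Eventually.of_forall fun x _ => hs
  · exact intervalIntegrable_const
  · exact Eventually.of_forall fun x _ => (h x).mul_left _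

lemma norm_fc_le_n0 {u : ℝ → ℂ} (hu : SP u) (k : ℤ) : ‖fc u k‖ ≤ n0 u :=
  hu.summable0.le_tsum k fun _ _ => norm_nonneg _

lemma wn_series {M : ℝ} (hM : 1 ≤ M) (s : ℕ) {U : ℕ → ℝ → ℂ} {v : ℝ → ℂ} (hU : ∀ n, SP (U n))
    (hv : SP v) (h : ∀ x, HasSum (fun n => U n x) (v x)) (hs : Summable fun n => wn M s (U n)) :
    wn M s v ≤ ∑' n, wn M s (U n) := by
  have hs0 : Summable fun n => n0 (U n) :=
    Summable.of_nonneg_of_le (fun n => n0_nonneg _) (fun n => n0_le_wn hM s (hU n)) hs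
  have hk : ∀ k, Summable fun n => ‖fc (U n) k‖ := fun k =>
    Summable.of_nonneg_of_le (fun n => norm_nonneg _) (fun n => norm_fc_le_n0 (hU n) k) hs0
  have hw := wt_nonneg hM
  refine (hv.summable hM s).tsum_le_of_sum_le fun t => ?_
  calc ∑ k ∈ t, (1 + |(k:ℝ)| / M) ^ s * ‖fc v k‖
      ≤ ∑ k ∈ t, ∑' n, (1 + |(k:ℝ)| / M) ^ s * ‖fc (U n) k‖ := by
        refine Finset.sum_le_sum fun k _ => ?_
        rw [tsum_mul_left, ← (fc_series hU h hs0 k).tsum_eq]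
        have := norm_tsum_le_tsum_norm (hk k)
        have := hw k
        gcongr
    _ = ∑' n, ∑ k ∈ t, (1 + |(k:ℝ)| / M) ^ s * ‖fc (U n) k‖ :=
        (Summable.tsum_finsetSum fun k _ => (hk k).mul_left _).symm
    _ ≤ _ := by
        refine Summable.tsum_le_tsum (fun n => ?_) (summable_sum fun k _ => (hk k).mul_left _) hs
        exact ((hU n).summable hM s).sum_le_tsum t fun k _ =>
          mul_nonneg (pow_nonneg (hw k) _) (norm_nonneg _)

lemma SP_series {U : ℕ → ℝ → ℂ} (hU : ∀ n, SP (U n))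
    (hs : ∀ r, Summable fun n => wn 1 r (U n)) :
    SP (fun x => ∑' n, U n x) ∧ ∀ x, HasSum (fun n => U n x) (∑' n, U n x) := by
  have h0 : Summable fun n => n0 (U n) := by simpa only [wn_zero] using hs 0
  refine ⟨⟨?_, fun x => by simp only [(hU _).2 x]⟩, fun x => ?_⟩
  · refine contDiff_tsum (v := fun r n => (2 * π) ^ r * wn 1 r (U n)) (fun n => (hU n).1)
      (fun r _ => (hs r).mul_left _) fun r n x _ => ?_
    rw [norm_iteratedFDeriv_eq_norm_iteratedDeriv]
    exact norm_iteratedDeriv_le (hU n) r x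
  · exact (Summable.of_norm_bounded h0 fun n => norm_le_n0 (hU n) x).hasSum

lemma n0_pow_le {u : ℝ → ℂ} (hu : SP u) (n : ℕ) :
    n0 (fun x => u x ^ (n + 1)) ≤ n0 u ^ (n + 1) := by
  induction n with
  | zero => simp
  | succ n ih =>
    have := n0_mul_le (hu.pow (n + 1)) hu
    calc _ = n0 (fun x => u x ^ (n + 1) * u x) := by simp only [pow_succ]
      _ ≤ _ := this
      _ ≤ n0 u ^ (n + 1) * n0 u := by gcongr; exact n0_nonneg u
      _ = _ := by ring

lemma wn_pow_le {M : ℝ} (hM : 1 ≤ M) (s : ℕ) {u : ℝ → ℂ} (hu : SP u) (n : ℕ) :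
    wn M s (fun x => u x ^ (n + 1)) ≤ (2 ^ (s + 1) * n0 u) ^ n * wn M s u := by
  have h0 := n0_nonneg u
  have hw := wn_nonneg hM s u
  induction n with
  | zero => simp
  | succ n ih =>
    have h1 := wn_mul_tame hM s (hu.pow (n + 1)) hu
    have h2 := n0_pow_le hu n
    have h3 : n0 u ^ n ≤ (2 ^ (s + 1) * n0 u) ^ n := by
      gcongr
      exact le_mul_of_one_le_left h0 (one_le_pow₀ (by norm_num))
    calc _ = wn M s (fun x => u x ^ (n + 1) * u x) := by simp only [pow_succ]
      _ ≤ _ := h1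
      _ ≤ 2 ^ s * ((2 ^ (s + 1) * n0 u) ^ n * wn M s u * n0 u +
          (2 ^ (s + 1) * n0 u) ^ n * n0 u * wn M s u) := by
            gcongr
            refine h2.trans ?_
            rw [pow_succ]; gcongr
      _ = _ := by ring

/-- Composition with a power series having coefficients bounded by one. -/
lemma wn_powerSeries {M : ℝ} (hM : 1 ≤ M) (s : ℕ) {u : ℝ → ℂ} (hu : SP u)
    (hsmall : 2 ^ (s + 1) * n0 u ≤ 1 / 2) {p : ℕ → ℂ} (hp : ∀ n, ‖p n‖ ≤ 1) {F : ℂ → ℂ}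
    (hF : ∀ z, ‖z‖ < 1 → HasSum (fun n => p n * z ^ (n + 1)) (F z))
    (hFu : SP (fun x => F (u x))) : wn M s (fun x => F (u x)) ≤ 2 * wn M s u := by
  have h0 := n0_nonneg u
  have hw := wn_nonneg hM s u
  have hlt : ∀ x, ‖u x‖ < 1 := fun x => by
    have h1 : n0 u ≤ 2 ^ (s + 1) * n0 u := le_mul_of_one_le_left h0 (one_le_pow₀ (by norm_num))
    linarith [norm_le_n0 hu x]
  have hb : ∀ n, wn M s (fun x => p n * u x ^ (n + 1)) ≤ (1 / 2) ^ n * wn M s u := fun n => by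
    rw [wn_const_mul]
    calc _ ≤ 1 * ((2 ^ (s + 1) * n0 u) ^ n * wn M s u) := by
          gcongr
          · exact wn_nonneg hM s _
          · exact hp n
          · exact wn_pow_le hM s hu n
      _ ≤ _ := by rw [one_mul]; gcongr
  have hg := hasSum_geometric_two.mul_right (wn M s u)
  have hSP : ∀ n, SP (fun x => p n * u x ^ (n + 1)) := fun n => (SP_const (p n)).mul (hu.pow _)
  have hs : Summable fun n => wn M s (fun x => p n * u x ^ (n + 1)) :=
    Summable.of_nonneg_of_le (fun n => wn_nonneg hM s _) hb hg.summable
  refine (wn_series hM s hSP hFu (fun x => hF (u x) (hlt x)) hs).trans ?_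
  rw [← hg.tsum_eq]
  exact hs.tsum_le_tsum hb hg.summable

lemma wn_exp_sub_one_le {M : ℝ} (hM : 1 ≤ M) (s : ℕ) {u : ℝ → ℂ} (hu : SP u)
    (hsmall : 2 ^ (s + 1) * n0 u ≤ 1 / 2) :
    wn M s (fun x => Complex.exp (u x) - 1) ≤ 2 * wn M s u := by
  refine wn_powerSeries hM s hu hsmall (p := fun n => (((n + 1).factorial : ℂ))⁻¹)
    (F := fun z => Complex.exp z - 1) (fun n => ?_) (fun z _ => ?_) (hu.cexp.sub (SP_const 1))
  · rw [norm_inv, Complex.norm_natCast]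
    exact inv_le_one_of_one_le₀ (by exact_mod_cast Nat.factorial_pos _)
  · have h : HasSum (fun n : ℕ => z ^ n / (n.factorial : ℂ)) (Complex.exp z) := by
      rw [Complex.exp_eq_exp_ℂ]
      exact NormedSpace.expSeries_div_hasSum_exp z
    rw [← hasSum_nat_add_iff' 1] at h
    simpa [div_eq_inv_mul] using h

lemma one_add_mem_slitPlane {z : ℂ} (h : ‖z‖ < 1) : 1 + z ∈ Complex.slitPlane := by
  refine Complex.mem_slitPlane_of_norm_lt_one h

lemma SP.log_one_add {u : ℝ → ℂ} (hu : SP u) (h : ∀ x, ‖u x‖ < 1) :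
    SP (fun x => Complex.log (1 + u x)) := by
  refine ⟨contDiff_iff_contDiffAt.2 fun x => ?_, fun x => by simp only [hu.2 x]⟩
  have h1 : ContDiffAt ℝ (⊤ : ℕ∞) Complex.log (1 + u x) :=
    (Complex.contDiffAt_log (one_add_mem_slitPlane (h x))).restrict_scalars ℝ
  exact h1.comp x (contDiff_const.add hu.1).contDiffAt

lemma one_add_ne_zero_of_norm_lt {z : ℂ} (h : ‖z‖ < 1) : 1 + z ≠ 0 :=
  Complex.slitPlane_ne_zero (one_add_mem_slitPlane h)

lemma SP.inv_one_add {u : ℝ → ℂ} (hu : SP u) (h : ∀ x, ‖u x‖ < 1) :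
    SP (fun x => (1 + u x)⁻¹) :=
  ⟨(contDiff_const.add hu.1).inv fun x => one_add_ne_zero_of_norm_lt (h x),
    fun x => by simp only [hu.2 x]⟩

lemma norm_lt_one_of_small {s : ℕ} {u : ℝ → ℂ} (hu : SP u)
    (hsmall : 2 ^ (s + 1) * n0 u ≤ 1 / 2) (x : ℝ) : ‖u x‖ < 1 := by
  have h1 : n0 u ≤ 2 ^ (s + 1) * n0 u :=
    le_mul_of_one_le_left (n0_nonneg u) (one_le_pow₀ (by norm_num))
  linarith [norm_le_n0 hu x]

lemma wn_log_one_add_le {M : ℝ} (hM : 1 ≤ M) (s : ℕ) {u : ℝ → ℂ} (hu : SP u)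
    (hsmall : 2 ^ (s + 1) * n0 u ≤ 1 / 2) :
    wn M s (fun x => Complex.log (1 + u x)) ≤ 2 * wn M s u := by
  refine wn_powerSeries hM s hu hsmall (p := fun n => (-1) ^ (n + 1 + 1) / ((n + 1 : ℕ) : ℂ))
    (F := fun z => Complex.log (1 + z)) (fun n => ?_) (fun z hz => ?_)
    (hu.log_one_add (norm_lt_one_of_small hu hsmall))
  · rw [norm_div, norm_pow, norm_neg, norm_one, one_pow, Complex.norm_natCast]
    exact div_le_one_of_le₀ (by norm_cast; omega) (by positivity)
  · have h := Complex.hasSum_taylorSeries_log hz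
    rw [← hasSum_nat_add_iff' 1] at h
    simp only [Finset.range_one, Finset.sum_singleton, Nat.cast_zero, div_zero, sub_zero] at h
    refine h.congr_fun ?_
    intro n
    ring

lemma wn_inv_one_add_sub_one_le {M : ℝ} (hM : 1 ≤ M) (s : ℕ) {u : ℝ → ℂ} (hu : SP u)
    (hsmall : 2 ^ (s + 1) * n0 u ≤ 1 / 2) :
    wn M s (fun x => (1 + u x)⁻¹ - 1) ≤ 2 * wn M s u := by
  refine wn_powerSeries hM s hu hsmall (p := fun n => (-1) ^ (n + 1))
    (F := fun z => (1 + z)⁻¹ - 1) (fun n => by simp) (fun z hz => ?_)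
    ((hu.inv_one_add (norm_lt_one_of_small hu hsmall)).sub (SP_const 1))
  have h := hasSum_geometric_of_norm_lt_one (ξ := -z) (by simpa using hz)
  rw [← hasSum_nat_add_iff' 1] at h
  simp only [Finset.range_one, Finset.sum_singleton, pow_zero, sub_neg_eq_add] at h
  refine h.congr_fun ?_
  intro n
  rw [← mul_pow]; ring

lemma iteratedDeriv_ee (k : ℤ) (n : ℕ) :
    iteratedDeriv n (ee k) = fun x => (2 * π * Complex.I * k) ^ n * ee k x := by
  induction n with
  | zero => simp
  | succ n ih =>
    rw [iteratedDeriv_succ, ih]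
    funext x
    rw [((hasDerivAt_ee k x).const_mul _).deriv]; ring

/-- Constant for the exponential of a real trigonometric polynomial. -/
noncomputable def expConst (s : ℕ) : ℝ :=
  2 ^ (s + 5) * ((s + 2).factorial * (4 * π) ^ (s + 2) * (2 * π) ^ (s + 2))

lemma norm_iteratedDeriv_le_of_trig {g : ℝ → ℂ} (hg : SP g) {K : ℝ}
    (hK : ∀ k : ℤ, K < |(k:ℝ)| → fc g k = 0) (n : ℕ) (x : ℝ) :
    ‖iteratedDeriv n g x‖ ≤ (2 * π * K) ^ n * n0 g := by
  refine (norm_le_n0 (hg.iteratedDeriv n) x).trans ?_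
  rw [n0, n0, ← tsum_mul_left]
  refine Summable.tsum_le_tsum (fun k => ?_) (hg.iteratedDeriv n).summable0
    (hg.summable0.mul_left _)
  rw [norm_fc_iteratedDeriv hg]
  rcases lt_or_ge K |(k:ℝ)| with h | h
  · simp [hK k h]
  · gcongr

lemma wn_exp_trig_le (s : ℕ) {g : ℝ → ℂ} (hg : SP g) {K : ℝ} (hK1 : 1 ≤ K)
    (hreal : ∀ x, (g x).im = 0)
    (hK : ∀ k : ℤ, K < |(k:ℝ)| → fc g k = 0) (hn : n0 g ≤ K) :
    wn (K ^ 2) s (fun x => Complex.exp (4 * π * Complex.I * g x)) ≤ expConst s * K ^ 4 := by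
  have hSP : SP (fun x => Complex.exp (4 * π * Complex.I * g x)) :=
    ((SP_const (4 * π * Complex.I)).mul hg).cexp
  have hK2 : 1 ≤ K ^ 2 := one_le_pow₀ hK1
  have hgre : ContDiff ℝ (⊤ : ℕ∞) (fun x => (g x).re) := Complex.reCLM.contDiff.comp hg.1
  have heq : (fun x => Complex.exp (4 * π * Complex.I * g x)) = ee 2 ∘ fun x => (g x).re := by
    funext x
    have : g x = ((g x).re : ℂ) := Complex.ext rfl (by simp [hreal x])
    simp only [Function.comp, ee]
    rw [this, Complex.ofReal_re]; congr 1; push_cast; ring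
  set n := s + 2
  set H : ℝ := n.factorial * (4 * π) ^ n * (2 * π) ^ n with hH
  have h4 : (1:ℝ) ≤ 4 * π := by nlinarith [Real.pi_gt_three]
  have h2 : (1:ℝ) ≤ 2 * π := by nlinarith [Real.pi_gt_three]
  have hH1 : 1 ≤ H := by
    have a1 : (1:ℝ) ≤ n.factorial := by exact_mod_cast Nat.factorial_pos _
    have a2 := one_le_pow₀ h4 (n := n)
    have a3 := one_le_pow₀ h2 (n := n)
    calc (1:ℝ) = 1 * 1 * 1 := by norm_num
      _ ≤ _ := by rw [hH]; gcongr
  have := wn_summable_and_le hSP hK2 s (H := H) (fun x => ?_) (fun x => ?_)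
  · refine this.2.trans_eq ?_
    rw [expConst, ← hH]; ring
  · have e : Complex.exp (4 * π * Complex.I * g x) = ee 2 ((g x).re) := congrFun heq x
    rw [e, norm_ee]; exact hH1
  · rw [heq, ← norm_iteratedFDeriv_eq_norm_iteratedDeriv]
    have := norm_iteratedFDeriv_comp_le (𝕜 := ℝ) (g := ee 2) (f := fun x => (g x).re) (n := n)
      (N := (⊤ : ℕ∞)) (contDiff_ee 2) hgre (by exact_mod_cast le_top) x (C := (4 * π) ^ n)
      (D := 2 * π * K ^ 2) (fun i hi => ?_) (fun i hi1 hi => ?_)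
    · refine this.trans_eq ?_
      rw [hH, mul_pow]; ring
    · rw [norm_iteratedFDeriv_eq_norm_iteratedDeriv, iteratedDeriv_ee]
      simp only [norm_mul, norm_pow, norm_ee, mul_one]
      have : ‖(2:ℂ)‖ * ‖(π:ℂ)‖ * ‖Complex.I‖ * ‖((2:ℤ):ℂ)‖ = 4 * π := by
        simp [abs_of_pos Real.pi_pos]; ring
      rw [this]
      exact pow_le_pow_right₀ h4 hi
    · have h1 := Complex.reCLM.norm_iteratedFDeriv_comp_left (f := g) (x := x) (N := (⊤ : ℕ∞))
        (n := i) hg.1.contDiffAt (by exact_mod_cast le_top)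
      have h3 := norm_iteratedDeriv_le_of_trig hg hK i x
      rw [← norm_iteratedFDeriv_eq_norm_iteratedDeriv] at h3
      have hK0 : 0 ≤ K := by linarith
      calc _ ≤ _ := h1
        _ ≤ 1 * ‖iteratedFDeriv ℝ i g x‖ := by
          gcongr; simp
        _ ≤ (2 * π * K) ^ i * K := by rw [one_mul]; refine h3.trans ?_; gcongr
        _ ≤ (2 * π * K) ^ i * K ^ i := by gcongr; exact le_self_pow₀ hK1 (by omega)
        _ = _ := by rw [← mul_pow]; ring

lemma n0_add_le {u v : ℝ → ℂ} (hu : SP u) (hv : SP v) :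
    n0 (fun x => u x + v x) ≤ n0 u + n0 v := by
  simpa only [wn_zero] using wn_add_le le_rfl 0 hu hv

lemma n0_sub_le {u v : ℝ → ℂ} (hu : SP u) (hv : SP v) :
    n0 (fun x => u x - v x) ≤ n0 u + n0 v := by
  simpa only [wn_zero] using wn_sub_le le_rfl 0 hu hv

lemma n0_shift {u : ℝ → ℂ} (hu : SP u) (a : ℝ) : n0 (fun x => u (x + a)) = n0 u := by
  simpa only [wn_zero] using wn_shift 1 0 hu a

lemma n0_conj (u : ℝ → ℂ) : n0 (fun x => (starRingEnd ℂ) (u x)) = n0 u := by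
  simpa only [wn_zero] using wn_conj 1 0 u

lemma n0_const_mul (c : ℂ) (u : ℝ → ℂ) : n0 (fun x => c * u x) = ‖c‖ * n0 u := by
  simpa only [wn_zero] using wn_const_mul 1 0 c u

/-- The quadratic nonlinearity of the conjugacy equation. -/
noncomputable def quadOp (a : ℝ) (p q r v : ℝ → ℂ) (x : ℝ) : ℂ :=
  p x * v x + q x + r x * (v x * v (x + a))

lemma SP_quadOp (a : ℝ) {p q r v : ℝ → ℂ} (hp : SP p) (hq : SP q) (hr : SP r) (hv : SP v) :
    SP (quadOp a p q r v) :=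
  ((hp.mul hv).add hq).add (hr.mul (hv.mul (hv.shift a)))

lemma n0_quadOp_le (a : ℝ) {p q r v : ℝ → ℂ} (hp : SP p) (hq : SP q) (hr : SP r) (hv : SP v) :
    n0 (quadOp a p q r v) ≤ n0 p * n0 v + n0 q + n0 r * (n0 v * n0 v) := by
  have h1 := n0_add_le ((hp.mul hv).add hq) (hr.mul (hv.mul (hv.shift a)))
  have h2 := n0_add_le (hp.mul hv) hq
  have h3 := n0_mul_le hp hv
  have h4 := n0_mul_le hr (hv.mul (hv.shift a))
  have h5 := n0_mul_le hv (hv.shift a)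
  rw [n0_shift hv] at h5
  have h6 := mul_le_mul_of_nonneg_left h5 (n0_nonneg r)
  have h7 : n0 (quadOp a p q r v) ≤ _ := h1
  linarith

lemma n0_quadOp_sub_le (a : ℝ) {p q r v w : ℝ → ℂ} (hp : SP p) (hr : SP r)
    (hv : SP v) (hw : SP w) :
    n0 (fun x => quadOp a p q r v x - quadOp a p q r w x) ≤
      (n0 p + n0 r * (n0 v + n0 w)) * n0 (fun x => v x - w x) := by
  have hd := hv.sub hw
  have e : (fun x => quadOp a p q r v x - quadOp a p q r w x) = fun x =>
      p x * (v x - w x) + r x * (v x * (v (x + a) - w (x + a)) + (v x - w x) * w (x + a)) := by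
    funext x; simp only [quadOp]; ring
  have s1 := hv.mul (hd.shift a)
  have s2 := hd.mul (hw.shift a)
  have h1 := n0_add_le (hp.mul hd) (hr.mul (s1.add s2))
  have h2 := n0_mul_le hp hd
  have h3 := n0_mul_le hr (s1.add s2)
  have h4 := n0_add_le s1 s2
  have h5 := n0_mul_le hv (hd.shift a)
  have h6 := n0_mul_le hd (hw.shift a)
  rw [n0_shift hd] at h5
  rw [n0_shift hw] at h6
  have h7 := mul_le_mul_of_nonneg_left (h4.trans (add_le_add h5 h6)) (n0_nonneg r)
  rw [e]
  refine h1.trans ?_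
  linarith

/-- Galerkin truncation of the quadratic equation, solved by contraction. -/
lemma exists_galerkin (a : ℝ) (N : ℕ) {d : ℤ → ℂ} {D R : ℝ} (hR : 0 ≤ R) (hD : 0 ≤ D)
    (hd : ∀ k ∈ Finset.Icc (-(N:ℤ)) N, d k ≠ 0 ∧ ‖(d k)⁻¹‖ ≤ D)
    {p q r : ℝ → ℂ} (hp : SP p) (hq : SP q) (hr : SP r)
    (h1 : D * (n0 p + 2 * R * n0 r) ≤ 1 / 2) (h2 : D * n0 q ≤ R / 2) :
    ∃ v : ℝ → ℂ, SP v ∧ n0 v ≤ R ∧ (∀ k ∉ Finset.Icc (-(N:ℤ)) N, fc v k = 0) ∧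
      ∀ k ∈ Finset.Icc (-(N:ℤ)) N, d k * fc v k = fc (quadOp a p q r v) k := by
  classical
  set I := Finset.Icc (-(N:ℤ)) N with hI
  let E : PiLp 1 (fun _ : I => ℂ) → ℤ → ℂ := fun c k => if h : k ∈ I then c ⟨k, h⟩ else 0
  let U : PiLp 1 (fun _ : I => ℂ) → ℝ → ℂ := fun c x => ∑ k ∈ I, E c k * ee k x
  have hU : ∀ c, SP (U c) := fun c => SP_trig _ _
  have hUn : ∀ c, n0 (U c) = ‖c‖ := fun c => by
    rw [n0_trig, PiLp.norm_eq_of_L1, ← Finset.sum_coe_sort]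
    refine Finset.sum_congr rfl fun k _ => ?_
    simp [E]
  have hUs : ∀ c c', (fun x => U c x - U c' x) = U (c - c') := fun c c' => by
    funext x
    simp only [U, ← Finset.sum_sub_distrib]
    refine Finset.sum_congr rfl fun k hk => ?_
    simp only [E, dif_pos hk, PiLp.sub_apply]; ring
  let Φ : PiLp 1 (fun _ : I => ℂ) → PiLp 1 (fun _ : I => ℂ) := fun c => WithLp.toLp 1 fun k : I => (d k)⁻¹ * fc (quadOp a p q r (U c)) k
  have hsum : ∀ w : ℝ → ℂ, SP w → ∑ k : I, ‖(d k)⁻¹ * fc w k‖ ≤ D * n0 w := by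
    intro w hw
    rw [Finset.sum_coe_sort I (fun k => ‖(d k)⁻¹ * fc w k‖)]
    calc _ ≤ ∑ k ∈ I, D * ‖fc w k‖ := by
          refine Finset.sum_le_sum fun k hk => ?_
          rw [norm_mul]
          gcongr
          exact (hd k hk).2
      _ = D * ∑ k ∈ I, ‖fc w k‖ := by rw [Finset.mul_sum]
      _ ≤ _ := by
        gcongr
        exact hw.summable0.sum_le_tsum _ fun _ _ => norm_nonneg _
  have hS : ∀ c, SP (quadOp a p q r (U c)) := fun c => SP_quadOp a hp hq hr (hU c)
  have hp0 := n0_nonneg p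
  have hr0 := n0_nonneg r
  have hmap : Set.MapsTo Φ (Metric.closedBall 0 R) (Metric.closedBall 0 R) := by
    intro c hc
    rw [mem_closedBall_zero_iff] at hc ⊢
    rw [PiLp.norm_eq_of_L1]
    refine (hsum _ (hS c)).trans ?_
    have h3 := n0_quadOp_le a hp hq hr (hU c)
    rw [hUn] at h3
    have hc0 := norm_nonneg c
    calc D * n0 (quadOp a p q r (U c)) ≤ D * (n0 p * R + n0 q + n0 r * (R * R)) := by
          gcongr
          refine h3.trans ?_
          gcongr
      _ ≤ D * (n0 p + 2 * R * n0 r) * R + D * n0 q := by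
          have : 0 ≤ D * (n0 r * (R * R)) := by positivity
          linarith
      _ ≤ 1 / 2 * R + R / 2 := by gcongr
      _ = R := by ring
  have hlip : ContractingWith (1 / 2) (hmap.restrict Φ _ _) := by
    refine ⟨by rw [← NNReal.coe_lt_coe]; norm_num, LipschitzWith.of_dist_le_mul ?_⟩
    rintro ⟨c, hc⟩ ⟨c', hc'⟩
    rw [mem_closedBall_zero_iff] at hc hc'
    simp only [Subtype.dist_eq, Set.MapsTo.val_restrict_apply, dist_eq_norm]
    rw [PiLp.norm_eq_of_L1]
    have h3 := n0_quadOp_sub_le (q := q) a hp hr (hU c) (hU c')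
    rw [hUs, hUn, hUn, hUn] at h3
    have h4 := hsum _ ((hS c).sub (hS c'))
    calc _ = ∑ k : I, ‖(d k)⁻¹ * fc (fun x => quadOp a p q r (U c) x -
              quadOp a p q r (U c') x) k‖ := by
            refine Finset.sum_congr rfl fun k _ => ?_
            rw [fc_sub (hS c) (hS c')]
            simp only [Φ, PiLp.sub_apply]
            congr 1; ring
      _ ≤ _ := h4
      _ ≤ D * ((n0 p + n0 r * (R + R)) * ‖c - c'‖) := by
            gcongr
            refine h3.trans ?_
            gcongr
      _ = D * (n0 p + 2 * R * n0 r) * ‖c - c'‖ := by ring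
      _ ≤ 1 / 2 * ‖c - c'‖ := by gcongr
      _ = _ := by simp
  obtain ⟨c, hc, hfix, -⟩ := hlip.exists_fixedPoint' Metric.isClosed_closedBall.isComplete hmap
    (x := 0) (by simp [hR]) (edist_ne_top _ _)
  refine ⟨U c, hU c, ?_, fun k hk => ?_, fun k hk => ?_⟩
  · rw [hUn]; simpa using hc
  · rw [fc_trig, if_neg hk]
  · rw [fc_trig, if_pos hk]
    have h3 : c ⟨k, hk⟩ = (d k)⁻¹ * fc (quadOp a p q r (U c)) k := by
      conv_lhs => rw [← hfix.eq]
    simp only [E, dif_pos hk, h3]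
    rw [← mul_assoc, mul_inv_cancel₀ (hd k hk).1, one_mul]

lemma wn_mul_tame_of_le {M : ℝ} (hM : 1 ≤ M) (s : ℕ) {u v : ℝ → ℂ} (hu : SP u) (hv : SP v)
    {a A b B : ℝ} (h1 : n0 u ≤ a) (h2 : wn M s u ≤ A) (h3 : n0 v ≤ b) (h4 : wn M s v ≤ B) :
    wn M s (fun x => u x * v x) ≤ 2 ^ s * (A * b + a * B) := by
  have a1 := n0_nonneg u
  have a2 := n0_nonneg v
  have a3 := wn_nonneg hM s u
  have a4 := wn_nonneg hM s v
  refine (wn_mul_tame hM s hu hv).trans ?_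
  gcongr
  · linarith
  · linarith

lemma n0_mul_le_of_le {u v : ℝ → ℂ} (hu : SP u) (hv : SP v)
    {a b : ℝ} (h1 : n0 u ≤ a) (h3 : n0 v ≤ b) : n0 (fun x => u x * v x) ≤ a * b := by
  have a1 := n0_nonneg u
  have a2 := n0_nonneg v
  exact (n0_mul_le hu hv).trans (mul_le_mul h1 h3 a2 (a1.trans h1))

lemma wn_quadOp_le {M : ℝ} (hM : 1 ≤ M) (s : ℕ) (a : ℝ) {p q r v : ℝ → ℂ} (hp : SP p)
    (hq : SP q) (hr : SP r) (hv : SP v) :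
    wn M s (quadOp a p q r v) ≤ 2 ^ s * (wn M s p * n0 v + n0 p * wn M s v) + wn M s q +
      2 ^ s * (wn M s r * (n0 v * n0 v) + n0 r * (2 ^ s * (2 * n0 v * wn M s v))) := by
  have h1 := wn_add_le hM s ((hp.mul hv).add hq) (hr.mul (hv.mul (hv.shift a)))
  have h2 := wn_add_le hM s (hp.mul hv) hq
  have h3 := wn_mul_tame hM s hp hv
  have h5 := wn_mul_tame hM s hv (hv.shift a)
  have h6 := n0_mul_le hv (hv.shift a)
  rw [n0_shift hv, wn_shift M s hv] at h5
  rw [n0_shift hv] at h6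
  have h7 := wn_mul_tame_of_le hM s hr (hv.mul (hv.shift a)) le_rfl le_rfl h6 h5
  have h8 : wn M s (quadOp a p q r v) ≤ _ := h1
  have e : wn M s v * n0 v + n0 v * wn M s v = 2 * n0 v * wn M s v := by ring
  rw [e] at h7
  linarith

/-- Absorption of the nonlinear terms in the weighted norms. -/
lemma wn_galerkin_le {K : ℝ} (s : ℕ) (hKs : 4096 * (2 ^ s * 2 ^ s) ≤ K) (a : ℝ)
    {p q r v : ℝ → ℂ} (hp : SP p) (hq : SP q) (hr : SP r) (hv : SP v)
    (hfc : ∀ k, ‖fc v k‖ ≤ K ^ 24 * ‖fc (quadOp a p q r v) k‖) {b X Y : ℝ} (hb0 : 0 ≤ b)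
    (hY0 : 0 ≤ Y) (hbX : b ≤ X) (hb : b * K ^ 100 ≤ 1) (hv0 : n0 v ≤ K ^ 30 * b)
    (hp0 : n0 p * K ^ 99 ≤ 1) (hps : wn (K ^ 2) s p ≤ 26 * Y)
    (hqs : wn (K ^ 2) s q ≤ K ^ 6 * X)
    (hr0 : n0 r ≤ 2 * K ^ 5 * b) (hrs : wn (K ^ 2) s r ≤ K ^ 7 * (X + b * Y)) :
    wn (K ^ 2) s v ≤ K ^ 56 * (X + b * Y) ∧
      wn (K ^ 2) s (quadOp a p q r v) ≤ K ^ 57 * (X + b * Y) := by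
  have hP : (1:ℝ) ≤ 2 ^ s := one_le_pow₀ (by norm_num)
  set P : ℝ := 2 ^ s with hPdef
  have hK : 4096 ≤ K := by nlinarith
  have hK0 : 0 < K := by linarith
  have hK1 : 1 ≤ K := by linarith
  have hM : 1 ≤ K ^ 2 := one_le_pow₀ hK1
  have hPK : 4096 * P ≤ K := by nlinarith
  have h0 := wn_quadOp_le hM s a hp hq hr hv
  set W := wn (K ^ 2) s (quadOp a p q r v) with hW
  set V := wn (K ^ 2) s v with hV
  have hV0 : 0 ≤ V := wn_nonneg hM s v
  have hVW : V ≤ K ^ 24 * W := wn_le_of_fc_le hM s (SP_quadOp a hp hq hr hv) hfc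
  set Z := X + b * Y with hZ
  have hbY : 0 ≤ b * Y := by positivity
  have hX0 : 0 ≤ X := hb0.trans hbX
  have hZ0 : 0 ≤ Z := by positivity
  have nv := n0_nonneg v
  have np := n0_nonneg p
  have nr := n0_nonneg r
  have npw := wn_nonneg hM s p
  have nrw := wn_nonneg hM s r
  have hvv : n0 v * n0 v ≤ 1 := by
    have h1 : K ^ 30 * b ≤ 1 := by
      calc K ^ 30 * b ≤ K ^ 100 * b := by gcongr; norm_num
        _ ≤ 1 := by linarith
    have h2 : n0 v ≤ 1 := hv0.trans h1
    nlinarith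
  have T1 : P * (wn (K ^ 2) s p * n0 v) ≤ K ^ 31 * Z := by
    calc P * (wn (K ^ 2) s p * n0 v) ≤ P * (26 * Y * (K ^ 30 * b)) := by gcongr
      _ = (26 * P) * (K ^ 30 * (b * Y)) := by ring
      _ ≤ K * (K ^ 30 * Z) := by
        gcongr
        · linarith
        · linarith
      _ = _ := by ring
  have T2 : P * (n0 p * V) * K ^ 24 ≤ 1 / 8 * V := by
    have : P * n0 p * K ^ 24 * 8 ≤ 1 := by
      calc P * n0 p * K ^ 24 * 8 = (8 * P) * (n0 p * K ^ 24) := by ring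
        _ ≤ K * (n0 p * K ^ 24) := by gcongr; linarith
        _ = n0 p * K ^ 25 := by ring
        _ ≤ n0 p * K ^ 99 := by gcongr; norm_num
        _ ≤ 1 := hp0
    nlinarith
  have T3 : wn (K ^ 2) s q ≤ K ^ 31 * Z := by
    refine hqs.trans ?_
    gcongr
    · norm_num
    · linarith
  have T4 : P * (wn (K ^ 2) s r * (n0 v * n0 v)) ≤ K ^ 31 * Z := by
    calc P * (wn (K ^ 2) s r * (n0 v * n0 v)) ≤ K * (K ^ 7 * Z * 1) := by
          gcongr
          linarith
      _ = K ^ 8 * Z := by ring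
      _ ≤ _ := by gcongr; norm_num
  have T5 : P * (n0 r * (P * (2 * n0 v * V))) * K ^ 24 ≤ 1 / 8 * V := by
    have h1 : P * P * (2 * K ^ 5 * b) * (K ^ 30 * b) * K ^ 24 * 16 ≤ 1 := by
      calc P * P * (2 * K ^ 5 * b) * (K ^ 30 * b) * K ^ 24 * 16
          = (32 * (P * P)) * (K ^ 59 * b * b) := by ring
        _ ≤ K * (K ^ 59 * b * b) := by gcongr; nlinarith
        _ = (b * K ^ 30) * (b * K ^ 30) := by ring
        _ ≤ (b * K ^ 100) * (b * K ^ 100) := by gcongr <;> norm_num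
        _ ≤ 1 := by
          have : 0 ≤ b * K ^ 100 := by positivity
          nlinarith
    calc P * (n0 r * (P * (2 * n0 v * V))) * K ^ 24
        ≤ P * (2 * K ^ 5 * b * (P * (2 * (K ^ 30 * b) * V))) * K ^ 24 := by gcongr
      _ = 1 / 8 * (P * P * (2 * K ^ 5 * b) * (K ^ 30 * b) * K ^ 24 * 16) * V := by ring
      _ ≤ 1 / 8 * 1 * V := by gcongr
      _ = _ := by ring
  have hsum : W ≤ 3 * (K ^ 31 * Z) + (P * (n0 p * V) + P * (n0 r * (P * (2 * n0 v * V)))) := by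
    linarith
  have hV1 : V ≤ 4 * K ^ 55 * Z := by
    have h1 : K ^ 24 * W ≤ K ^ 24 * (3 * (K ^ 31 * Z) + (P * (n0 p * V) +
        P * (n0 r * (P * (2 * n0 v * V))))) := by gcongr
    have h2 : K ^ 24 * (3 * (K ^ 31 * Z)) = 3 * (K ^ 55 * Z) := by ring
    linarith
  have hV2 : V ≤ K ^ 56 * Z := by
    refine hV1.trans ?_
    calc 4 * K ^ 55 * Z ≤ K * K ^ 55 * Z := by gcongr; linarith
      _ = _ := by ring
  refine ⟨hV2, ?_⟩
  have hK24 : 1 ≤ K ^ 24 := one_le_pow₀ hK1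
  have a2 : P * (n0 p * V) ≤ P * (n0 p * V) * K ^ 24 := le_mul_of_one_le_right (by positivity) hK24
  have a5 : P * (n0 r * (P * (2 * n0 v * V))) ≤ P * (n0 r * (P * (2 * n0 v * V))) * K ^ 24 :=
    le_mul_of_one_le_right (by positivity) hK24
  have a6 : K ^ 31 * Z ≤ K ^ 56 * Z := by gcongr; norm_num
  have a7 : 4 * (K ^ 56 * Z) ≤ K ^ 57 * Z := by
    calc 4 * (K ^ 56 * Z) ≤ K * (K ^ 56 * Z) := by gcongr; linarith
      _ = _ := by ring
  linarith

/-- The real-linear map `w ↦ c w + d w̄` of the plane. -/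
noncomputable def act (c d w : ℂ) : ℂ := c * w + d * (starRingEnd ℂ) w

lemma exists_coboundary (a : ℝ) {T : Finset ℤ} (hsym : ∀ k ∈ T, -k ∈ T)
    (hne : ∀ k ∈ T, ee k a ≠ 1) {u : ℝ → ℂ} (hreal : ∀ x, (u x).im = 0) :
    ∃ g : ℝ → ℂ, SP g ∧ (∀ x, (g x).im = 0) ∧
      (∀ k, fc g k = if k ∈ T then fc u k / (ee k a - 1) else 0) ∧
      ∀ x, g (x + a) - g x = ∑ k ∈ T, fc u k * ee k x := by
  refine ⟨fun x => ∑ k ∈ T, fc u k / (ee k a - 1) * ee k x, SP_trig _ _, fun x => ?_,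
    fun k => fc_trig _ _ _, fun x => ?_⟩
  · rw [← Complex.conj_eq_iff_im, map_sum]
    have hc : ∀ k, (starRingEnd ℂ) (fc u k) = fc u (-k) := fun k => by
      have h : (fun x => (starRingEnd ℂ) (u x)) = u := by
        funext x; exact Complex.conj_eq_iff_im.2 (hreal x)
      have := fc_conj u (-k)
      rw [h, neg_neg] at this
      exact this.symm
    refine Finset.sum_nbij' (fun k => -k) (fun k => -k) hsym hsym (by simp) (by simp) fun k _ => ?_
    rw [map_mul, map_div₀, map_sub, map_one, hc, ee_neg, ee_neg]
  · rw [← Finset.sum_sub_distrib]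
    refine Finset.sum_congr rfl fun k hk => ?_
    have : ee k a - 1 ≠ 0 := sub_ne_zero.2 (hne k hk)
    rw [ee_add_arg]
    field_simp

/-- One step of the conjugation, at the level of linear maps of the plane. -/
lemma act_conjugation {E β m mT η : ℂ} (hE : E * (starRingEnd ℂ) E = 1) (hm : ‖m‖ < 1)
    (hη : η = (β - mT) * (starRingEnd ℂ) (m * E ^ 2) - mT * (starRingEnd ℂ) β)
    (h1 : 1 + η ≠ 0) {E' β' : ℂ} (hE' : (‖1 + η‖ : ℂ) * E' = E * (1 + η))
    (hβ' : β' * (1 + (starRingEnd ℂ) η) =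
      E ^ 2 * m + β - mT - (starRingEnd ℂ) β * (E ^ 2 * m) * mT) (w : ℂ) :
    ∃ l : ℝ, 0 < l ∧ l = ‖1 + η‖ / (1 - ‖m‖ ^ 2) ∧
      act 1 (-mT) (act E (β * (starRingEnd ℂ) E) w) =
        l * act E' (β' * (starRingEnd ℂ) E') (act 1 (-m) w) := by
  have hm1 : 0 < 1 - ‖m‖ ^ 2 := by
    have := norm_nonneg m
    nlinarith
  have hn : 0 < ‖1 + η‖ := norm_pos_iff.2 h1
  have hnc : (‖1 + η‖ : ℂ) ≠ 0 := by exact_mod_cast hn.ne'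
  have hmc : (1 : ℂ) - ‖m‖ ^ 2 ≠ 0 := by exact_mod_cast hm1.ne'
  refine ⟨‖1 + η‖ / (1 - ‖m‖ ^ 2), div_pos hn hm1, rfl, ?_⟩
  have hEc : (‖1 + η‖ : ℂ) * (starRingEnd ℂ) E' =
      (starRingEnd ℂ) E * (1 + (starRingEnd ℂ) η) := by
    have := congrArg (starRingEnd ℂ) hE'
    simpa using this
  have hmm : (‖m‖ : ℂ) ^ 2 = m * (starRingEnd ℂ) m := (Complex.mul_conj' m).symm
  have hηc : 1 + η = 1 + ((β - mT) * ((starRingEnd ℂ) m * (starRingEnd ℂ) E ^ 2)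
      - mT * (starRingEnd ℂ) β) := by
    rw [hη]; simp
  have key : ((‖1 + η‖ : ℂ)) * act E' (β' * (starRingEnd ℂ) E') (act 1 (-m) w) =
      E * (1 + η) * (w - m * (starRingEnd ℂ) w) + (starRingEnd ℂ) E *
        (E ^ 2 * m + β - mT - (starRingEnd ℂ) β * (E ^ 2 * m) * mT) *
        ((starRingEnd ℂ) w - (starRingEnd ℂ) m * w) := by
    simp only [act, map_add, map_mul, map_neg, Complex.conj_conj, one_mul]
    rw [← hβ']
    linear_combination (w - m * (starRingEnd ℂ) w) * hE' +
      β' * ((starRingEnd ℂ) w - (starRingEnd ℂ) m * w) * hEc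
  push_cast
  rw [div_mul_eq_mul_div, key, eq_div_iff hmc, hηc, hmm]
  simp only [act, map_add, map_mul, Complex.conj_conj, one_mul]
  generalize (starRingEnd ℂ) E = F at *
  generalize (starRingEnd ℂ) m = n at *
  generalize (starRingEnd ℂ) w = z at *
  generalize (starRingEnd ℂ) β = γ at *
  have hF2 : E ^ 2 * F = E := by linear_combination E * hE
  have hE2 : E * F ^ 2 = F := by linear_combination F * hE
  linear_combination (-(w - m * z) * (β - mT) * n) * hE2 -
    ((z - n * w) * m) * (1 - γ * mT) * hF2

lemma wn_mul_le_of_bounds {M K Y : ℝ} (hM : 1 ≤ M) (s : ℕ) {u v : ℝ → ℂ} (hu : SP u)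
    (hv : SP v) (hK : 2 ^ (s + 1) ≤ K) {a A b B : ℝ} (h1 : n0 u ≤ a) (h2 : wn M s u ≤ A)
    (h3 : n0 v ≤ b) (h4 : wn M s v ≤ B) (hAb : A * b ≤ Y) (haB : a * B ≤ Y) :
    wn M s (fun x => u x * v x) ≤ K * Y := by
  have h := wn_mul_tame_of_le hM s hu hv h1 h2 h3 h4
  have a1 := n0_nonneg u
  have a4 := wn_nonneg hM s v
  have hY : 0 ≤ Y := (mul_nonneg (a1.trans h1) (a4.trans h4)).trans haB
  calc _ ≤ 2 ^ s * (A * b + a * B) := h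
    _ ≤ 2 ^ s * (Y + Y) := by gcongr
    _ = 2 ^ (s + 1) * Y := by ring
    _ ≤ K * Y := by gcongr

/-- Norm bounds for the new error and the new phase after one conjugation step. -/
lemma step_bounds {K : ℝ} (s : ℕ) (hKs : 8 ^ (s + 4) ≤ K) (a : ℝ) {e v P H β : ℝ → ℂ}
    (he : SP e) (hv : SP v) (hP : SP P) (hH : SP H) (hβ : SP β) {b Y Z : ℝ} (hb0 : 0 ≤ b)
    (hbZ : b ≤ Z) (hYZ : b * Y ≤ Z) (hb : b * K ^ 100 ≤ 1)
    (e1 : n0 e ≤ K ^ 5) (e2 : wn (K ^ 2) s e ≤ K ^ 5)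
    (v1 : n0 v ≤ K ^ 30 * b) (v2 : wn (K ^ 2) s v ≤ K ^ 56 * Z)
    (P1 : n0 P ≤ 2) (P2 : wn (K ^ 2) s P ≤ 1 + 26 * Y)
    (H1 : n0 H ≤ K ^ 31 * b) (H2 : wn (K ^ 2) s H ≤ K ^ 57 * Z)
    (b1 : n0 β ≤ b) (b2 : wn (K ^ 2) s β ≤ Z) {E0 : ℂ} (hE0 : ‖E0‖ = 1)
    {m y η Er ψ' β' : ℝ → ℂ} (hm : m = fun x => e x * v x)
    (hy : y = fun x => E0 * (e (x + a) * (P x * v x)))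
    (hη : η = fun x => (β x - m (x + a)) * (starRingEnd ℂ) (y x) -
      m (x + a) * (starRingEnd ℂ) (β x))
    (hEr : Er = fun x => e (x + a) * H x)
    (hψ' : ψ' = fun x => (Complex.log (1 + η x) - (starRingEnd ℂ) (Complex.log (1 + η x))) /
      (4 * π * Complex.I))
    (hβ' : β' = fun x => Er x * (starRingEnd ℂ) ((1 + η x)⁻¹)) :
    SP m ∧ SP η ∧ SP ψ' ∧ SP β' ∧ (∀ x, ‖η x‖ < 1) ∧ n0 m ≤ K ^ 35 * b ∧
      wn (K ^ 2) s m ≤ K ^ 80 * Z ∧ wn (K ^ 2) s ψ' ≤ K ^ 80 * Z ∧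
      wn (K ^ 2) s β' ≤ K ^ 80 * Z ∧ n0 β' ≤ K ^ 6 * n0 H := by
  have hp : (1:ℝ) ≤ 8 ^ s := one_le_pow₀ (by norm_num)
  have hK : 4096 ≤ K := by
    have : (8:ℝ) ^ (s + 4) = 8 ^ s * 4096 := by ring
    linarith
  have hp2 : (2:ℝ) ^ (s + 1) ≤ K := by
    calc (2:ℝ) ^ (s + 1) ≤ 8 ^ (s + 1) := by gcongr; norm_num
      _ ≤ 8 ^ (s + 4) := by gcongr <;> norm_num
      _ ≤ K := hKs
  have hK0 : 0 < K := by linarith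
  have hK1 : 1 ≤ K := by linarith
  have hM : 1 ≤ K ^ 2 := one_le_pow₀ hK1
  have hZ0 : 0 ≤ Z := hb0.trans hbZ
  have hkb : ∀ n ≤ 99, K ^ n * b * 4096 ≤ 1 := fun n hn => by
    calc K ^ n * b * 4096 ≤ K ^ n * b * K := by gcongr
      _ = b * K ^ (n + 1) := by ring
      _ ≤ b * K ^ 100 := by gcongr; omega
      _ ≤ 1 := hb
  have hkb1 : ∀ n ≤ 99, K ^ n * b ≤ 1 := fun n hn => by
    have h0 : 0 ≤ K ^ n * b := by positivity
    linarith [hkb n hn]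
  have hkz : ∀ (i j : ℕ), i ≤ j → ∀ X : ℝ, 0 ≤ X → K ^ i * X ≤ K ^ j * X := fun i j hij X hX => by
    gcongr
  have hkz1 : ∀ (i j : ℕ), i + 1 ≤ j → ∀ c X : ℝ, 0 ≤ X → c ≤ 4096 → c * (K ^ i * X) ≤ K ^ j * X :=
    fun i j hij c X hX hc => by
    calc c * (K ^ i * X) ≤ K * (K ^ i * X) := by
          gcongr
          linarith
      _ = K ^ (i + 1) * X := by ring
      _ ≤ K ^ j * X := hkz _ _ hij X hX
  -- the conjugation
  have Sm : SP m := hm ▸ he.mul hv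
  have m1 : n0 m ≤ K ^ 35 * b := by
    rw [hm]
    refine (n0_mul_le_of_le he hv e1 v1).trans (le_of_eq ?_)
    ring
  have m2 : wn (K ^ 2) s m ≤ K ^ 62 * Z := by
    rw [hm]
    refine (wn_mul_le_of_bounds hM s he hv hp2 e1 e2 v1 v2 (Y := K ^ 61 * Z) ?_ ?_).trans
      (le_of_eq ?_)
    · calc K ^ 5 * (K ^ 30 * b) = K ^ 35 * b := by ring
        _ ≤ K ^ 61 * b := hkz _ _ (by norm_num) _ hb0
        _ ≤ _ := by gcongr
    · exact le_of_eq (by ring)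
    · ring
  have SmT : SP (fun x => m (x + a)) := Sm.shift a
  have SeT : SP (fun x => e (x + a)) := he.shift a
  have mT1 : n0 (fun x => m (x + a)) ≤ K ^ 35 * b := by rwa [n0_shift Sm]
  have mT2 : wn (K ^ 2) s (fun x => m (x + a)) ≤ K ^ 62 * Z := by rwa [wn_shift _ s Sm]
  have eT1 : n0 (fun x => e (x + a)) ≤ K ^ 5 := by rwa [n0_shift he]
  have eT2 : wn (K ^ 2) s (fun x => e (x + a)) ≤ K ^ 5 := by rwa [wn_shift _ s he]
  have Pv2 : wn (K ^ 2) s (fun x => P x * v x) ≤ K ^ 58 * Z := by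
    refine (wn_mul_le_of_bounds hM s hP hv hp2 P1 P2 v1 v2 (Y := K ^ 57 * Z) ?_ ?_).trans
      (le_of_eq ?_)
    · calc (1 + 26 * Y) * (K ^ 30 * b) = K ^ 30 * b + 26 * (K ^ 30 * (b * Y)) := by ring
        _ ≤ K ^ 30 * Z + 26 * (K ^ 30 * Z) := by gcongr
        _ = 27 * (K ^ 30 * Z) := by ring
        _ ≤ _ := hkz1 _ _ (by norm_num) _ _ hZ0 (by norm_num)
    · exact hkz1 _ _ (by norm_num) _ _ hZ0 (by norm_num)
    · ring
  have Pv1 : n0 (fun x => P x * v x) ≤ 2 * (K ^ 30 * b) := n0_mul_le_of_le hP hv P1 v1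
  have Sy : SP y := hy ▸ (SP_const E0).mul (SeT.mul (hP.mul hv))
  have y1 : n0 y ≤ K ^ 36 * b := by
    rw [hy, n0_const_mul, hE0, one_mul]
    refine (n0_mul_le_of_le SeT (hP.mul hv) eT1 Pv1).trans ?_
    calc K ^ 5 * (2 * (K ^ 30 * b)) = 2 * (K ^ 35 * b) := by ring
      _ ≤ _ := hkz1 _ _ (by norm_num) _ _ hb0 (by norm_num)
  have y2 : wn (K ^ 2) s y ≤ K ^ 65 * Z := by
    rw [hy, wn_const_mul, hE0, one_mul]
    refine (wn_mul_le_of_bounds hM s SeT (hP.mul hv) hp2 eT1 eT2 Pv1 Pv2 (Y := K ^ 64 * Z)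
      ?_ ?_).trans (le_of_eq ?_)
    · calc K ^ 5 * (2 * (K ^ 30 * b)) = 2 * (K ^ 35 * b) := by ring
        _ ≤ K ^ 64 * b := hkz1 _ _ (by norm_num) _ _ hb0 (by norm_num)
        _ ≤ _ := by gcongr
    · calc K ^ 5 * (K ^ 58 * Z) = K ^ 63 * Z := by ring
        _ ≤ _ := hkz _ _ (by norm_num) _ hZ0
    · ring
  have SD : SP (fun x => β x - m (x + a)) := hβ.sub SmT
  have D1 : n0 (fun x => β x - m (x + a)) ≤ K ^ 36 * b := by
    calc _ ≤ n0 β + n0 (fun x => m (x + a)) := n0_sub_le hβ SmT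
      _ ≤ K ^ 0 * b + K ^ 35 * b := by linarith
      _ ≤ K ^ 35 * b + K ^ 35 * b := by gcongr; norm_num
      _ = 2 * (K ^ 35 * b) := by ring
      _ ≤ _ := hkz1 _ _ (by norm_num) _ _ hb0 (by norm_num)
  have D2 : wn (K ^ 2) s (fun x => β x - m (x + a)) ≤ K ^ 63 * Z := by
    calc _ ≤ wn (K ^ 2) s β + wn (K ^ 2) s (fun x => m (x + a)) := wn_sub_le hM s hβ SmT
      _ ≤ K ^ 0 * Z + K ^ 62 * Z := by linarith
      _ ≤ K ^ 62 * Z + K ^ 62 * Z := by gcongr; norm_num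
      _ = 2 * (K ^ 62 * Z) := by ring
      _ ≤ _ := hkz1 _ _ (by norm_num) _ _ hZ0 (by norm_num)
  have yc1 : n0 (fun x => (starRingEnd ℂ) (y x)) ≤ K ^ 36 * b := by rwa [n0_conj]
  have yc2 : wn (K ^ 2) s (fun x => (starRingEnd ℂ) (y x)) ≤ K ^ 65 * Z := by rwa [wn_conj]
  have bc1 : n0 (fun x => (starRingEnd ℂ) (β x)) ≤ b := by rwa [n0_conj]
  have bc2 : wn (K ^ 2) s (fun x => (starRingEnd ℂ) (β x)) ≤ Z := by rwa [wn_conj]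
  have Sη : SP η := hη ▸ (SD.mul Sy.conj).sub (SmT.mul hβ.conj)
  have η1 : n0 η ≤ K ^ 73 * b * b := by
    rw [hη]
    calc _ ≤ _ := n0_sub_le (SD.mul Sy.conj) (SmT.mul hβ.conj)
      _ ≤ K ^ 36 * b * (K ^ 36 * b) + K ^ 35 * b * b :=
        add_le_add (n0_mul_le_of_le SD Sy.conj D1 yc1) (n0_mul_le_of_le SmT hβ.conj mT1 bc1)
      _ = K ^ 72 * (b * b) + K ^ 35 * (b * b) := by ring
      _ ≤ K ^ 72 * (b * b) + K ^ 72 * (b * b) := by gcongr; norm_num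
      _ = 2 * (K ^ 72 * (b * b)) := by ring
      _ ≤ K ^ 73 * (b * b) := hkz1 _ _ (by norm_num) _ _ (by positivity) (by norm_num)
      _ = _ := by ring
  have η2 : wn (K ^ 2) s η ≤ K ^ 67 * Z := by
    rw [hη]
    have q1 := wn_mul_le_of_bounds hM s SD Sy.conj hp2 D1 D2 yc1 yc2 (Y := K ^ 65 * Z) (by
      calc K ^ 63 * Z * (K ^ 36 * b) = K ^ 36 * b * (K ^ 63 * Z) := by ring
        _ ≤ 1 * (K ^ 63 * Z) := mul_le_mul_of_nonneg_right (hkb1 36 (by norm_num)) (mul_nonneg (pow_nonneg hK0.le _) hZ0)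
        _ = K ^ 63 * Z := one_mul _
        _ ≤ _ := hkz _ _ (by norm_num) _ hZ0) (by
      calc K ^ 36 * b * (K ^ 65 * Z) ≤ 1 * (K ^ 65 * Z) :=
            mul_le_mul_of_nonneg_right (hkb1 36 (by norm_num)) (mul_nonneg (pow_nonneg hK0.le _) hZ0)
        _ = _ := one_mul _)
    have q2 := wn_mul_le_of_bounds hM s SmT hβ.conj hp2 mT1 mT2 bc1 bc2 (Y := K ^ 65 * Z) (by
      calc K ^ 62 * Z * b = K ^ 62 * b * Z := by ring
        _ ≤ 1 * Z := by gcongr; exact hkb1 _ (by norm_num)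
        _ = K ^ 0 * Z := by ring
        _ ≤ _ := hkz _ _ (by norm_num) _ hZ0) (by
      calc K ^ 35 * b * Z ≤ 1 * Z := by gcongr; exact hkb1 _ (by norm_num)
        _ = K ^ 0 * Z := by ring
        _ ≤ _ := hkz _ _ (by norm_num) _ hZ0)
    calc _ ≤ _ := wn_sub_le hM s (SD.mul Sy.conj) (SmT.mul hβ.conj)
      _ ≤ K * (K ^ 65 * Z) + K * (K ^ 65 * Z) := add_le_add q1 q2
      _ = 2 * (K ^ 66 * Z) := by ring
      _ ≤ _ := hkz1 _ _ (by norm_num) _ _ hZ0 (by norm_num)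
  have hbb : b * 4096 ≤ 1 := by simpa using hkb 0 (by norm_num)
  have ηs : 2 ^ (s + 1) * n0 η ≤ 1 / 4 := by
    have nη := n0_nonneg η
    calc 2 ^ (s + 1) * n0 η ≤ K * (K ^ 73 * b * b) := by gcongr
      _ = K ^ 74 * b * b := by ring
      _ ≤ 1 * b := by gcongr; exact hkb1 _ (by norm_num)
      _ ≤ _ := by linarith
  have ηs2 : 2 ^ (s + 1) * n0 η ≤ 1 / 2 := by linarith
  have η0 : 2 ^ (0 + 1) * n0 η ≤ 1 / 2 := by
    have nη := n0_nonneg η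
    calc 2 ^ (0 + 1) * n0 η ≤ 2 ^ (s + 1) * n0 η := by gcongr <;> norm_num
      _ ≤ _ := ηs2
  have hlt := norm_lt_one_of_small Sη ηs2
  -- the phase
  have SL := Sη.log_one_add hlt
  have SLs := SL.sub SL.conj
  have Sψ : SP ψ' := by
    have := (SP_const ((4 * π * Complex.I)⁻¹)).mul SLs
    rw [hψ']
    convert this using 2
    rw [div_eq_inv_mul]
  have ψ2 : wn (K ^ 2) s ψ' ≤ K ^ 80 * Z := by
    have h1 := wn_log_one_add_le hM s Sη ηs2
    have h2 := wn_sub_le hM s SL SL.conj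
    rw [wn_conj] at h2
    have h3 : ψ' = fun x => (4 * π * Complex.I)⁻¹ *
        (Complex.log (1 + η x) - (starRingEnd ℂ) (Complex.log (1 + η x))) := by
      rw [hψ']; funext x; rw [div_eq_inv_mul]
    have h4 : ‖(4 * π * Complex.I : ℂ)⁻¹‖ ≤ 1 := by
      rw [norm_inv]
      refine inv_le_one_of_one_le₀ ?_
      simp only [norm_mul, Complex.norm_I, Complex.norm_real, Complex.norm_ofNat, norm_eq_abs,
        abs_of_pos pi_pos]
      linarith [pi_gt_three]
    rw [h3, wn_const_mul]
    have h5 : 0 ≤ wn (K ^ 2) s (fun x => Complex.log (1 + η x) -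
      (starRingEnd ℂ) (Complex.log (1 + η x))) := wn_nonneg hM s _
    calc _ ≤ 1 * wn (K ^ 2) s (fun x => Complex.log (1 + η x) -
          (starRingEnd ℂ) (Complex.log (1 + η x))) := by gcongr
      _ ≤ 4 * (K ^ 67 * Z) := by linarith
      _ ≤ _ := hkz1 _ _ (by norm_num) _ _ hZ0 (by norm_num)
  -- the error
  have SEr : SP Er := hEr ▸ SeT.mul hH
  have Er1 : n0 Er ≤ K ^ 5 * n0 H := by
    rw [hEr]
    exact n0_mul_le_of_le SeT hH eT1 le_rfl
  have Er2 : wn (K ^ 2) s Er ≤ K ^ 63 * Z := by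
    rw [hEr]
    refine (wn_mul_le_of_bounds hM s SeT hH hp2 eT1 eT2 H1 H2 (Y := K ^ 62 * Z) ?_ ?_).trans
      (le_of_eq ?_)
    · calc K ^ 5 * (K ^ 31 * b) = K ^ 36 * b := by ring
        _ ≤ K ^ 62 * b := hkz _ _ (by norm_num) _ hb0
        _ ≤ _ := by gcongr
    · exact le_of_eq (by ring)
    · ring
  have Si := (Sη.inv_one_add hlt).sub (SP_const 1)
  have i2 := wn_inv_one_add_sub_one_le hM s Sη ηs2
  have i1 : n0 (fun x => (1 + η x)⁻¹ - 1) ≤ 1 := by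
    have := wn_inv_one_add_sub_one_le hM 0 Sη η0
    rw [wn_zero, wn_zero] at this
    linarith
  have ic1 : n0 (fun x => (starRingEnd ℂ) ((1 + η x)⁻¹ - 1)) ≤ 1 := by rwa [n0_conj]
  have ic2 : wn (K ^ 2) s (fun x => (starRingEnd ℂ) ((1 + η x)⁻¹ - 1)) ≤ 2 * (K ^ 67 * Z) := by
    rw [wn_conj]
    linarith
  have hβ2 : β' = fun x => Er x + Er x * (starRingEnd ℂ) ((1 + η x)⁻¹ - 1) := by
    rw [hβ']; funext x
    simp only [map_sub, map_one]; ring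
  have SErc : SP (fun x => Er x * (starRingEnd ℂ) ((1 + η x)⁻¹ - 1)) := SEr.mul Si.conj
  refine ⟨Sm, Sη, Sψ, hβ2 ▸ SEr.add SErc, hlt, m1,
    m2.trans (hkz _ _ (by norm_num) _ hZ0), ψ2, ?_, ?_⟩
  · rw [hβ2]
    have Er1' : n0 Er ≤ K ^ 36 * b := by
      calc n0 Er ≤ K ^ 5 * n0 H := Er1
        _ ≤ K ^ 5 * (K ^ 31 * b) := by gcongr
        _ = _ := by ring
    have q := wn_mul_le_of_bounds hM s SEr Si.conj hp2 Er1' Er2 ic1 ic2 (Y := K ^ 68 * Z) (by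
      calc K ^ 63 * Z * 1 = K ^ 63 * Z := mul_one _
        _ ≤ _ := hkz _ _ (by norm_num) _ hZ0) (by
      calc K ^ 36 * b * (2 * (K ^ 67 * Z)) ≤ 1 * (2 * (K ^ 67 * Z)) := by
            exact mul_le_mul_of_nonneg_right (hkb1 36 (by norm_num)) (mul_nonneg zero_le_two (mul_nonneg (pow_nonneg hK0.le _) hZ0))
        _ = 2 * (K ^ 67 * Z) := one_mul _
        _ ≤ _ := hkz1 _ _ (by norm_num) _ _ hZ0 (by norm_num))
    calc _ ≤ _ := wn_add_le hM s SEr SErc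
      _ ≤ K ^ 63 * Z + K * (K ^ 68 * Z) := add_le_add Er2 q
      _ = K ^ 63 * Z + K ^ 69 * Z := by ring
      _ ≤ K ^ 69 * Z + K ^ 69 * Z := by gcongr; norm_num
      _ = 2 * (K ^ 69 * Z) := by ring
      _ ≤ _ := hkz1 _ _ (by norm_num) _ _ hZ0 (by norm_num)
  · rw [hβ2]
    have nH := n0_nonneg H
    calc _ ≤ _ := n0_add_le SEr SErc
      _ ≤ K ^ 5 * n0 H + K ^ 5 * n0 H * 1 :=
        add_le_add Er1 (n0_mul_le_of_le SEr Si.conj Er1 ic1)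
      _ = 2 * (K ^ 5 * n0 H) := by ring
      _ ≤ _ := hkz1 _ _ (by norm_num) _ _ nH (by norm_num)

/-- Solution, up to high Fourier modes, of the conjugacy equation in reduced coordinates. -/
lemma exists_reduced_solution {K : ℝ} (hK : 4096 ≤ K) (a : ℝ) {N : ℕ} (hN : 1 ≤ N) {E0 : ℂ}
    (hE0 : ‖E0‖ = 1)
    (hd : ∀ k : ℤ, |k| ≤ N → 1 ≤ K ^ 24 * ‖ee k a - E0‖) {e p β : ℝ → ℂ} (he : SP e)
    (hp : SP p) (hβ : SP β) (e1 : n0 e ≤ K ^ 5) (p1 : n0 p * K ^ 99 ≤ 1)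
    (hb : n0 β * K ^ 100 ≤ 1) :
    ∃ v H : ℝ → ℂ, SP v ∧ SP H ∧ n0 v ≤ K ^ 30 * n0 β ∧ n0 H ≤ K ^ 31 * n0 β ∧
      (∀ x, H x = E0 * (1 + p x) * v x + (starRingEnd ℂ) (e (x + a)) * β x - v (x + a) -
        (starRingEnd ℂ) (β x) * E0 * (1 + p x) * e (x + a) * v x * v (x + a)) ∧
      ∀ s : ℕ, 8 ^ (s + 4) ≤ K → ∀ Y : ℝ, 0 ≤ Y → wn (K ^ 2) s e ≤ K ^ 5 →
        wn (K ^ 2) s p ≤ 26 * Y →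
        wn (K ^ 2) s v ≤ K ^ 56 * (wn (K ^ 2) s β + n0 β * Y) ∧
        wn (K ^ 2) s H ≤ K ^ 57 * (wn (K ^ 2) s β + n0 β * Y) ∧
        n0 H ≤ (K ^ 2 / N) ^ s * (K ^ 57 * (wn (K ^ 2) s β + n0 β * Y)) := by
  have hK0 : 0 < K := by linarith
  have hK1 : 1 ≤ K := by linarith
  have hM : 1 ≤ K ^ 2 := one_le_pow₀ hK1
  have hb0 := n0_nonneg β
  set b := n0 β with hbdef
  have hp0 := n0_nonneg p
  have SeT := he.shift a
  have eT1 : n0 (fun x => e (x + a)) ≤ K ^ 5 := by rwa [n0_shift he]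
  set q : ℝ → ℂ := fun x => (starRingEnd ℂ) (e (x + a)) * β x with hq
  set P : ℝ → ℂ := fun x => 1 + p x with hP
  set p' : ℝ → ℂ := fun x => E0 * p x with hp'
  set r : ℝ → ℂ := fun x => (-E0) * ((starRingEnd ℂ) (q x) * P x) with hr
  have Sq : SP q := SeT.conj.mul hβ
  have SPP : SP P := (SP_const 1).add hp
  have Sp' : SP p' := (SP_const E0).mul hp
  have Sr : SP r := (SP_const (-E0)).mul (Sq.conj.mul SPP)
  have nP : n0 P ≤ 2 := by
    have h1 : n0 p ≤ 1 := by
      calc n0 p ≤ n0 p * K ^ 99 := le_mul_of_one_le_right hp0 (one_le_pow₀ hK1)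
        _ ≤ 1 := p1
    have h2 := n0_add_le (SP_const 1) hp
    have h3 : n0 (fun _ : ℝ => (1:ℂ)) = 1 := by
      simpa only [wn_zero, norm_one] using wn_const 1 0 1
    linarith
  have eTc1 : n0 (fun x => (starRingEnd ℂ) (e (x + a))) ≤ K ^ 5 := by rwa [n0_conj]
  have nq : n0 q ≤ K ^ 5 * b := n0_mul_le_of_le SeT.conj hβ eTc1 le_rfl
  have nqc : n0 (fun x => (starRingEnd ℂ) (q x)) ≤ K ^ 5 * b := by rwa [n0_conj]
  have np' : n0 p' = n0 p := by rw [hp', n0_const_mul, hE0, one_mul]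
  have nr : n0 r ≤ 2 * K ^ 5 * b := by
    rw [hr, n0_const_mul, norm_neg, hE0, one_mul]
    exact (n0_mul_le_of_le Sq.conj SPP nqc nP).trans (le_of_eq (by ring))
  have hkb : ∀ n ≤ 99, K ^ n * b * 4096 ≤ 1 := fun n hn => by
    calc K ^ n * b * 4096 ≤ K ^ n * b * K := by gcongr
      _ = b * K ^ (n + 1) := by ring
      _ ≤ b * K ^ 100 := by gcongr; omega
      _ ≤ 1 := hb
  have hmem : ∀ k : ℤ, k ∈ Finset.Icc (-(N:ℤ)) N ↔ |k| ≤ N := fun k => by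
    rw [Finset.mem_Icc, abs_le]
  obtain ⟨v, Sv, v1, v2, v3⟩ := exists_galerkin a N (d := fun k => ee k a - E0) (D := K ^ 24)
    (R := 2 * K ^ 29 * b) (by positivity) (by positivity) (fun k hk => by
      have h := hd k ((hmem k).1 hk)
      have h0 : ee k a - E0 ≠ 0 := by
        intro h0
        rw [h0, norm_zero, mul_zero] at h
        linarith
      refine ⟨h0, ?_⟩
      rw [norm_inv, inv_le_comm₀ (norm_pos_iff.2 h0) (by positivity)]
      rw [inv_le_iff_one_le_mul₀ (by positivity)]
      linarith) Sp' Sq Sr (by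
      rw [np']
      have h1 : K ^ 24 * n0 p * 4096 ≤ 1 := by
        calc K ^ 24 * n0 p * 4096 ≤ K ^ 24 * n0 p * K := by gcongr
          _ = n0 p * K ^ 25 := by ring
          _ ≤ n0 p * K ^ 99 := by gcongr; norm_num
          _ ≤ 1 := p1
      have h2 := hkb 58 (by norm_num)
      have h3 := hkb 0 (by norm_num)
      have h0 := n0_nonneg r
      calc K ^ 24 * (n0 p + 2 * (2 * K ^ 29 * b) * n0 r)
          ≤ K ^ 24 * (n0 p + 2 * (2 * K ^ 29 * b) * (2 * K ^ 5 * b)) := by gcongr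
        _ = K ^ 24 * n0 p + 8 * (K ^ 58 * b) * b := by ring
        _ ≤ K ^ 24 * n0 p + 8 * 1 * b := by gcongr; linarith [show 0 ≤ K ^ 58 * b by positivity]
        _ ≤ 1 / 2 := by linarith) (by
      calc K ^ 24 * n0 q ≤ K ^ 24 * (K ^ 5 * b) := by gcongr
        _ = 2 * K ^ 29 * b / 2 := by ring
        _ ≤ _ := le_rfl)
  have SF := SP_quadOp a Sp' Sq Sr Sv
  have v4 : n0 v ≤ K ^ 30 * b := by
    calc n0 v ≤ 2 * (K ^ 29 * b) := by linarith
      _ ≤ K * (K ^ 29 * b) := by gcongr; linarith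
      _ = _ := by ring
  have hfc : ∀ k, ‖fc v k‖ ≤ K ^ 24 * ‖fc (quadOp a p' q r v) k‖ := fun k => by
    by_cases hk : k ∈ Finset.Icc (-(N:ℤ)) N
    · rw [← v3 k hk, norm_mul]
      have h := hd k ((hmem k).1 hk)
      have h0 := norm_nonneg (fc v k)
      calc ‖fc v k‖ ≤ (K ^ 24 * ‖ee k a - E0‖) * ‖fc v k‖ := le_mul_of_one_le_left h0 h
        _ = _ := by ring
    · rw [v2 k hk, norm_zero]; positivity
  set H : ℝ → ℂ := fun x => quadOp a p' q r v x - (v (x + a) - E0 * v x) with hH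
  have SH : SP H := SF.sub ((Sv.shift a).sub ((SP_const E0).mul Sv))
  have fH : ∀ k, fc H k = if k ∈ Finset.Icc (-(N:ℤ)) N then 0 else fc (quadOp a p' q r v) k :=
    fun k => by
    rw [hH, fc_sub SF ((Sv.shift a).sub ((SP_const E0).mul Sv)),
      fc_sub (Sv.shift a) ((SP_const E0).mul Sv), fc_shift Sv, fc_const_mul]
    split_ifs with hk
    · rw [← v3 k hk]; ring
    · rw [v2 k hk]; ring
  have fH1 : ∀ k, ‖fc H k‖ ≤ ‖fc (quadOp a p' q r v) k‖ := fun k => by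
    rw [fH]; split_ifs
    · rw [norm_zero]; exact norm_nonneg _
    · rfl
  refine ⟨v, H, Sv, SH, v4, ?_, fun x => ?_, fun s hs Y hY We Wp => ?_⟩
  · have h1 := wn_le_of_fc_le (M := 1) le_rfl 0 (u := H) SF (C := 1) (by simpa using fH1)
    rw [wn_zero, wn_zero, one_mul] at h1
    have h2 := n0_quadOp_le a Sp' Sq Sr Sv
    have nv0 := n0_nonneg v
    have nr0 := n0_nonneg r
    have a1 : n0 p' * n0 v ≤ 1 * (K ^ 30 * b) := by
      gcongr
      rw [np']
      calc n0 p ≤ n0 p * K ^ 99 := le_mul_of_one_le_right hp0 (one_le_pow₀ hK1)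
        _ ≤ 1 := p1
    have a2 : n0 r * (n0 v * n0 v) ≤ 2 * K ^ 5 * b * (K ^ 30 * b * (K ^ 30 * b)) := by gcongr
    have h3 := hkb 35 (by norm_num)
    have h4 := hkb 30 (by norm_num)
    have a3 : 2 * K ^ 5 * b * (K ^ 30 * b * (K ^ 30 * b)) ≤ 2 * 1 * (1 * (K ^ 30 * b)) := by
      calc 2 * K ^ 5 * b * (K ^ 30 * b * (K ^ 30 * b)) =
          2 * (K ^ 35 * b) * (b * (K ^ 30 * b)) := by ring
        _ ≤ _ := by
          gcongr
          · linarith [show 0 ≤ K ^ 35 * b by positivity]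
          · linarith [hkb 0 (by norm_num)]
    have a4 : K ^ 5 * b ≤ K ^ 30 * b := by gcongr; norm_num
    calc n0 H ≤ 4 * (K ^ 30 * b) := by linarith
      _ ≤ K * (K ^ 30 * b) := by gcongr; linarith
      _ = _ := by ring
  · simp only [hH, quadOp, hp', hq, hr, hP, map_mul, Complex.conj_conj]
    ring
  · have hp8 : (1:ℝ) ≤ 8 ^ s := one_le_pow₀ (by norm_num)
    have h22 : 4096 * (2 ^ s * 2 ^ s) ≤ K := by
      refine le_trans ?_ hs
      rw [← mul_pow, pow_add]
      calc (4096:ℝ) * (2 * 2) ^ s ≤ 4096 * 8 ^ s := by gcongr; norm_num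
        _ = _ := by ring
    have h2 : (2:ℝ) ^ (s + 1) ≤ K := by
      calc (2:ℝ) ^ (s + 1) ≤ 8 ^ (s + 1) := by gcongr; norm_num
        _ ≤ 8 ^ (s + 4) := by gcongr <;> norm_num
        _ ≤ K := hs
    have h29 : 29 * 2 ^ s ≤ K := by
      refine le_trans ?_ hs
      rw [pow_add]
      calc (29:ℝ) * 2 ^ s ≤ 4096 * 8 ^ s := by gcongr <;> norm_num
        _ = _ := by ring
    set X := wn (K ^ 2) s β with hX
    have hbX : b ≤ X := n0_le_wn hM s hβ
    have hbY : 0 ≤ b * Y := mul_nonneg hb0 hY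
    have eT2 : wn (K ^ 2) s (fun x => (starRingEnd ℂ) (e (x + a))) ≤ K ^ 5 := by
      rwa [wn_conj, wn_shift _ s he]
    have Wq : wn (K ^ 2) s q ≤ K ^ 6 * X := by
      refine (wn_mul_le_of_bounds hM s SeT.conj hβ h2 eTc1 eT2 le_rfl le_rfl
        (Y := K ^ 5 * X) ?_ le_rfl).trans (le_of_eq (by ring))
      gcongr
    have WP : wn (K ^ 2) s P ≤ 1 + 26 * Y := by
      have h2 := wn_add_le hM s (SP_const 1) hp
      have h3 := wn_const (K ^ 2) s 1
      rw [norm_one] at h3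
      linarith
    have Wr : wn (K ^ 2) s r ≤ K ^ 7 * (X + b * Y) := by
      rw [hr, wn_const_mul, norm_neg, hE0, one_mul]
      have Wqc : wn (K ^ 2) s (fun x => (starRingEnd ℂ) (q x)) ≤ K ^ 6 * X := by rwa [wn_conj]
      refine (wn_mul_tame_of_le hM s Sq.conj SPP nqc Wqc nP WP).trans ?_
      have i1 : K ^ 5 * b ≤ K ^ 6 * X := by gcongr; norm_num
      have i2 : K ^ 5 * (b * Y) ≤ K ^ 6 * (b * Y) := by gcongr; norm_num
      have i3 : 0 ≤ K ^ 6 * (b * Y) := by positivity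
      have i4 : 0 ≤ K ^ 6 * X := mul_nonneg (by positivity) (hb0.trans hbX)
      calc 2 ^ s * (K ^ 6 * X * 2 + K ^ 5 * b * (1 + 26 * Y))
          = 2 ^ s * (2 * (K ^ 6 * X) + K ^ 5 * b + 26 * (K ^ 5 * (b * Y))) := by ring
        _ ≤ 2 ^ s * (29 * (K ^ 6 * X + K ^ 6 * (b * Y))) := by
          gcongr
          linarith
        _ = 29 * 2 ^ s * (K ^ 6 * X + K ^ 6 * (b * Y)) := by ring
        _ ≤ K * (K ^ 6 * X + K ^ 6 * (b * Y)) := by gcongr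
        _ = _ := by ring
    have Wp' : wn (K ^ 2) s p' ≤ 26 * Y := by rwa [hp', wn_const_mul, hE0, one_mul]
    obtain ⟨V, F⟩ := wn_galerkin_le s h22 a Sp' Sq Sr Sv hfc hb0 hY hbX hb v4
      (by rwa [np']) Wp' Wq nr Wr
    refine ⟨V, ?_, ?_⟩
    · have := wn_le_of_fc_le hM s (u := H) SF (C := 1) (by simpa using fH1)
      linarith
    · have hN0 : (0:ℝ) < N := by exact_mod_cast hN
      refine (n0_high_le hM hN0 s SF (v := H) (fun k hk => ⟨?_, fH1 k⟩) SH).trans (by gcongr)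
      by_contra hlt
      refine hk ?_
      rw [fH, if_pos]
      rw [hmem]
      have : |(k:ℝ)| < N := not_le.1 hlt
      have h3 : ((|k| : ℤ) : ℝ) < ((N : ℤ) : ℝ) := by simpa using this
      exact (by exact_mod_cast h3 : |k| < (N:ℤ)).le

lemma expConst_nonneg (s : ℕ) : 0 ≤ expConst s := by
  unfold expConst; positivity

/-- Threshold above which one conjugation step controls the norm of order `s`. -/
noncomputable def kamThr (s : ℕ) : ℝ := 8 ^ (s + 4) * (1 + expConst s + expConst 0)

lemma le_of_kamThr_le {K : ℝ} {s : ℕ} (h : kamThr s ≤ K) :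
    8 ^ (s + 4) ≤ K ∧ 4096 ≤ K ∧ expConst s ≤ K ∧ expConst 0 ≤ K := by
  have h1 := expConst_nonneg s
  have h2 := expConst_nonneg 0
  have hp : (4096:ℝ) ≤ 8 ^ (s + 4) := by
    calc (4096:ℝ) = 8 ^ (0 + 4) := by norm_num
      _ ≤ _ := by gcongr <;> norm_num
  have h3 : kamThr s = 8 ^ (s + 4) + 8 ^ (s + 4) * expConst s + 8 ^ (s + 4) * expConst 0 := by
    unfold kamThr; ring
  have h4 : expConst s ≤ 8 ^ (s + 4) * expConst s := le_mul_of_one_le_left h1 (by linarith)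
  have h5 : expConst 0 ≤ 8 ^ (s + 4) * expConst 0 := le_mul_of_one_le_left h2 (by linarith)
  refine ⟨?_, ?_, ?_, ?_⟩ <;> linarith

/-- The rotation part of the fibre map. -/
noncomputable def phaseExp (ρ : ℝ) (ψ : ℝ → ℂ) (x : ℝ) : ℂ :=
  Complex.exp (2 * π * Complex.I * (ρ + ψ x))

/-- The fibre map `w ↦ E w + β conj (E w)` with `E = exp(2πi(ρ+ψ))`. -/
noncomputable def fibreMap (ρ : ℝ) (ψ β : ℝ → ℂ) (x : ℝ) (w : ℂ) : ℂ :=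
  act (phaseExp ρ ψ x) (β x * (starRingEnd ℂ) (phaseExp ρ ψ x)) w

lemma phaseExp_mul_conj (ρ : ℝ) {ψ : ℝ → ℂ} {x : ℝ} (h : (ψ x).im = 0) :
    phaseExp ρ ψ x * (starRingEnd ℂ) (phaseExp ρ ψ x) = 1 := by
  rw [phaseExp, ← Complex.exp_conj, ← Complex.exp_add]
  have : (starRingEnd ℂ) (ψ x) = ψ x := Complex.conj_eq_iff_im.2 h
  simp only [map_mul, map_add, Complex.conj_I, Complex.conj_ofReal, this, Complex.conj_ofNat]
  rw [Complex.exp_eq_one_iff]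
  exact ⟨0, by push_cast; ring⟩

lemma im_sub_conj_div (z : ℂ) :
    (z - (starRingEnd ℂ) z) / (4 * π * Complex.I) = ((z.im / (2 * π) : ℝ) : ℂ) := by
  rw [Complex.sub_conj]
  have : (π:ℂ) ≠ 0 := by exact_mod_cast pi_ne_zero
  have h2 := Complex.I_ne_zero
  push_cast
  field_simp
  ring

lemma norm_mul_exp_arg (z : ℂ) :
    (‖z‖ : ℂ) * Complex.exp (2 * π * Complex.I *
      ((Complex.log z - (starRingEnd ℂ) (Complex.log z)) / (4 * π * Complex.I))) = z := by
  rw [im_sub_conj_div, Complex.log_im]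
  conv_rhs => rw [← Complex.norm_mul_exp_arg_mul_I z]
  congr 2
  have : (π:ℂ) ≠ 0 := by exact_mod_cast pi_ne_zero
  push_cast
  field_simp

/-- Projection on the complement of a set of modes. -/
lemma sub_trig_bounds {M : ℝ} (hM : 1 ≤ M) (s : ℕ) (T : Finset ℤ) {u : ℝ → ℂ} (hu : SP u) :
    SP (fun x => u x - ∑ k ∈ T, fc u k * ee k x) ∧
      wn M s (fun x => u x - ∑ k ∈ T, fc u k * ee k x) ≤ wn M s u := by
  refine ⟨hu.sub (SP_trig _ _), ?_⟩
  have := wn_le_of_fc_le hM s hu (u := fun x => u x - ∑ k ∈ T, fc u k * ee k x) (C := 1)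
    fun k => by
      rw [fc_sub hu (SP_trig _ _), fc_trig]
      split_ifs
      · rw [sub_self, norm_zero]; positivity
      · simp
  linarith

/-- One step of the renormalised conjugation scheme. -/
theorem kam_step {K ρ a : ℝ} {N : ℕ} (hN : 1 ≤ N) (hK : kamThr 0 ≤ K) {T : Finset ℤ}
    (hsym : ∀ k ∈ T, -k ∈ T) (hT : ∀ k ∈ T, |(k:ℝ)| ≤ K ∧ 1 ≤ K * ‖ee k a - 1‖)
    (hd : ∀ k : ℤ, |k| ≤ N → 1 ≤ K ^ 24 * ‖ee k a - Complex.exp (4 * π * Complex.I * ρ)‖)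
    {ψ β : ℝ → ℂ} (hψ : SP ψ) (hβ : SP β) (hreal : ∀ x, (ψ x).im = 0)
    (hb : n0 β * K ^ 100 ≤ 1) (hψ1 : n0 ψ ≤ 1)
    (hψ2 : n0 (fun x => ψ x - ∑ k ∈ T, fc ψ k * ee k x) * K ^ 100 ≤ 3) :
    ∃ m ψ' β' : ℝ → ℂ, SP m ∧ SP ψ' ∧ SP β' ∧ (∀ x, (ψ' x).im = 0) ∧ (∀ x, ‖m x‖ < 1) ∧
      n0 m ≤ K ^ 35 * n0 β ∧
      (∀ x w, ∃ l : ℝ, 0 < l ∧ act 1 (-m (x + a)) (fibreMap ρ ψ β x w) =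
        l * fibreMap ρ ψ' β' x (act 1 (-m x) w)) ∧
      ∀ s : ℕ, kamThr s ≤ K →
        wn (K ^ 2) s m ≤ K ^ 80 * (wn (K ^ 2) s β + n0 β * wn (K ^ 2) s ψ) ∧
        wn (K ^ 2) s (fun x => ψ' x - ψ x) ≤
          K ^ 80 * (wn (K ^ 2) s β + n0 β * wn (K ^ 2) s ψ) ∧
        wn (K ^ 2) s β' ≤ K ^ 80 * (wn (K ^ 2) s β + n0 β * wn (K ^ 2) s ψ) ∧
        n0 β' ≤ (K ^ 2 / N) ^ s * (K ^ 80 * (wn (K ^ 2) s β + n0 β * wn (K ^ 2) s ψ)) := by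
  obtain ⟨-, hK4, -, hE0K⟩ := le_of_kamThr_le hK
  have hK0 : 0 < K := by linarith
  have hK1 : 1 ≤ K := by linarith
  have hM : 1 ≤ K ^ 2 := one_le_pow₀ hK1
  obtain ⟨g, Sg, greal, gfc, gco⟩ := exists_coboundary a hsym (fun k hk h => by
    have := (hT k hk).2
    rw [h, sub_self, norm_zero, mul_zero] at this
    linarith) hreal
  have gsmall : n0 g ≤ K := by
    have h1 := wn_le_of_fc_le (M := 1) le_rfl 0 (u := g) hψ (C := K) fun k => by
      rw [gfc]
      split_ifs with hk
      · have h := (hT k hk).2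
        have h0 : 0 < ‖ee k a - 1‖ := by
          by_contra h0
          nlinarith [norm_nonneg (ee k a - 1)]
        rw [norm_div, div_le_iff₀ h0]
        calc ‖fc ψ k‖ ≤ (K * ‖ee k a - 1‖) * ‖fc ψ k‖ :=
              le_mul_of_one_le_left (norm_nonneg _) h
          _ = _ := by ring
      · rw [norm_zero]; positivity
    rw [wn_zero, wn_zero] at h1
    nlinarith
  have gfc0 : ∀ k : ℤ, K < |(k:ℝ)| → fc g k = 0 := fun k hk => by
    rw [gfc, if_neg]
    exact fun h => not_lt.2 (hT k h).1 hk
  set e : ℝ → ℂ := fun x => Complex.exp (4 * π * Complex.I * g x) with he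
  have Se : SP e := ((SP_const (4 * π * Complex.I)).mul Sg).cexp
  have We : ∀ s, expConst s ≤ K → wn (K ^ 2) s e ≤ K ^ 5 := fun s hs => by
    calc _ ≤ expConst s * K ^ 4 := wn_exp_trig_le s Sg hK1 greal gfc0 gsmall
      _ ≤ K * K ^ 4 := by gcongr
      _ = _ := by ring
  have ne : n0 e ≤ K ^ 5 := by simpa only [wn_zero] using We 0 hE0K
  obtain ⟨Sh, -⟩ := sub_trig_bounds le_rfl 0 T hψ
  set h : ℝ → ℂ := fun x => ψ x - ∑ k ∈ T, fc ψ k * ee k x with hh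
  have h0 := n0_nonneg h
  set h4 : ℝ → ℂ := fun x => (4 * π * Complex.I) * h x with hh4
  have Sh4 : SP h4 := (SP_const (4 * π * Complex.I)).mul Sh
  have nc : ‖(4 * π * Complex.I : ℂ)‖ ≤ 13 := by
    simp only [norm_mul, Complex.norm_I, Complex.norm_real, Complex.norm_ofNat, norm_eq_abs,
      abs_of_pos pi_pos]
    linarith [pi_lt_d2]
  have nh4 : n0 h4 ≤ 13 * n0 h := by
    rw [hh4, n0_const_mul]; gcongr
  set p : ℝ → ℂ := fun x => Complex.exp (h4 x) - 1 with hp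
  have Sp : SP p := Sh4.cexp.sub (SP_const 1)
  have h41 : n0 h4 * K ^ 99 * K ≤ 39 := by
    calc n0 h4 * K ^ 99 * K ≤ 13 * n0 h * K ^ 99 * K := by gcongr
      _ = 13 * (n0 h * K ^ 100) := by ring
      _ ≤ _ := by linarith
  have h4s : ∀ s, 8 ^ (s + 4) ≤ K → 2 ^ (s + 1) * n0 h4 ≤ 1 / 2 := fun s hs => by
    have h4n := n0_nonneg h4
    have hp8 : (1:ℝ) ≤ 8 ^ s := one_le_pow₀ (by norm_num)
    have h2 : (78:ℝ) * 2 ^ (s + 1) ≤ K := by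
      refine le_trans ?_ hs
      calc (78:ℝ) * 2 ^ (s + 1) = 156 * 2 ^ s := by ring
        _ ≤ 4096 * 8 ^ s := by gcongr <;> norm_num
        _ = _ := by ring
    have h3 : 78 * (2 ^ (s + 1) * n0 h4) ≤ 39 := by
      calc 78 * (2 ^ (s + 1) * n0 h4) = 78 * 2 ^ (s + 1) * n0 h4 := by ring
        _ ≤ K * n0 h4 := by gcongr
        _ = n0 h4 * 1 * K := by ring
        _ ≤ n0 h4 * K ^ 99 * K := by gcongr; exact one_le_pow₀ hK1
        _ ≤ 39 := h41
    linarith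
  have Wp : ∀ s, 8 ^ (s + 4) ≤ K → wn (K ^ 2) s p ≤ 2 * wn (K ^ 2) s h4 := fun s hs =>
    wn_exp_sub_one_le hM s Sh4 (h4s s hs)
  have np : n0 p * K ^ 99 ≤ 1 := by
    have h1 := Wp 0 (by norm_num; linarith)
    rw [wn_zero, wn_zero] at h1
    have h2 : n0 p * K ^ 99 * K ≤ 78 := by
      calc n0 p * K ^ 99 * K ≤ 2 * n0 h4 * K ^ 99 * K := by gcongr
        _ = 2 * (n0 h4 * K ^ 99 * K) := by ring
        _ ≤ _ := by linarith
    have h3 : 0 ≤ n0 p * K ^ 99 := mul_nonneg (n0_nonneg p) (pow_nonneg hK0.le _)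
    nlinarith
  set E0 : ℂ := Complex.exp (4 * π * Complex.I * ρ) with hE0
  have nE0 : ‖E0‖ = 1 := by
    rw [hE0, show (4 * π * Complex.I * ρ : ℂ) = ((4 * π * ρ : ℝ) : ℂ) * Complex.I by
      push_cast; ring, Complex.norm_exp_ofReal_mul_I]
  obtain ⟨v, H, Sv, SH, nv, nH, Heq, hW⟩ :=
    exists_reduced_solution hK4 a hN nE0 hd Se Sp hβ ne np hb
  set P : ℝ → ℂ := fun x => 1 + p x with hP
  have SP1 : SP P := (SP_const 1).add Sp
  have nP : n0 P ≤ 2 := by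
    have h1 : n0 p ≤ 1 := by
      calc n0 p ≤ n0 p * K ^ 99 := le_mul_of_one_le_right (n0_nonneg p) (one_le_pow₀ hK1)
        _ ≤ 1 := np
    have h2 := n0_add_le (SP_const 1) Sp
    have h3 : n0 (fun _ : ℝ => (1:ℂ)) = 1 := by
      simpa only [wn_zero, norm_one] using wn_const 1 0 1
    linarith
  set m : ℝ → ℂ := fun x => e x * v x with hm
  set y : ℝ → ℂ := fun x => E0 * (e (x + a) * (P x * v x)) with hy
  set η : ℝ → ℂ := fun x => (β x - m (x + a)) * (starRingEnd ℂ) (y x) -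
      m (x + a) * (starRingEnd ℂ) (β x) with hη
  set Er : ℝ → ℂ := fun x => e (x + a) * H x with hEr
  set δ : ℝ → ℂ := fun x => (Complex.log (1 + η x) - (starRingEnd ℂ) (Complex.log (1 + η x))) /
      (4 * π * Complex.I) with hδ
  set β' : ℝ → ℂ := fun x => Er x * (starRingEnd ℂ) ((1 + η x)⁻¹) with hβ'
  have hall : ∀ s : ℕ, kamThr s ≤ K → SP m ∧ SP η ∧ SP δ ∧ SP β' ∧ (∀ x, ‖η x‖ < 1) ∧
      n0 m ≤ K ^ 35 * n0 β ∧
      wn (K ^ 2) s m ≤ K ^ 80 * (wn (K ^ 2) s β + n0 β * wn (K ^ 2) s ψ) ∧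
      wn (K ^ 2) s δ ≤ K ^ 80 * (wn (K ^ 2) s β + n0 β * wn (K ^ 2) s ψ) ∧
      wn (K ^ 2) s β' ≤ K ^ 80 * (wn (K ^ 2) s β + n0 β * wn (K ^ 2) s ψ) ∧
      n0 β' ≤ K ^ 6 * n0 H := fun s hs => by
    obtain ⟨h8, -, hes, -⟩ := le_of_kamThr_le hs
    have hY := wn_nonneg hM s ψ
    have hX := wn_nonneg hM s β
    have hbn := n0_nonneg β
    have hp26 : wn (K ^ 2) s p ≤ 26 * wn (K ^ 2) s ψ := by
      have h1 := Wp s h8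
      have h2 := (sub_trig_bounds hM s T hψ).2
      rw [hh4, wn_const_mul] at h1
      have h3 : 0 ≤ wn (K ^ 2) s h := wn_nonneg hM s h
      have h4 : ‖(4 * π * Complex.I : ℂ)‖ * wn (K ^ 2) s h ≤ 13 * wn (K ^ 2) s ψ := by
        gcongr
      linarith
    obtain ⟨V, W, -⟩ := hW s h8 _ hY (We s hes) hp26
    have hP2 : wn (K ^ 2) s P ≤ 1 + 26 * wn (K ^ 2) s ψ := by
      have h2 := wn_add_le hM s (SP_const 1) Sp
      have h3 := wn_const (K ^ 2) s 1
      rw [norm_one] at h3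
      linarith
    have hby := mul_nonneg hbn hY
    have hbx := n0_le_wn hM s hβ
    exact step_bounds s h8 a Se Sv SP1 SH hβ hbn (by linarith)
      (by linarith) hb ne (We s hes) nv V nP hP2 nH W le_rfl (by linarith) nE0 hm hy hη hEr
      hδ hβ'
  obtain ⟨Sm, -, Sδ, Sβ', hlt, nm, -⟩ := hall 0 hK
  have hm1 : ∀ x, ‖m x‖ < 1 := fun x => by
    have h1 := norm_le_n0 Sm x
    have h2 : K ^ 35 * n0 β * K ≤ 1 := by
      calc K ^ 35 * n0 β * K = n0 β * K ^ 36 := by ring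
        _ ≤ n0 β * K ^ 100 := by
          have := n0_nonneg β
          gcongr; norm_num
        _ ≤ 1 := hb
    have h3 : 0 ≤ K ^ 35 * n0 β := mul_nonneg (pow_nonneg hK0.le _) (n0_nonneg β)
    nlinarith
  refine ⟨m, fun x => ψ x + δ x, β', Sm, hψ.add Sδ, Sβ', fun x => ?_, hm1, nm, fun x w => ?_,
    fun s hs => ?_⟩
  · rw [hδ]
    dsimp only
    rw [im_sub_conj_div, Complex.add_im, hreal, Complex.ofReal_im, add_zero]
  · have hne := one_add_ne_zero_of_norm_lt (hlt x)
    have hE2 : phaseExp ρ ψ x ^ 2 * m x = y x := by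
      have h1 : phaseExp ρ ψ x ^ 2 * e x = E0 * e (x + a) * P x := by
        rw [phaseExp, ← Complex.exp_nat_mul, hE0, he, hP, hp, hh4, hh]
        simp only [add_sub_cancel]
        rw [← gco x, ← Complex.exp_add, ← Complex.exp_add, ← Complex.exp_add]
        congr 1
        push_cast
        ring
      calc phaseExp ρ ψ x ^ 2 * m x = phaseExp ρ ψ x ^ 2 * e x * v x := by rw [hm]; ring
        _ = _ := by rw [h1, hy]; ring
    obtain ⟨l, hl, -, hcon⟩ := act_conjugation (E := phaseExp ρ ψ x) (β := β x) (m := m x)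
      (mT := m (x + a)) (η := η x) (phaseExp_mul_conj ρ (hreal x)) (hm1 x)
      (by rw [mul_comm (m x), hE2]) hne (E' := phaseExp ρ (fun x => ψ x + δ x) x) (β' := β' x)
      (by
        have h1 : phaseExp ρ (fun x => ψ x + δ x) x =
            phaseExp ρ ψ x * Complex.exp (2 * π * Complex.I * δ x) := by
          rw [phaseExp, phaseExp, ← Complex.exp_add]
          congr 1
          ring
        have h2 := norm_mul_exp_arg (1 + η x)
        rw [h1]
        linear_combination phaseExp ρ ψ x * h2)
      (by
        have h1 : (starRingEnd ℂ) ((1 + η x)⁻¹) * (1 + (starRingEnd ℂ) (η x)) = 1 := by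
          rw [show 1 + (starRingEnd ℂ) (η x) = (starRingEnd ℂ) (1 + η x) by simp, ← map_mul,
            inv_mul_cancel₀ hne, map_one]
        have h3 : e (x + a) * (starRingEnd ℂ) (e (x + a)) = 1 := by
          rw [he]
          dsimp only
          rw [← Complex.exp_conj, ← Complex.exp_add, Complex.exp_eq_one_iff]
          have : (starRingEnd ℂ) (g (x + a)) = g (x + a) := Complex.conj_eq_iff_im.2 (greal _)
          refine ⟨0, ?_⟩
          simp only [map_mul, Complex.conj_I, Complex.conj_ofReal, this, Complex.conj_ofNat]
          push_cast
          ring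
        have h2 : Er x = y x + β x - m (x + a) - (starRingEnd ℂ) (β x) * y x * m (x + a) := by
          rw [hEr]
          dsimp only
          rw [Heq x, hy, hm, hP]
          dsimp only
          linear_combination β x * h3
        rw [hE2, ← h2, hβ']
        linear_combination Er x * h1) w
    exact ⟨l, hl, hcon⟩
  · obtain ⟨-, -, -, -, -, -, w1, w2, w3, w4⟩ := hall s hs
    obtain ⟨h8, -, hes, -⟩ := le_of_kamThr_le hs
    refine ⟨w1, by simpa only [add_sub_cancel_left] using w2, w3, w4.trans ?_⟩
    have hY := wn_nonneg hM s ψ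
    have hX := wn_nonneg hM s β
    have hbn := n0_nonneg β
    have hp26 : wn (K ^ 2) s p ≤ 26 * wn (K ^ 2) s ψ := by
      have h1 := Wp s h8
      have h2 := (sub_trig_bounds hM s T hψ).2
      rw [hh4, wn_const_mul] at h1
      have h3 : 0 ≤ wn (K ^ 2) s h := wn_nonneg hM s h
      have h4 : ‖(4 * π * Complex.I : ℂ)‖ * wn (K ^ 2) s h ≤ 13 * wn (K ^ 2) s ψ := by
        gcongr
      linarith
    obtain ⟨-, -, hH3⟩ := hW s h8 _ hY (We s hes) hp26
    have hZ : 0 ≤ (K ^ 2 / N) ^ s * (wn (K ^ 2) s β + n0 β * wn (K ^ 2) s ψ) := by positivity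
    calc K ^ 6 * n0 H ≤ K ^ 6 * ((K ^ 2 / N) ^ s * (K ^ 57 *
          (wn (K ^ 2) s β + n0 β * wn (K ^ 2) s ψ))) := by gcongr
      _ = K ^ 63 * ((K ^ 2 / N) ^ s * (wn (K ^ 2) s β + n0 β * wn (K ^ 2) s ψ)) := by ring
      _ ≤ K ^ 80 * ((K ^ 2 / N) ^ s * (wn (K ^ 2) s β + n0 β * wn (K ^ 2) s ψ)) := by
        gcongr; norm_num
      _ = _ := by ring

lemma distToInt_nonneg (x : ℝ) : 0 ≤ distToInt x := abs_nonneg _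

lemma distToInt_le (x : ℝ) (j : ℤ) : distToInt x ≤ |x - j| := round_le x j

lemma distToInt_add_int (x : ℝ) (j : ℤ) : distToInt (x + j) = distToInt x := by
  unfold distToInt
  rw [round_add_intCast]
  congr 1
  push_cast
  ring

lemma distToInt_int_mul_le (n : ℤ) (x : ℝ) : distToInt (n * x) ≤ |(n:ℝ)| * distToInt x := by
  refine (distToInt_le _ (n * round x)).trans (le_of_eq ?_)
  rw [distToInt, ← abs_mul]
  congr 1
  push_cast
  ring

lemma distToInt_add_le (x y : ℝ) : distToInt (x + y) ≤ distToInt x + distToInt y := by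
  refine (distToInt_le _ (round x + round y)).trans ?_
  refine le_trans (le_of_eq ?_) (abs_add_le _ _)
  congr 1
  push_cast
  ring

lemma distToInt_neg (x : ℝ) : distToInt (-x) = distToInt x := by
  have h : ∀ x, distToInt (-x) ≤ distToInt x := fun x => by
    refine (distToInt_le _ (-round x)).trans (le_of_eq ?_)
    rw [distToInt, ← abs_neg]
    congr 1
    push_cast
    ring
  refine le_antisymm (h x) ?_
  simpa using h (-x)

lemma distToInt_le_norm_exp_sub_one (x : ℝ) :
    distToInt x ≤ ‖Complex.exp (2 * π * Complex.I * x) - 1‖ := by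
  set t := x - round x with ht
  have h1 : Complex.exp (2 * π * Complex.I * x) = Complex.exp (Complex.I * ((2 * π * t : ℝ) : ℂ)) := by
    rw [Complex.exp_eq_exp_iff_exists_int]
    refine ⟨round x, ?_⟩
    rw [ht]
    push_cast
    ring
  have h2 : |t| ≤ 1 / 2 := abs_sub_round x
  rw [h1, Complex.norm_exp_I_mul_ofReal_sub_one, distToInt, ← ht, norm_mul, norm_eq_abs,
    norm_eq_abs, show 2 * π * t / 2 = π * t by ring]
  have h3 : 2 / π * |π * t| ≤ |sin (π * t)| := mul_abs_le_abs_sin (by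
    rw [abs_mul, abs_of_pos pi_pos]; nlinarith [pi_pos])
  rw [abs_mul π, abs_of_pos pi_pos] at h3
  have h4 : 2 / π * (π * |t|) = 2 * |t| := by field_simp
  rw [h4] at h3
  have h5 := abs_nonneg t
  rw [abs_of_pos (by norm_num : (0:ℝ) < 2)]
  linarith

lemma distToInt_pos_of_irrational {α : ℝ} (hα : Irrational α) {k : ℤ} (hk : k ≠ 0) :
    0 < distToInt (k * α) := by
  refine lt_of_le_of_ne (distToInt_nonneg _) fun h => ?_
  have h1 : (k:ℝ) * α - round ((k:ℝ) * α) = 0 := abs_eq_zero.1 h.symm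
  exact (hα.intCast_mul hk).ne_int _ (sub_eq_zero.1 h1)

/-- A record of small divisors beyond a given scale. -/
lemma exists_next_scale {α : ℝ} (hα : Irrational α) {K : ℝ} (hK : 1 ≤ K) :
    ∃ (K' : ℝ) (q : ℕ), K ^ 12 ≤ K' ∧ 1 ≤ q ∧ (q:ℝ) ≤ K ^ 12 ∧
      distToInt (q * α) = 1 / K' ∧
      ∀ k : ℤ, k ≠ 0 → |(k:ℝ)| < K' / 2 → 1 / K' ≤ distToInt (k * α) := by
  set n := ⌊K ^ 12⌋₊ with hn
  have hK12 : 1 ≤ K ^ 12 := one_le_pow₀ hK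
  have hn1 : 1 ≤ n := Nat.le_floor (by simpa using hK12)
  have hnK : (n:ℝ) ≤ K ^ 12 := Nat.floor_le (by linarith)
  obtain ⟨q, hq, hmin⟩ := Finset.exists_min_image (Finset.Icc 1 n)
    (fun k : ℕ => distToInt (k * α)) ⟨1, by simp [hn1]⟩
  rw [Finset.mem_Icc] at hq
  set η := distToInt (q * α) with hη
  have hη0 : 0 < η := by
    have := distToInt_pos_of_irrational hα (k := (q:ℤ)) (by omega)
    simpa using this
  have hmin' : ∀ k : ℤ, k ≠ 0 → |(k:ℝ)| ≤ n → η ≤ distToInt (k * α) := fun k hk hkn => by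
    have h1 : distToInt (k * α) = distToInt ((k.natAbs : ℝ) * α) := by
      rw [Nat.cast_natAbs, Int.cast_abs]
      rcases abs_cases (k:ℝ) with ⟨h, _⟩ | ⟨h, _⟩
      · rw [h]
      · rw [h, neg_mul, distToInt_neg]
    rw [h1]
    refine hmin _ (Finset.mem_Icc.2 ⟨Int.natAbs_pos.2 hk, ?_⟩)
    rw [← Int.cast_abs, ← Nat.cast_natAbs] at hkn
    exact_mod_cast hkn
  have hηn : η ≤ 1 / (n + 1) := by
    obtain ⟨j, k, hk0, hkn, hjk⟩ := Real.exists_int_int_abs_mul_sub_le α (n := n) (by omega)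
    refine le_trans (hmin' k hk0.ne' ?_) ((distToInt_le _ j).trans hjk)
    rw [abs_of_pos (by exact_mod_cast hk0)]
    exact_mod_cast hkn
  have hηn' : η * (n + 1) ≤ 1 := by
    rwa [le_div_iff₀ (by positivity)] at hηn
  refine ⟨1 / η, q, ?_, hq.1, ?_, by rw [one_div_one_div], fun k hk hkK => ?_⟩
  · rw [le_div_iff₀ hη0]
    have := Nat.lt_floor_add_one (K ^ 12)
    rw [← hn] at this
    nlinarith
  · exact le_trans (by exact_mod_cast hq.2) hnK
  · rw [one_div_one_div]
    by_contra! hlt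
    have hkn : (n:ℝ) < |(k:ℝ)| := by
      by_contra! h
      exact not_le.2 hlt (hmin' k hk h)
    have hkη : |(k:ℝ)| * η < 1 / 2 := by
      have : |(k:ℝ)| < 1 / (2 * η) := by
        calc _ < 1 / η / 2 := hkK
          _ = _ := by rw [div_div, mul_comm]
      rw [lt_div_iff₀ (by positivity)] at this
      linarith
    have hqn : (q:ℝ) ≤ n := by exact_mod_cast hq.2
    have hq0 : (1:ℝ) ≤ q := by exact_mod_cast hq.1
    set p := round ((q:ℝ) * α)
    set p' := round ((k:ℝ) * α)
    have hdet : ((q * p' - k * p : ℤ) : ℝ) =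
        k * ((q:ℝ) * α - p) - q * ((k:ℝ) * α - p') := by push_cast; ring
    have e1 : |(q:ℝ) * α - p| = η := rfl
    have e2 : |(k:ℝ) * α - p'| = distToInt (k * α) := rfl
    by_cases h0 : (q * p' - k * p : ℤ) = 0
    · rw [h0, Int.cast_zero] at hdet
      have h1 : |(k:ℝ)| * η = q * distToInt (k * α) := by
        rw [← e1, ← e2, ← abs_mul, ← Nat.abs_cast q, ← abs_mul, Nat.abs_cast]
        congr 1
        linarith
      have h2 : |(k:ℝ)| * η < n * η := by
        rw [h1]
        calc _ < (q:ℝ) * η := by gcongr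
          _ ≤ _ := by gcongr
      exact absurd (lt_of_mul_lt_mul_right h2 hη0.le) (not_lt.2 hkn.le)
    · have h1 : (1:ℝ) ≤ |((q * p' - k * p : ℤ) : ℝ)| := by
        exact_mod_cast Int.one_le_abs h0
      rw [hdet] at h1
      have h2 := abs_sub ((k:ℝ) * ((q:ℝ) * α - p)) (q * ((k:ℝ) * α - p'))
      rw [abs_mul, abs_mul, e1, e2, Nat.abs_cast] at h2
      have h3 : (q:ℝ) * distToInt (k * α) ≤ q * η := by gcongr
      have h4 : (q:ℝ) * η ≤ n * η := by gcongr
      have h5 : (n:ℝ) * η ≤ |(k:ℝ)| * η := by gcongr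
      linarith

lemma volume_distToInt_lt_le {n : ℕ} (hn : 1 ≤ n) {t : ℝ} (ht : 0 < t) :
    volume {x : ℝ | x ∈ Set.Ico (0:ℝ) 1 ∧ distToInt (n * x) < t} ≤ ENNReal.ofReal (4 * t) := by
  have hn0 : (0:ℝ) < n := by exact_mod_cast hn
  have hsub : {x : ℝ | x ∈ Set.Ico (0:ℝ) 1 ∧ distToInt (n * x) < t} ⊆
      ⋃ j ∈ Finset.range (n + 1), Set.Ioo (((j:ℝ) - t) / n) ((j + t) / n) := by
    rintro x ⟨⟨hx0, hx1⟩, hx⟩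
    have h0 : 0 ≤ round ((n:ℝ) * x) := by
      rw [round_eq]
      exact Int.floor_nonneg.2 (by positivity)
    have h1 : round ((n:ℝ) * x) ≤ n := by
      rw [round_eq, ← Int.lt_add_one_iff, Int.floor_lt]
      push_cast
      nlinarith
    obtain ⟨j, hj⟩ := Int.eq_ofNat_of_zero_le h0
    rw [distToInt, hj, abs_lt] at hx
    simp only [Set.mem_iUnion, Finset.mem_range, Set.mem_Ioo]
    refine ⟨j, by omega, ?_, ?_⟩
    · rw [div_lt_iff₀ hn0]
      have := hx.1
      push_cast at this
      linarith
    · rw [lt_div_iff₀ hn0]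
      have := hx.2
      push_cast at this
      linarith
  refine (measure_mono hsub).trans ((measure_biUnion_finset_le _ _).trans ?_)
  have hv : ∀ j ∈ Finset.range (n + 1),
      volume (Set.Ioo (((j:ℝ) - t) / n) ((j + t) / n)) ≤ ENNReal.ofReal (2 * t / n) := fun j _ => by
    rw [Real.volume_Ioo]
    refine le_of_eq (congrArg _ ?_)
    ring
  refine (Finset.sum_le_sum hv).trans ?_
  rw [Finset.sum_const, Finset.card_range, nsmul_eq_mul, ← ENNReal.ofReal_natCast,
    ← ENNReal.ofReal_mul (by positivity)]
  refine ENNReal.ofReal_le_ofReal ?_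
  rw [mul_div_assoc', div_le_iff₀ hn0]
  have : (1:ℝ) ≤ n := by exact_mod_cast hn
  push_cast
  nlinarith

lemma measurable_distToInt : Measurable distToInt := by
  have h : Measurable fun x : ℝ => ((⌊x + 1 / 2⌋ : ℤ) : ℝ) :=
    (measurable_from_top (f := fun k : ℤ => (k:ℝ))).comp
      (Int.measurable_floor.comp (measurable_id.add_const _))
  have h2 : distToInt = fun x : ℝ => |x - ((⌊x + 1 / 2⌋ : ℤ) : ℝ)| := by
    funext x
    rw [distToInt, round_eq]
  rw [h2]
  exact (measurable_id.sub h).abs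

/-- Scales of small divisors attached to an irrational frequency. -/
structure IsScale (α : ℝ) (K : ℕ → ℝ) (q : ℕ → ℕ) : Prop where
  one_le : ∀ h, 1 ≤ K h
  growth : ∀ h, K h ^ 12 ≤ K (h + 1)
  q_pos : ∀ h, 1 ≤ q h
  q_le : ∀ h, (q h : ℝ) ≤ K h ^ 12
  dist_q : ∀ h, distToInt (q h * α) = 1 / K (h + 1)
  dist_ge : ∀ h, ∀ k : ℤ, k ≠ 0 → |(k:ℝ)| < K (h + 1) / 2 → 1 / K (h + 1) ≤ distToInt (k * α)

lemma exists_isScale {α : ℝ} (hα : Irrational α) {K₀ : ℝ} (hK : 1 ≤ K₀) :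
    ∃ K q, K 0 = K₀ ∧ IsScale α K q := by
  have hex : ∀ K : {K : ℝ // 1 ≤ K}, ∃ (K' : {K : ℝ // 1 ≤ K}) (q : ℕ), K.1 ^ 12 ≤ K'.1 ∧ 1 ≤ q ∧
      (q:ℝ) ≤ K.1 ^ 12 ∧ distToInt (q * α) = 1 / K'.1 ∧
      ∀ k : ℤ, k ≠ 0 → |(k:ℝ)| < K'.1 / 2 → 1 / K'.1 ≤ distToInt (k * α) := fun K => by
    obtain ⟨K', q, h⟩ := exists_next_scale hα K.2
    exact ⟨⟨K', (one_le_pow₀ K.2).trans h.1⟩, q, h⟩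
  choose F G hFG using hex
  set S : ℕ → {K : ℝ // 1 ≤ K} := fun h => F^[h] ⟨K₀, hK⟩ with hS
  have hs : ∀ h, S (h + 1) = F (S h) := fun h => Function.iterate_succ_apply' _ _ _
  exact ⟨fun h => (S h).1, fun h => G (S h), rfl,
    { one_le := fun h => (S h).2
      growth := fun h => by rw [hs]; exact (hFG (S h)).1
      q_pos := fun h => (hFG (S h)).2.1
      q_le := fun h => (hFG (S h)).2.2.1
      dist_q := fun h => by rw [hs]; exact (hFG (S h)).2.2.2.1
      dist_ge := fun h => by rw [hs]; exact (hFG (S h)).2.2.2.2 }⟩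

lemma IsScale.geometric {α : ℝ} {K : ℕ → ℝ} {q : ℕ → ℕ} (hs : IsScale α K q) (h2 : 2 ≤ K 0)
    (h : ℕ) : K 0 * 2 ^ h ≤ K h := by
  induction h with
  | zero => simp
  | succ h ih =>
    have h1 := hs.one_le h
    have h3 : (1:ℝ) ≤ 2 ^ h := one_le_pow₀ (by norm_num)
    have h4 : 2 ≤ K h := by nlinarith
    calc K 0 * 2 ^ (h + 1) = K 0 * 2 ^ h * 2 := by ring
      _ ≤ K h * K h := by gcongr
      _ = K h ^ 2 := by ring
      _ ≤ K h ^ 12 := by gcongr; norm_num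
      _ ≤ _ := hs.growth h

/-- The set of good rotation numbers. -/
lemma exists_good_set {α : ℝ} {K : ℕ → ℝ} {q : ℕ → ℕ} (hs : IsScale α K q) (h2 : 2 ≤ K 0)
    {ε : ℝ} (hε : 0 < ε) (hK : 17 ≤ ε * K 0) :
    ∃ Q : Set ℝ, Q ⊆ Set.Ico (0:ℝ) 1 ∧ MeasurableSet Q ∧
      volume (Set.Ico (0:ℝ) 1 \ Q) < ENNReal.ofReal ε ∧
      ∀ ρ ∈ Q, ∀ h, ∀ k : ℤ, |(k:ℝ)| ≤ √(K (h + 1)) →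
        1 / K h ^ 24 ≤ distToInt (2 * ρ - k * α) := by
  have hK0 : ∀ h, 0 < K h := fun h => by linarith [hs.one_le h]
  set G : Set ℝ := {ρ | ∀ h, ∀ k : ℤ, |(k:ℝ)| ≤ √(K (h + 1)) →
        1 / K h ^ 24 ≤ distToInt (2 * ρ - k * α)} with hG
  have mG : MeasurableSet G := by
    rw [hG]
    simp only [Set.ofPred_forall]
    refine MeasurableSet.iInter fun h => MeasurableSet.iInter fun k => MeasurableSet.iInter fun _ => ?_
    exact measurableSet_le measurable_const
      (measurable_distToInt.comp ((measurable_id.const_mul 2).sub_const _))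
  refine ⟨Set.Ico 0 1 ∩ G, Set.inter_subset_left, measurableSet_Ico.inter mG, ?_,
    fun ρ hρ => hρ.2⟩
  set t : ℕ → ℝ := fun h => 2 / K h with ht
  have hsub : Set.Ico (0:ℝ) 1 \ (Set.Ico 0 1 ∩ G) ⊆
      ⋃ h, {x : ℝ | x ∈ Set.Ico (0:ℝ) 1 ∧ distToInt ((2 * q h : ℕ) * x) < t h} := by
    rintro x ⟨hx, hxG⟩
    have hxG' : x ∉ G := fun h => hxG ⟨hx, h⟩
    simp only [hG, Set.mem_ofPred_eq, not_forall, not_le] at hxG'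
    obtain ⟨h, k, hk, hlt⟩ := hxG'
    refine Set.mem_iUnion.2 ⟨h, hx, ?_⟩
    have e : ((2 * q h : ℕ) : ℝ) * x = ((q h : ℤ) : ℝ) * (2 * x - k * α) + k * (q h * α) := by
      push_cast; ring
    rw [e]
    have h1 := distToInt_add_le (((q h : ℤ) : ℝ) * (2 * x - k * α)) (k * (q h * α))
    have h3 := distToInt_int_mul_le (q h) (2 * x - k * α)
    have h4 := distToInt_int_mul_le k (q h * α)
    rw [hs.dist_q] at h4
    have hKh := hs.one_le h
    have hq0 : (1:ℝ) ≤ q h := by exact_mod_cast hs.q_pos h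
    have a1 : |(((q h : ℕ) : ℤ) : ℝ)| * distToInt (2 * x - k * α) < 1 / K h := by
      rw [Int.cast_natCast, Nat.abs_cast]
      have hp : 0 < K h ^ 24 := pow_pos (hK0 h) _
      calc (q h : ℝ) * distToInt (2 * x - k * α) < q h * (1 / K h ^ 24) := by gcongr
        _ ≤ K h ^ 12 * (1 / K h ^ 24) := by gcongr; exact hs.q_le h
        _ = 1 / K h ^ 12 := by
          have := (hK0 h).ne'
          field_simp
        _ ≤ 1 / K h ^ 1 := by gcongr; norm_num
        _ = _ := by rw [pow_one]
    have a2 : |(k:ℝ)| * (1 / K (h + 1)) ≤ 1 / K h := by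
      have hg : K h ≤ √(K (h + 1)) := by
        refine Real.le_sqrt_of_sq_le (le_trans ?_ (hs.growth h))
        gcongr
        norm_num
      have hsq : √(K (h + 1)) * √(K (h + 1)) = K (h + 1) := Real.mul_self_sqrt (hK0 _).le
      have hs0 : 0 < √(K (h + 1)) := Real.sqrt_pos.2 (hK0 _)
      calc |(k:ℝ)| * (1 / K (h + 1)) ≤ √(K (h + 1)) * (1 / K (h + 1)) := by
            have := hK0 (h + 1)
            gcongr
        _ = 1 / √(K (h + 1)) := by
          nth_rewrite 2 [← hsq]
          field_simp
        _ ≤ 1 / K h := by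
          have := hK0 h
          gcongr
    calc _ ≤ _ := h1
      _ < 1 / K h + 1 / K h := by linarith
      _ = t h := by rw [ht]; ring
  have hb : ∀ h, volume {x : ℝ | x ∈ Set.Ico (0:ℝ) 1 ∧ distToInt ((2 * q h : ℕ) * x) < t h} ≤
      ENNReal.ofReal (8 / K 0 * (1 / 2) ^ h) := fun h => by
    have ht0 : 0 < t h := div_pos two_pos (hK0 h)
    refine (volume_distToInt_lt_le (by have := hs.q_pos h; omega) ht0).trans
      (ENNReal.ofReal_le_ofReal ?_)
    have hg := hs.geometric h2 h
    calc 4 * t h = 8 / K h := by rw [ht]; ring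
      _ ≤ 8 / (K 0 * 2 ^ h) := by
        have := hK0 0
        gcongr
      _ = _ := by rw [one_div, inv_pow]; field_simp
  have hsum : HasSum (fun h : ℕ => 8 / K 0 * (1 / 2 : ℝ) ^ h) (8 / K 0 * 2) :=
    hasSum_geometric_two.mul_left _
  calc _ ≤ _ := measure_mono hsub
    _ ≤ ∑' h, _ := measure_iUnion_le _
    _ ≤ ∑' h, ENNReal.ofReal (8 / K 0 * (1 / 2) ^ h) := ENNReal.tsum_le_tsum hb
    _ = ENNReal.ofReal (8 / K 0 * 2) := by
      rw [← hsum.tsum_eq, ENNReal.ofReal_tsum_of_nonneg _ hsum.summable]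
      intro h
      have := hK0 0
      positivity
    _ < ENNReal.ofReal ε := by
      rw [ENNReal.ofReal_lt_ofReal_iff hε]
      rw [div_mul_eq_mul_div, div_lt_iff₀ (hK0 0)]
      linarith

/-- The point of the unit circle with angle `2πy`. -/
noncomputable def cis (y : ℝ) : ℂ := Complex.exp (2 * π * Complex.I * y)

lemma cis_add (x y : ℝ) : cis (x + y) = cis x * cis y := by
  rw [cis, cis, cis, ← Complex.exp_add]
  congr 1
  push_cast
  ring

lemma norm_cis (y : ℝ) : ‖cis y‖ = 1 := by
  rw [cis, show (2 * π * Complex.I * y : ℂ) = ((2 * π * y : ℝ) : ℂ) * Complex.I by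
      push_cast; ring, Complex.norm_exp_ofReal_mul_I]

lemma cis_mul_conj (y : ℝ) : cis y * (starRingEnd ℂ) (cis y) = 1 := by
  rw [Complex.mul_conj', norm_cis]; norm_num

lemma eq_add_int_of_mul_cis_eq {r₁ r₂ : ℝ} (h1 : 0 < r₁) (h2 : 0 < r₂) {x y : ℝ}
    (h : (r₁ : ℂ) * cis x = r₂ * cis y) : ∃ j : ℤ, x = y + j := by
  have hn : r₁ = r₂ := by
    have := congrArg norm h
    simpa [norm_cis, abs_of_pos h1, abs_of_pos h2] using this
  rw [hn] at h
  have hc : cis x = cis y := mul_left_cancel₀ (by exact_mod_cast h2.ne') h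
  rw [cis, cis, Complex.exp_eq_exp_iff_exists_int] at hc
  obtain ⟨j, hj⟩ := hc
  refine ⟨j, ?_⟩
  have hπ : (2 * π * Complex.I : ℂ) ≠ 0 := Complex.two_pi_I_ne_zero
  have h3 : (2 * π * Complex.I : ℂ) * x = (2 * π * Complex.I) * (y + j) := by rw [hj]; ring
  exact_mod_cast mul_left_cancel₀ hπ h3

lemma act_real_mul (c d : ℂ) (r : ℝ) (w : ℂ) : act c d (r * w) = r * act c d w := by
  simp only [act, map_mul, Complex.conj_ofReal]; ring

/-- A linear map close to the identity moves directions little. -/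
lemma act_cis_near {c d : ℂ} {δ : ℝ} (h : ‖c - 1‖ + ‖d‖ ≤ δ) (hδ : δ ≤ 1 / 2) (y : ℝ) :
    ∃ R θ : ℝ, 0 < R ∧ |θ - y| ≤ δ ∧ act c d (cis y) = R * cis θ := by
  set u : ℂ := (c - 1) + d * (starRingEnd ℂ) (cis y) ^ 2 with hu
  have hn : ‖u‖ ≤ δ := by
    refine le_trans (norm_add_le _ _) (le_trans (le_of_eq ?_) h)
    rw [norm_mul, norm_pow, RCLike.norm_conj, norm_cis, one_pow, mul_one]
  have h1 : 1 + u ≠ 0 := one_add_ne_zero_of_norm_lt (by linarith)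
  refine ⟨‖1 + u‖, y + Complex.arg (1 + u) / (2 * π), norm_pos_iff.2 h1, ?_, ?_⟩
  · rw [add_sub_cancel_left, abs_div, abs_of_pos two_pi_pos, div_le_iff₀ two_pi_pos]
    have h2 := Complex.norm_log_one_add_half_le_self (hn.trans hδ)
    have h3 := Complex.abs_im_le_norm (Complex.log (1 + u))
    rw [Complex.log_im] at h3
    have h4 : 0 ≤ δ := (norm_nonneg u).trans hn
    nlinarith [pi_gt_three]
  · have h2 : (‖1 + u‖ : ℂ) * cis (Complex.arg (1 + u) / (2 * π)) = 1 + u := by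
      conv_rhs => rw [← Complex.norm_mul_exp_arg_mul_I (1 + u)]
      rw [cis]
      congr 2
      have : (π:ℂ) ≠ 0 := by exact_mod_cast pi_ne_zero
      push_cast
      field_simp
    rw [cis_add, mul_left_comm, h2, hu, act]
    linear_combination -(d * (starRingEnd ℂ) (cis y)) * cis_mul_conj y

lemma fibreMap_eq (ρ : ℝ) (ψ β : ℝ → ℂ) (x : ℝ) (w : ℂ) :
    fibreMap ρ ψ β x w = act 1 (β x) (phaseExp ρ ψ x * w) := by
  simp only [fibreMap, act, map_mul]; ring

lemma phaseExp_eq_cis (ρ : ℝ) {ψ : ℝ → ℂ} {x : ℝ} (h : (ψ x).im = 0) :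
    phaseExp ρ ψ x = cis (ρ + (ψ x).re) := by
  have : ψ x = ((ψ x).re : ℂ) := Complex.ext rfl (by simpa using h)
  rw [phaseExp, cis, Complex.ofReal_add, ← this]

lemma fibreMap_cis_near {ρ : ℝ} {ψ β : ℝ → ℂ} {x : ℝ} (h : (ψ x).im = 0) {δ : ℝ}
    (hβ : ‖β x‖ ≤ δ) (hδ : δ ≤ 1 / 2) (y : ℝ) :
    ∃ R θ : ℝ, 0 < R ∧ |θ - (y + ρ + (ψ x).re)| ≤ δ ∧
      fibreMap ρ ψ β x (cis y) = R * cis θ := by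
  rw [fibreMap_eq, phaseExp_eq_cis ρ h, ← cis_add, show ρ + (ψ x).re + y = y + ρ + (ψ x).re by ring]
  exact act_cis_near (by simpa using hβ) hδ _

lemma sum_liftOrbit (f : ℝ → ℝ → ℝ) (α x y : ℝ) (n : ℕ) :
    ∑ i ∈ Finset.range n, f (x + i * α) (liftOrbit f α x y i) = liftOrbit f α x y n - y := by
  induction n with
  | zero => simp [liftOrbit]
  | succ n ih => rw [Finset.sum_range_succ, ih, liftOrbit]; ring

lemma int_eq_zero_of_abs_lt_one {j : ℤ} (h : |(j:ℝ)| < 1) : j = 0 := by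
  rw [← Int.cast_abs] at h
  have : |j| < 1 := by exact_mod_cast h
  exact Int.abs_lt_one_iff.1 this

/-- The mean of the phase of a conjugated cocycle is controlled by its non-rotational part, when
the phase is normalised by the fibered rotation number. -/
lemma rotNum_mean_le {α ρ : ℝ} {f : ℝ → ℝ → ℝ} {G c d ψ β : ℝ → ℂ} {A B : ℝ → ℂ} {ψ₀ : ℝ → ℝ}
    (hlift : ∀ x y, ∃ r : ℝ, 0 < r ∧ act (A x) (B x) (cis y) = r * cis (y + f x y))
    (hlim : ∀ x y : ℝ, Tendsto
      (fun n : ℕ => (∑ i ∈ Finset.range n, f (x + i * α) (liftOrbit f α x y i)) / n)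
      atTop (nhds ρ))
    (hclose : ∀ x y, |f x y - (ρ + ψ₀ x)| ≤ 1 / 10)
    (hψ₀ : ∀ x, |(ψ x).re - ψ₀ x| ≤ 1 / 10) (hreal : ∀ x, (ψ x).im = 0)
    (hcd : ∀ x, ‖c x - 1‖ + ‖d x‖ ≤ 1 / 10)
    (hconj : ∀ x w, ∃ l : ℝ, 0 < l ∧ act (c (x + α)) (d (x + α)) (act (A x) (B x) w) =
      l * fibreMap ρ ψ β x (act (c x) (d x) w))
    {b : ℝ} (hβ : ∀ x, ‖β x‖ ≤ b) (hb : b ≤ 1 / 10)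
    {Γ μ H : ℝ} (hG : ∀ x, ‖G x‖ ≤ Γ)
    (hH : ∀ x, ‖ψ x - μ - (G (x + α) - G x)‖ ≤ H) : |μ| ≤ b + H := by
  have hθ : ∀ n : ℕ, ∃ R θ : ℝ, 0 < R ∧ |θ - liftOrbit f α 0 0 n| ≤ 1 / 10 ∧
      act (c (0 + n * α)) (d (0 + n * α)) (cis (liftOrbit f α 0 0 n)) = R * cis θ := fun n =>
    act_cis_near (hcd _) (by norm_num) _
  choose R θ hR hθ1 hθ2 using hθ
  set y : ℕ → ℝ := liftOrbit f α 0 0 with hy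
  have hstep : ∀ n : ℕ, |θ (n + 1) - θ n - ρ - (ψ (n * α)).re| ≤ b := fun n => by
    obtain ⟨r, hr, hr2⟩ := hlift (0 + n * α) (y n)
    obtain ⟨l, hl, hl2⟩ := hconj (0 + n * α) (cis (y n))
    obtain ⟨R', θ', hR', hθ', hθ'2⟩ := fibreMap_cis_near (ρ := ρ) (hreal (0 + n * α)) (hβ _)
      (by linarith) (θ n)
    have hx : (0:ℝ) + n * α + α = 0 + (n + 1 : ℕ) * α := by push_cast; ring
    have hfm : ∀ (t : ℝ) (w : ℂ), fibreMap ρ ψ β (0 + n * α) (t * w) =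
        t * fibreMap ρ ψ β (0 + n * α) w := fun t w => act_real_mul _ _ _ _
    have hyn : y (n + 1) = y n + f (0 + n * α) (y n) := rfl
    rw [hr2, act_real_mul, hx, ← hyn, hθ2 (n + 1), hθ2 n, hfm, hθ'2] at hl2
    obtain ⟨j, hj⟩ := eq_add_int_of_mul_cis_eq (r₁ := r * R (n + 1)) (r₂ := l * (R n * R'))
      (x := θ (n + 1)) (y := θ') (mul_pos hr (hR _)) (mul_pos hl (mul_pos (hR _) hR'))
      (by push_cast; linear_combination hl2)
    have c1 := abs_le.1 (hclose (0 + n * α) (y n))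
    have c2 := abs_le.1 (hψ₀ (0 + n * α))
    have c3 := abs_le.1 (hθ1 n)
    have c4 := abs_le.1 (hθ1 (n + 1))
    have c5 := abs_le.1 hθ'
    have hj0 : j = 0 := int_eq_zero_of_abs_lt_one (by
      rw [abs_lt]
      constructor <;> linarith)
    rw [hj0, Int.cast_zero, add_zero] at hj
    rw [zero_add] at c5
    rw [abs_le]
    constructor <;> linarith
  have hΓ : 0 ≤ Γ := (norm_nonneg _).trans (hG 0)
  have htel : ∀ n : ℕ, |θ n - θ 0 - n * ρ - n * μ - ((G (n * α)).re - (G 0).re)| ≤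
      n * (b + H) := fun n => by
    induction n with
    | zero => simp
    | succ n ih =>
      have h1 := abs_le.1 (hstep n)
      have h2 := abs_le.1 ((Complex.abs_re_le_norm _).trans (hH (n * α)))
      simp only [Complex.sub_re, Complex.ofReal_re] at h2
      have hx : ((n + 1 : ℕ) : ℝ) * α = n * α + α := by push_cast; ring
      rw [hx]
      have ih := abs_le.1 ih
      rw [abs_le]
      push_cast
      constructor <;> nlinarith
  have hbound : ∀ n : ℕ, |μ| * n ≤ |y n - n * ρ| + (1 + 2 * Γ) + n * (b + H) := fun n => by
    have h1 := abs_le.1 (htel n)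
    have h2 := abs_le.1 (hθ1 n)
    have h3 := abs_le.1 (hθ1 0)
    have h4 := abs_le.1 ((Complex.abs_re_le_norm _).trans (hG (n * α)))
    have h5 := abs_le.1 ((Complex.abs_re_le_norm _).trans (hG 0))
    have h6 : y 0 = 0 := rfl
    have h8 := neg_abs_le (y n - n * ρ)
    have h9 := le_abs_self (y n - n * ρ)
    have hn : (0:ℝ) ≤ n := Nat.cast_nonneg n
    have h7 : |μ| * n = |μ * n| := by rw [abs_mul, Nat.abs_cast]
    rw [h7, abs_le]
    constructor <;> linarith
  have hl : Tendsto (fun n : ℕ => |y n / n - ρ| + (1 + 2 * Γ) / n + (b + H)) atTop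
      (nhds (|ρ - ρ| + 0 + (b + H))) := by
    refine ((Tendsto.sub ?_ tendsto_const_nhds).abs.add
      (tendsto_const_div_atTop_nhds_zero_nat _)).add tendsto_const_nhds
    refine (hlim 0 0).congr fun n => ?_
    rw [sum_liftOrbit, sub_zero]
  rw [sub_self, abs_zero, zero_add, zero_add] at hl
  refine ge_of_tendsto hl ?_
  filter_upwards [eventually_gt_atTop 0] with n hn
  have hn0 : (0:ℝ) < n := by exact_mod_cast hn
  have h1 : |y n / n - ρ| = |y n - n * ρ| / n := by
    rw [← abs_of_pos hn0, ← abs_div, abs_of_pos hn0]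
    congr 1
    field_simp
  rw [h1, ← add_div, ← sub_nonneg, div_add' _ _ _ hn0.ne', sub_nonneg, le_div_iff₀ hn0]
  linarith [hbound n]

/-- A continuous function on the plane staying near the integers stays near one of them. -/
lemma exists_int_near {F : ℝ × ℝ → ℝ} (hF : Continuous F)
    (h : ∀ p, ∃ j : ℤ, |F p - j| ≤ 1 / 10) : ∃ j : ℤ, ∀ p, |F p - j| ≤ 1 / 10 := by
  obtain ⟨j, hj⟩ := h 0
  refine ⟨j, fun p => ?_⟩
  obtain ⟨i, hi⟩ := h p
  have hconn : (F '' Set.univ).OrdConnected :=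
    (isPreconnected_univ.image F hF.continuousOn).ordConnected
  have hno : ∀ t ∈ F '' Set.univ, ∀ k : ℤ, t ≠ k + 1 / 2 := by
    rintro t ⟨q, -, rfl⟩ k hk
    obtain ⟨m, hm⟩ := h q
    rw [hk, abs_le] at hm
    have h1 : m < k + 1 := by
      have : (m:ℝ) < ((k + 1 : ℤ) : ℝ) := by push_cast; linarith
      exact_mod_cast this
    have h2 : k < m := by
      have : (k:ℝ) < (m : ℝ) := by linarith
      exact_mod_cast this
    omega
  rw [abs_le] at hj hi
  rcases lt_trichotomy i j with hlt | heq | hlt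
  · exfalso
    have h1 : (i:ℝ) + 1 ≤ j := by exact_mod_cast hlt
    exact hno (i + 1 / 2) (hconn.out ⟨p, trivial, rfl⟩ ⟨0, trivial, rfl⟩
      ⟨by linarith, by linarith⟩) i rfl
  · rw [← heq, abs_le]; exact hi
  · exfalso
    have h1 : (j:ℝ) + 1 ≤ i := by exact_mod_cast hlt
    exact hno (j + 1 / 2) (hconn.out ⟨0, trivial, rfl⟩ ⟨p, trivial, rfl⟩
      ⟨by linarith, by linarith⟩) j rfl

/-- The lift of the projective action agrees with the phase up to an integer and a small error. -/
lemma exists_int_lift_near {f : ℝ → ℝ → ℝ} (hf : Continuous (Function.uncurry f))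
    {A B ψ β : ℝ → ℂ} (hψ : Continuous ψ) (hreal : ∀ x, (ψ x).im = 0)
    (hlift : ∀ x y, ∃ r : ℝ, 0 < r ∧ act (A x) (B x) (cis y) = r * cis (y + f x y))
    (hconj : ∀ x w, ∃ l : ℝ, 0 < l ∧ act (A x) (B x) w = l * fibreMap 0 ψ β x w)
    (hβ : ∀ x, ‖β x‖ ≤ 1 / 10) : ∃ j : ℤ, ∀ x y, |f x y - ((ψ x).re + j)| ≤ 1 / 10 := by
  obtain ⟨j, hj⟩ := exists_int_near (F := fun p => f p.1 p.2 - (ψ p.1).re)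
    (hf.sub (Complex.continuous_re.comp (hψ.comp continuous_fst))) (fun p => by
      obtain ⟨r, hr, hr2⟩ := hlift p.1 p.2
      obtain ⟨l, hl, hl2⟩ := hconj p.1 (cis p.2)
      obtain ⟨R, θ, hR, hθ, hθ2⟩ := fibreMap_cis_near (ρ := 0) (hreal p.1) (hβ p.1)
        (by norm_num) p.2
      rw [hr2, hθ2] at hl2
      obtain ⟨j, hj⟩ := eq_add_int_of_mul_cis_eq (r₁ := r) (r₂ := l * R) (x := p.2 + f p.1 p.2) (y := θ) hr (mul_pos hl hR)
        (by push_cast; linear_combination hl2)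
      refine ⟨j, ?_⟩
      rw [abs_le] at hθ ⊢
      constructor <;> linarith)
  refine ⟨j, fun x y => ?_⟩
  have := hj (x, y)
  rwa [sub_sub] at this

/-- Frequencies removed by a coboundary at each scale. -/
noncomputable def modeSet (K : ℕ → ℝ) : ℕ → Finset ℤ
  | 0 => ∅
  | h + 1 => {k ∈ Finset.Icc (-⌈K (h + 1)⌉) ⌈K (h + 1)⌉ | k ≠ 0 ∧ |(k:ℝ)| < K (h + 1) / 2}

lemma mem_modeSet_succ {K : ℕ → ℝ} {h : ℕ} {k : ℤ} :
    k ∈ modeSet K (h + 1) ↔ k ≠ 0 ∧ |(k:ℝ)| < K (h + 1) / 2 := by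
  rw [modeSet, Finset.mem_filter, Finset.mem_Icc]
  refine ⟨fun hk => hk.2, fun hk => ⟨?_, hk⟩⟩
  have h1 : |(k:ℝ)| ≤ (⌈K (h + 1)⌉ : ℤ) := by
    have := Int.le_ceil (K (h + 1))
    have := abs_nonneg (k:ℝ)
    linarith [hk.2]
  rw [abs_le] at h1
  exact ⟨by exact_mod_cast h1.1, by exact_mod_cast h1.2⟩

lemma neg_mem_modeSet {K : ℕ → ℝ} {h : ℕ} {k : ℤ} (hk : k ∈ modeSet K h) :
    -k ∈ modeSet K h := by
  cases h with
  | zero => simp [modeSet] at hk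
  | succ h =>
    rw [mem_modeSet_succ] at hk ⊢
    simpa using hk

lemma zero_notMem_modeSet {K : ℕ → ℝ} (h : ℕ) : (0:ℤ) ∉ modeSet K h := by
  cases h with
  | zero => simp [modeSet]
  | succ h => simp [mem_modeSet_succ]

lemma distToInt_le_norm_ee_sub_one (k : ℤ) (a : ℝ) :
    distToInt (k * a) ≤ ‖ee k a - 1‖ := by
  convert distToInt_le_norm_exp_sub_one (k * a) using 4
  rw [ee]; congr 1; push_cast; ring

lemma modeSet_small_divisor {α : ℝ} {K : ℕ → ℝ} {q : ℕ → ℕ} (hs : IsScale α K q) {h : ℕ}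
    {k : ℤ} (hk : k ∈ modeSet K h) : |(k:ℝ)| ≤ K h ∧ 1 ≤ K h * ‖ee k α - 1‖ := by
  cases h with
  | zero => simp [modeSet] at hk
  | succ h =>
    rw [mem_modeSet_succ] at hk
    have h1 := hs.one_le (h + 1)
    refine ⟨by linarith [hk.2], ?_⟩
    have h2 := (hs.dist_ge h k hk.1 hk.2).trans (distToInt_le_norm_ee_sub_one k α)
    rwa [div_le_iff₀' (by linarith)] at h2

/-- The part of `ψ` carried by the modes outside `T` and different from zero. -/
noncomputable def highPart (T : Finset ℤ) (ψ : ℝ → ℂ) (x : ℝ) : ℂ :=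
  ψ x - ∑ k ∈ T, fc ψ k * ee k x - fc ψ 0

lemma SP_highPart (T : Finset ℤ) {ψ : ℝ → ℂ} (hψ : SP ψ) : SP (highPart T ψ) :=
  (hψ.sub (SP_trig T _)).sub (SP_const _)

lemma fc_highPart {T : Finset ℤ} (h0 : (0:ℤ) ∉ T) {ψ : ℝ → ℂ} (hψ : SP ψ) (k : ℤ) :
    fc (highPart T ψ) k = if k ∈ T ∨ k = 0 then 0 else fc ψ k := by
  have h1 : fc (highPart T ψ) k = fc ψ k - (if k ∈ T then fc ψ k else 0) -
      (if k = 0 then fc ψ 0 else 0) := by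
    unfold highPart
    rw [fc_sub (hψ.sub (SP_trig T _)) (SP_const _), fc_sub hψ (SP_trig T _), fc_trig, fc_const]
  rw [h1]
  by_cases hk0 : k = 0
  · subst hk0; simp [h0]
  · by_cases hk : k ∈ T <;> simp [hk, hk0]

lemma n0_highPart_le {T : Finset ℤ} (h0 : (0:ℤ) ∉ T) {ψ : ℝ → ℂ} (hψ : SP ψ) :
    n0 (highPart T ψ) ≤ n0 ψ := by
  rw [← wn_zero 1, ← wn_zero 1]
  refine (wn_le_of_fc_le (C := 1) le_rfl 0 hψ fun k => ?_).trans_eq (one_mul _)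
  rw [fc_highPart h0 hψ]
  split_ifs
  · simp
  · simp

lemma n0_highPart_modeSet_le {K : ℕ → ℝ} {h : ℕ} (hK : 0 < K (h + 1)) {M : ℝ} (hM : 1 ≤ M) (s : ℕ)
    {ψ : ℝ → ℂ} (hψ : SP ψ) :
    n0 (highPart (modeSet K (h + 1)) ψ) ≤ (M / (K (h + 1) / 2)) ^ s * wn M s ψ := by
  refine n0_high_le hM (by positivity) s hψ (fun k hk => ?_) (SP_highPart _ hψ)
  rw [fc_highPart (zero_notMem_modeSet _) hψ] at hk ⊢
  split_ifs at hk ⊢ with h1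
  · simp at hk
  · push Not at h1
    rw [mem_modeSet_succ] at h1
    refine ⟨?_, le_rfl⟩
    by_contra hlt
    exact h1.1 ⟨h1.2, by linarith⟩

/-- A stage of the conjugation scheme: phase, off-diagonal part, and accumulated conjugacy. -/
structure KamState where
  ψ : ℝ → ℂ
  β : ℝ → ℂ
  c : ℝ → ℂ
  d : ℝ → ℂ

/-- The estimates satisfied by a stage of the conjugation scheme. -/
structure KamState.Good (α ρ : ℝ) (A B : ℝ → ℂ) (K : ℕ → ℝ) (r S : ℕ) (e : ℝ) (h : ℕ)
    (z : KamState) : Prop where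
  hψ : SP z.ψ
  hβ : SP z.β
  hc : SP z.c
  hd : SP z.d
  real : ∀ x, (z.ψ x).im = 0
  n0_psi : n0 z.ψ + (1 / 2) ^ h / 40 ≤ 1 / 20
  n0_cd : n0 (fun x => z.c x - 1) + n0 z.d + (1 / 2) ^ h / 40 ≤ 1 / 20
  wn_beta : wn (K h ^ 2) S z.β ≤ e * K h ^ 8
  wn_psi : wn (K h ^ 2) S z.ψ ≤ K h ^ 8
  n0_beta : n0 z.β * K h ^ (12 * r) ≤ e
  high : n0 (highPart (modeSet K h) z.ψ) * K h ^ 100 ≤ 1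
  conj : ∀ x w, ∃ l : ℝ, 0 < l ∧ act (z.c (x + α)) (z.d (x + α)) (act (A x) (B x) w) =
      l * fibreMap ρ z.ψ z.β x (act (z.c x) (z.d x) w)

/-- The relation between consecutive stages, `m` being the conjugation of the step. -/
structure KamState.Step (K N : ℝ) (z z' : KamState) (m : ℝ → ℂ) : Prop where
  hm : SP m
  m_lt : ∀ x, ‖m x‖ < 1
  n0_m : n0 m ≤ K ^ 35 * n0 z.β
  c_eq : ∀ x, z'.c x = z.c x - m x * (starRingEnd ℂ) (z.d x)
  d_eq : ∀ x, z'.d x = z.d x - m x * (starRingEnd ℂ) (z.c x)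
  bounds : ∀ s : ℕ, kamThr s ≤ K →
        wn (K ^ 2) s m ≤ K ^ 80 * (wn (K ^ 2) s z.β + n0 z.β * wn (K ^ 2) s z.ψ) ∧
        wn (K ^ 2) s (fun x => z'.ψ x - z.ψ x) ≤
          K ^ 80 * (wn (K ^ 2) s z.β + n0 z.β * wn (K ^ 2) s z.ψ) ∧
        wn (K ^ 2) s z'.β ≤ K ^ 80 * (wn (K ^ 2) s z.β + n0 z.β * wn (K ^ 2) s z.ψ) ∧
        n0 z'.β ≤ (K ^ 2 / N) ^ s * (K ^ 80 * (wn (K ^ 2) s z.β + n0 z.β * wn (K ^ 2) s z.ψ))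

/-- The rotation number datum in complex coordinates. -/
structure RotDatum (α ρ : ℝ) (A B : ℝ → ℂ) (f : ℝ → ℝ → ℝ) (ψ₀ : ℝ → ℝ) : Prop where
  lift : ∀ x y, ∃ r : ℝ, 0 < r ∧ act (A x) (B x) (cis y) = r * cis (y + f x y)
  lim : ∀ x y : ℝ, Tendsto
      (fun n : ℕ => (∑ i ∈ Finset.range n, f (x + i * α) (liftOrbit f α x y i)) / n)
      atTop (nhds ρ)
  close : ∀ x y, |f x y - (ρ + ψ₀ x)| ≤ 1 / 10
  small : ∀ x, |ψ₀ x| ≤ 1 / 20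

lemma fc_zero_eq_re {ψ : ℝ → ℂ} (hreal : ∀ x, (ψ x).im = 0) : fc ψ 0 = ((fc ψ 0).re : ℂ) := by
  have h1 : (fun x => (starRingEnd ℂ) (ψ x)) = ψ := by
    funext x
    exact Complex.conj_eq_iff_im.2 (hreal x)
  have h2 := fc_conj ψ 0
  rw [h1, neg_zero] at h2
  exact (Complex.conj_eq_iff_re.1 h2.symm).symm

namespace KamState.Good
variable {α ρ : ℝ} {A B : ℝ → ℂ} {K : ℕ → ℝ} {q : ℕ → ℕ} {r S h : ℕ} {e : ℝ} {z : KamState}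
  {f : ℝ → ℝ → ℝ} {ψ₀ : ℝ → ℝ}

lemma n0_beta_mul_pow (hz : z.Good α ρ A B K r S e h) (hK : 1 ≤ K h) {n : ℕ} (hn : n ≤ 12 * r) :
    n0 z.β * K h ^ n ≤ e :=
  le_trans (by have := n0_nonneg z.β; gcongr) hz.n0_beta

lemma norm_fc_zero_le (hz : z.Good α ρ A B K r S e h) (hs : IsScale α K q)
    (hf : RotDatum α ρ A B f ψ₀) (he : e ≤ 1 / 10) :
    ‖fc z.ψ 0‖ ≤ n0 z.β + n0 (highPart (modeSet K h) z.ψ) := by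
  obtain ⟨g, hg, -, -, hg2⟩ := exists_coboundary α (T := modeSet K h)
    (fun k hk => neg_mem_modeSet hk) (fun k hk h1 => by
      have := (modeSet_small_divisor hs hk).2
      rw [h1] at this; norm_num at this) hz.real
  have hp : (0:ℝ) ≤ (1 / 2) ^ h / 40 := by positivity
  have h1 := hz.n0_psi
  have h2 := hz.n0_cd
  rw [fc_zero_eq_re hz.real, Complex.norm_real, Real.norm_eq_abs]
  have hb : n0 z.β ≤ 1 / 10 := by
    have := hz.n0_beta_mul_pow (hs.one_le h) (Nat.zero_le _)
    rw [pow_zero, mul_one] at this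
    linarith
  refine rotNum_mean_le (G := g) (Γ := n0 g) (c := z.c) (d := z.d) hf.lift hf.lim hf.close ?_ hz.real ?_
    hz.conj (fun x => norm_le_n0 hz.hβ x) hb (fun x => norm_le_n0 hg x) ?_
  · intro x
    have h3 := (Complex.abs_re_le_norm (z.ψ x)).trans (norm_le_n0 hz.hψ x)
    refine (abs_sub _ _).trans ?_
    linarith [hf.small x]
  · intro x
    have h3 := norm_le_n0 (hz.hc.sub (SP_const 1)) x
    have h4 := norm_le_n0 hz.hd x
    linarith
  · intro x
    rw [← fc_zero_eq_re hz.real, hg2, sub_right_comm]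
    exact norm_le_n0 (SP_highPart _ hz.hψ) x

lemma n0_sub_modes_le (hz : z.Good α ρ A B K r S e h) (hs : IsScale α K q)
    (hf : RotDatum α ρ A B f ψ₀) (he : e ≤ 1 / 10) (hr : 200 ≤ r) :
    n0 (fun x => z.ψ x - ∑ k ∈ modeSet K h, fc z.ψ k * ee k x) * K h ^ 100 ≤ 3 := by
  have hK := hs.one_le h
  have h1 := hz.norm_fc_zero_le hs hf he
  have h2 : n0 (fun x => z.ψ x - ∑ k ∈ modeSet K h, fc z.ψ k * ee k x) ≤
      n0 (highPart (modeSet K h) z.ψ) + ‖fc z.ψ 0‖ := by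
    have := n0_add_le (SP_highPart (modeSet K h) hz.hψ) (SP_const (fc z.ψ 0))
    have h3 : n0 (fun _ : ℝ => fc z.ψ 0) = ‖fc z.ψ 0‖ := by
      rw [← wn_zero 1, wn_const]
    rw [h3] at this
    convert this using 3 with x
    rw [highPart]; ring
  have h3 := hz.n0_beta_mul_pow hK (n := 100) (by omega)
  have h4 := hz.high
  have hp : (0:ℝ) ≤ K h ^ 100 := by positivity
  calc _ ≤ (n0 (highPart (modeSet K h) z.ψ) + (n0 z.β + n0 (highPart (modeSet K h) z.ψ))) *
      K h ^ 100 := by gcongr; linarith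
    _ = 2 * (n0 (highPart (modeSet K h) z.ψ) * K h ^ 100) + n0 z.β * K h ^ 100 := by ring
    _ ≤ 3 := by linarith

end KamState.Good

lemma pow_mul_pow_le_one {x y : ℝ} (hx : 0 ≤ x) (hx1 : x ≤ 1) (hy : 0 ≤ y) (h : x ^ 4 * y ≤ 1)
    {s t : ℕ} (hst : 4 * t ≤ s) : x ^ s * y ^ t ≤ 1 :=
  calc x ^ s * y ^ t ≤ x ^ (4 * t) * y ^ t := by
        have := pow_le_pow_of_le_one hx hx1 hst
        have := pow_nonneg hy t
        gcongr
    _ = (x ^ 4 * y) ^ t := by rw [pow_mul, mul_pow]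
    _ ≤ 1 := pow_le_one₀ (by positivity) h

lemma floor_sqrt_ratio {K L : ℝ} (hK : 4 ≤ K) (h : K ^ 12 ≤ L) :
    1 ≤ ⌊√L⌋₊ ∧ K ^ 2 / (⌊√L⌋₊ : ℝ) ≤ 1 ∧ (K ^ 2 / (⌊√L⌋₊ : ℝ)) ^ 4 * L ≤ 1 := by
  have hL0 : 0 ≤ L := le_trans (by positivity) h
  have h1 : K ^ 6 ≤ √L := by
    refine Real.le_sqrt_of_sq_le ?_
    calc (K ^ 6) ^ 2 = K ^ 12 := by ring
      _ ≤ L := h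
  have hK1 : 1 ≤ K := by linarith
  have h4 : (4:ℝ) ^ 4 ≤ K ^ 4 := by gcongr
  have h2 : K ^ 2 * 256 ≤ K ^ 6 := by
    calc K ^ 2 * 256 = K ^ 2 * 4 ^ 4 := by norm_num
      _ ≤ K ^ 2 * K ^ 4 := by gcongr
      _ = K ^ 6 := by ring
  have hK2 : 1 ≤ K ^ 2 := one_le_pow₀ hK1
  have h3 : √L / 2 ≤ (⌊√L⌋₊ : ℝ) := by
    have := Nat.lt_floor_add_one (√L)
    linarith
  have hN : K ^ 2 ≤ (⌊√L⌋₊ : ℝ) := by linarith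
  have hN0 : (0:ℝ) < (⌊√L⌋₊ : ℝ) := by linarith
  refine ⟨by exact_mod_cast hK2.trans hN, (div_le_one hN0).2 hN, ?_⟩
  rw [div_pow, div_mul_eq_mul_div, div_le_one (by positivity)]
  have h5 : 16 * K ^ 8 ≤ L := by
    calc 16 * K ^ 8 ≤ 4 ^ 4 * K ^ 8 := by gcongr; norm_num
      _ ≤ K ^ 4 * K ^ 8 := by gcongr
      _ = K ^ 12 := by ring
      _ ≤ L := h
  calc (K ^ 2) ^ 4 * L = (16 * K ^ 8) * L / 16 := by ring
    _ ≤ L * L / 16 := by gcongr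
    _ = (√L / 2) ^ 4 := by
        rw [div_pow, show √L ^ 4 = (√L ^ 2) ^ 2 by ring, Real.sq_sqrt hL0]; ring
    _ ≤ _ := by gcongr

lemma IsScale.zero_le {α : ℝ} {K : ℕ → ℝ} {q : ℕ → ℕ} (hs : IsScale α K q) (h : ℕ) :
    K 0 ≤ K h := by
  refine monotone_nat_of_le_succ (fun n => ?_) (Nat.zero_le h)
  refine le_trans ?_ (hs.growth n)
  exact le_self_pow₀ (hs.one_le n) (by norm_num)

lemma act_sub_act (m c d w : ℂ) :
    act (c - m * (starRingEnd ℂ) d) (d - m * (starRingEnd ℂ) c) w = act 1 (-m) (act c d w) := by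
  simp only [act, map_add, map_mul, Complex.conj_conj]; ring

namespace KamState.Good
variable {α ρ : ℝ} {A B : ℝ → ℂ} {K : ℕ → ℝ} {q : ℕ → ℕ} {r S h : ℕ} {e : ℝ} {z : KamState}
  {f : ℝ → ℝ → ℝ} {ψ₀ : ℝ → ℝ}

lemma step_size_le (hz : z.Good α ρ A B K r S e h) (hs : IsScale α K q) (h2 : 2 ≤ K h)
    (he0 : 0 ≤ e) :
    K h ^ 80 * (wn (K h ^ 2) S z.β + n0 z.β * wn (K h ^ 2) S z.ψ) ≤ e * K h ^ 89 := by
  have hK := hs.one_le h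
  have h1 := hz.n0_beta_mul_pow hK (Nat.zero_le _)
  rw [pow_zero, mul_one] at h1
  have hb := n0_nonneg z.β
  have hp : (0:ℝ) ≤ K h ^ 8 := by positivity
  have hp80 : (0:ℝ) ≤ K h ^ 80 := pow_nonneg (by linarith) _
  have hp88 : (0:ℝ) ≤ e * K h ^ 88 := mul_nonneg he0 (pow_nonneg (by linarith) _)
  have hw := wn_nonneg (M := K h ^ 2) (one_le_pow₀ hK) S z.ψ
  calc _ ≤ K h ^ 80 * (e * K h ^ 8 + e * K h ^ 8) := by
        gcongr
        · exact hz.wn_beta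
        · exact hz.wn_psi
    _ = e * K h ^ 88 * 2 := by ring
    _ ≤ e * K h ^ 88 * K h := by gcongr
    _ = e * K h ^ 89 := by ring

lemma step_size_zero_le (hz : z.Good α ρ A B K r S e h) :
    n0 z.β + n0 z.β * n0 z.ψ ≤ 2 * n0 z.β := by
  have hb := n0_nonneg z.β
  have h1 := hz.n0_psi
  have hp : (0:ℝ) ≤ (1 / 2) ^ h / 40 := by positivity
  nlinarith

end KamState.Good

lemma inv_scale_le {α : ℝ} {K : ℕ → ℝ} {q : ℕ → ℕ} (hs : IsScale α K q) (h2 : 2 ≤ K 0) (h : ℕ) :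
    (K h)⁻¹ ≤ (K 0)⁻¹ * (1 / 2) ^ h := by
  have h1 := hs.geometric h2 h
  calc (K h)⁻¹ ≤ (K 0 * 2 ^ h)⁻¹ := by gcongr
    _ = _ := by rw [mul_inv, one_div, inv_pow]

namespace KamState.Good
variable {α ρ : ℝ} {A B : ℝ → ℂ} {K : ℕ → ℝ} {q : ℕ → ℕ} {r S h : ℕ} {e : ℝ} {z : KamState}
  {f : ℝ → ℝ → ℝ} {ψ₀ : ℝ → ℝ}

set_option maxHeartbeats 1000000 in
/-- One step of the conjugation scheme preserves the estimates. -/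
theorem exists_step (hz : z.Good α ρ A B K r S e h) (hs : IsScale α K q)
    (hf : RotDatum α ρ A B f ψ₀) (he0 : 0 ≤ e) (he : e ≤ 1 / 10) (hr : 200 ≤ r)
    (hS : S + 2 = 50 * r) (hK0 : kamThr 0 ≤ K 0) (hKS : kamThr S ≤ K 0)
    (hd : ∀ k : ℤ, |k| ≤ (⌊√(K (h + 1))⌋₊ : ℤ) →
      1 ≤ K h ^ 24 * ‖ee k α - Complex.exp (4 * π * Complex.I * ρ)‖) :
    ∃ z' m, z'.Good α ρ A B K r S e (h + 1) ∧ Step (K h) ⌊√(K (h + 1))⌋₊ z z' m := by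
  have hle := hs.zero_le h
  obtain ⟨-, h4096, -, -⟩ := le_of_kamThr_le hK0
  have hK := hs.one_le h
  have hKp := hs.one_le (h + 1)
  have hK0' : 0 ≤ K h := by linarith
  have hgr := hs.growth h
  have h2 : 2 ≤ K h := by linarith
  have hM : 1 ≤ K h ^ 2 := one_le_pow₀ hK
  obtain ⟨hN1, hN2, hN3⟩ := floor_sqrt_ratio (by linarith) hgr
  have hb100 := hz.n0_beta_mul_pow hK (n := 100) (by omega)
  have hpw : (0:ℝ) < (1 / 2) ^ h / 40 := by positivity
  have hpsi := hz.n0_psi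
  have hcd := hz.n0_cd
  have hbn := n0_nonneg z.β
  obtain ⟨m, ψ', β', hm, hψ', hβ', hreal', hmlt, hnm, hconj, hbd⟩ :=
    kam_step hN1 (hK0.trans hle) (T := modeSet K h) (fun k hk => neg_mem_modeSet hk)
      (fun k hk => modeSet_small_divisor hs hk) hd hz.hψ hz.hβ hz.real (by linarith)
      (by linarith) (hz.n0_sub_modes_le hs hf he hr)
  have hsmall : K h ^ 80 * (2 * n0 z.β) ≤ (1 / 2) ^ h / 320 := by
    have h1 := inv_scale_le hs (by linarith) h
    have h3 : n0 z.β * K h ^ 82 ≤ 1 := (hz.n0_beta_mul_pow hK (by omega)).trans (by linarith)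
    have h5 : K h ^ 80 * (2 * n0 z.β) ≤ (K h)⁻¹ := by
      rw [← one_div, le_div_iff₀ (by linarith)]
      have h7 : (0:ℝ) ≤ n0 z.β * K h ^ 81 := mul_nonneg hbn (pow_nonneg hK0' _)
      calc K h ^ 80 * (2 * n0 z.β) * K h = n0 z.β * K h ^ 81 * 2 := by ring
        _ ≤ n0 z.β * K h ^ 81 * K h := by gcongr
        _ = n0 z.β * K h ^ 82 := by ring
        _ ≤ 1 := h3
    have h6 : (K 0)⁻¹ ≤ 1 / 320 := by
      rw [inv_le_comm₀ (by linarith) (by norm_num)]; linarith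
    calc _ ≤ _ := h5
      _ ≤ _ := h1
      _ ≤ 1 / 320 * (1 / 2) ^ h := by gcongr
      _ = _ := by ring
  have hn0m : n0 m ≤ (1 / 2) ^ h / 320 := by
    refine le_trans (hnm.trans ?_) hsmall
    calc K h ^ 35 * n0 z.β ≤ K h ^ 80 * n0 z.β := by gcongr; norm_num
      _ ≤ K h ^ 80 * (2 * n0 z.β) := by gcongr; linarith
  have hdiff : n0 (fun x => ψ' x - z.ψ x) ≤ (1 / 2) ^ h / 320 := by
    have h1 := (hbd 0 (hK0.trans hle)).2.1
    simp only [wn_zero] at h1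
    refine h1.trans (le_trans ?_ hsmall)
    have := hz.step_size_zero_le
    gcongr
  obtain ⟨hb1, hb2, hb3, hb4⟩ := hbd S (hKS.trans hle)
  have hW := hz.step_size_le hs h2 he0
  have h96 : K h ^ 96 ≤ K (h + 1) ^ 8 := by
    calc K h ^ 96 = (K h ^ 12) ^ 8 := by ring
      _ ≤ _ := by gcongr
  have h89 : K h ^ 89 ≤ K (h + 1) ^ 8 := le_trans (by gcongr; norm_num) h96
  have hW' := hW.trans (mul_le_mul_of_nonneg_left h89 he0)
  have hMp : K h ^ 2 ≤ K (h + 1) ^ 2 := by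
    have : K h ≤ K (h + 1) := (le_self_pow₀ hK (by norm_num)).trans hgr
    gcongr
  have hwψ : wn (K h ^ 2) S ψ' ≤ K (h + 1) ^ 8 := by
    have h1 := wn_add_le hM S hz.hψ (hψ'.sub hz.hψ)
    simp only [add_sub_cancel] at h1
    have h3 : K h ^ 8 ≤ K h ^ 89 := by gcongr; norm_num
    calc _ ≤ _ := h1
      _ ≤ K h ^ 8 + e * K h ^ 89 := add_le_add hz.wn_psi (hb2.trans hW)
      _ ≤ K h ^ 89 + 1 * K h ^ 89 := by gcongr; linarith
      _ = 2 * K h ^ 89 := by ring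
      _ ≤ K h * K h ^ 89 := by gcongr
      _ = K h ^ 90 := by ring
      _ ≤ K h ^ 96 := by gcongr; norm_num
      _ ≤ _ := h96
  have hhalf : ((1:ℝ) / 2) ^ (h + 1) = (1 / 2) ^ h / 2 := by rw [pow_succ]; ring
  refine ⟨⟨ψ', β', fun x => z.c x - m x * (starRingEnd ℂ) (z.d x),
    fun x => z.d x - m x * (starRingEnd ℂ) (z.c x)⟩, m,
    { hψ := hψ', hβ := hβ', hc := hz.hc.sub (hm.mul hz.hd.conj), hd := hz.hd.sub (hm.mul hz.hc.conj),
      real := hreal', n0_psi := ?_, n0_cd := ?_, wn_beta := ?_, wn_psi := ?_,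
      n0_beta := ?_, high := ?_, conj := ?_ }, ⟨hm, hmlt, hnm, fun x => rfl, fun x => rfl, hbd⟩⟩
  · have h1 := n0_add_le hz.hψ (hψ'.sub hz.hψ)
    simp only [add_sub_cancel] at h1
    change n0 ψ' + _ ≤ _
    rw [hhalf]
    linarith
  · have hnd := n0_nonneg z.d
    have hnc := n0_nonneg (fun x => z.c x - 1)
    have hmn := n0_nonneg m
    have h1 : n0 (fun x => z.c x - m x * (starRingEnd ℂ) (z.d x) - 1) ≤
        n0 (fun x => z.c x - 1) + n0 m * n0 z.d := by
      have := n0_sub_le (hz.hc.sub (SP_const 1)) (hm.mul hz.hd.conj)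
      have h3 := n0_mul_le hm hz.hd.conj
      rw [n0_conj] at h3
      simp only [sub_right_comm _ _ (1:ℂ)]
      linarith
    have h3 : n0 (fun x => z.d x - m x * (starRingEnd ℂ) (z.c x)) ≤
        n0 z.d + n0 m * (n0 (fun x => z.c x - 1) + 1) := by
      have h4 := n0_sub_le hz.hd (hm.mul hz.hc.conj)
      have h3 := n0_mul_le hm hz.hc.conj
      rw [n0_conj] at h3
      have h5 := n0_add_le (hz.hc.sub (SP_const 1)) (SP_const 1)
      have h6 : n0 (fun _ : ℝ => (1:ℂ)) = 1 := by rw [← wn_zero 1, wn_const, norm_one]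
      simp only [sub_add_cancel, h6] at h5
      nlinarith
    change n0 (fun x => z.c x - m x * (starRingEnd ℂ) (z.d x) - 1) +
      n0 (fun x => z.d x - m x * (starRingEnd ℂ) (z.c x)) + _ ≤ _
    rw [hhalf]
    nlinarith
  · exact (wn_antitone hM hMp S hβ').trans (hb3.trans hW')
  · exact (wn_antitone hM hMp S hψ').trans hwψ
  · have h1 := pow_mul_pow_le_one (by positivity) hN2 (by linarith) hN3 (s := S) (t := 12 * r + 8)
      (by omega)
    have h3 : (0:ℝ) ≤ (K h ^ 2 / (⌊√(K (h + 1))⌋₊ : ℝ)) ^ S := by positivity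
    have h5 : (0:ℝ) ≤ K (h + 1) ^ (12 * r) := pow_nonneg (by linarith) _
    change n0 β' * _ ≤ _
    calc n0 β' * K (h + 1) ^ (12 * r) ≤ (K h ^ 2 / (⌊√(K (h + 1))⌋₊ : ℝ)) ^ S *
          (e * K (h + 1) ^ 8) * K (h + 1) ^ (12 * r) := by
          gcongr
          exact hb4.trans (mul_le_mul_of_nonneg_left hW' h3)
      _ = e * ((K h ^ 2 / (⌊√(K (h + 1))⌋₊ : ℝ)) ^ S * K (h + 1) ^ (12 * r + 8)) := by ring
      _ ≤ e * 1 := by gcongr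
      _ = e := mul_one _
  · have hx : K h ^ 2 / (K (h + 1) / 2) ≤ 1 ∧ (K h ^ 2 / (K (h + 1) / 2)) ^ 4 * K (h + 1) ≤ 1 := by
      have hp1 : (0:ℝ) < K (h + 1) / 2 := by linarith
      have h1 : 16 * K h ^ 8 ≤ K (h + 1) := by
        calc 16 * K h ^ 8 ≤ K h * K h ^ 8 := by gcongr; linarith
          _ = K h ^ 9 := by ring
          _ ≤ K h ^ 12 := by gcongr; norm_num
          _ ≤ _ := hgr
      have h3 : K h ^ 2 ≤ K h ^ 8 := by gcongr; norm_num
      refine ⟨(div_le_one hp1).2 (by linarith), ?_⟩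
      rw [div_pow, div_mul_eq_mul_div, div_le_one (by positivity)]
      have hpp : (1:ℝ) ≤ K (h + 1) ^ 2 := one_le_pow₀ hKp
      have hp8 : (0:ℝ) ≤ K (h + 1) := by linarith
      calc (K h ^ 2) ^ 4 * K (h + 1) = (16 * K h ^ 8) * K (h + 1) * 1 / 16 := by ring
        _ ≤ K (h + 1) * K (h + 1) * K (h + 1) ^ 2 / 16 := by gcongr
        _ = _ := by ring
    have h1 := pow_mul_pow_le_one (by positivity) hx.1 (by linarith) hx.2 (s := S) (t := 108)
      (by omega)
    have h3 := n0_highPart_modeSet_le (K := K) (h := h) (by linarith) hM S hψ'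
    have h5 : (0:ℝ) ≤ (K h ^ 2 / (K (h + 1) / 2)) ^ S := by positivity
    have h7 : (0:ℝ) ≤ K (h + 1) ^ 100 := pow_nonneg (by linarith) _
    change n0 (highPart (modeSet K (h + 1)) ψ') * _ ≤ _
    calc _ ≤ (K h ^ 2 / (K (h + 1) / 2)) ^ S * K (h + 1) ^ 8 * K (h + 1) ^ 100 := by
          gcongr
          exact h3.trans (mul_le_mul_of_nonneg_left hwψ h5)
      _ = (K h ^ 2 / (K (h + 1) / 2)) ^ S * K (h + 1) ^ 108 := by ring
      _ ≤ 1 := h1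
  · intro x w
    obtain ⟨l, hl, hl2⟩ := hz.conj x w
    obtain ⟨l', hl', hl2'⟩ := hconj x (act (z.c x) (z.d x) w)
    refine ⟨l * l', mul_pos hl hl', ?_⟩
    simp only [act_sub_act]
    rw [hl2, act_real_mul, hl2']
    push_cast; ring

end KamState.Good

namespace KamState

/-- An infinite run of the conjugation scheme. -/
structure Run (α ρ : ℝ) (A B : ℝ → ℂ) (K : ℕ → ℝ) (r S : ℕ) (e : ℝ) (z : ℕ → KamState)
    (m : ℕ → ℝ → ℂ) : Prop where
  good : ∀ h, (z h).Good α ρ A B K r S e h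
  step : ∀ h, Step (K h) ⌊√(K (h + 1))⌋₊ (z h) (z (h + 1)) (m h)

variable {α ρ : ℝ} {A B : ℝ → ℂ} {K : ℕ → ℝ} {q : ℕ → ℕ} {r S : ℕ} {e : ℝ}
  {f : ℝ → ℝ → ℝ} {ψ₀ : ℝ → ℝ}

theorem exists_run {z₀ : KamState} (hz : z₀.Good α ρ A B K r S e 0) (hs : IsScale α K q)
    (hf : RotDatum α ρ A B f ψ₀) (he0 : 0 ≤ e) (he : e ≤ 1 / 10) (hr : 200 ≤ r)
    (hS : S + 2 = 50 * r) (hK0 : kamThr 0 ≤ K 0) (hKS : kamThr S ≤ K 0)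
    (hd : ∀ h, ∀ k : ℤ, |k| ≤ (⌊√(K (h + 1))⌋₊ : ℤ) →
      1 ≤ K h ^ 24 * ‖ee k α - Complex.exp (4 * π * Complex.I * ρ)‖) :
    ∃ z m, z 0 = z₀ ∧ Run α ρ A B K r S e z m := by
  have key : ∀ h (z : {z : KamState // z.Good α ρ A B K r S e h}),
      ∃ p : {z : KamState // z.Good α ρ A B K r S e (h + 1)} × (ℝ → ℂ),
        Step (K h) ⌊√(K (h + 1))⌋₊ z.1 p.1.1 p.2 := fun h z => by
    obtain ⟨z', m, h1, h2⟩ := z.2.exists_step hs hf he0 he hr hS hK0 hKS (hd h)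
    exact ⟨(⟨z', h1⟩, m), h2⟩
  choose F hF using key
  let Z : (h : ℕ) → {z : KamState // z.Good α ρ A B K r S e h} :=
    fun h => Nat.rec ⟨z₀, hz⟩ (fun n z => (F n z).1) h
  exact ⟨fun h => (Z h).1, fun h => (F h (Z h)).2, rfl, fun h => (Z h).2, fun h => hF h (Z h)⟩

end KamState

lemma IsScale.eventually_ge {α : ℝ} {K : ℕ → ℝ} {q : ℕ → ℕ} (hs : IsScale α K q) (h2 : 2 ≤ K 0)
    (C : ℝ) : ∃ h₀, ∀ h, h₀ ≤ h → C ≤ K h := by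
  obtain ⟨n, hn⟩ := pow_unbounded_of_one_lt C (one_lt_two)
  refine ⟨n, fun h hh => ?_⟩
  have h1 := hs.geometric h2 h
  have h3 : (2:ℝ) ^ n ≤ 2 ^ h := by gcongr; norm_num
  have h4 : (0:ℝ) ≤ 2 ^ h := by positivity
  nlinarith

lemma wn_one_le_of_bounds {K g : ℝ} (hK : 1 ≤ K) {r s : ℕ} (hrs : r ≤ s) {u : ℝ → ℂ} (hu : SP u)
    (hV : n0 u * K ^ (3 * r + 1) ≤ g) (hW : wn (K ^ 2) s u * K ^ (3 * r + 1) ≤ g * K ^ s) :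
    wn 1 r u ≤ 2 * g * K⁻¹ := by
  have hM : 1 ≤ K ^ 2 := one_le_pow₀ hK
  have hK0 : 0 < K := by linarith
  have h1 := wn_one_le hM r hu
  have h2 := wn_interp hM hK hrs hu
  have hs0 : 0 < K ^ s := pow_pos hK0 _
  have hr0 : 0 ≤ K ^ (2 * r + 1) := pow_nonneg hK0.le _
  rw [← div_eq_mul_inv, le_div_iff₀ hK0]
  refine le_of_mul_le_mul_left ?_ hs0
  have hKs : 0 ≤ K ^ s * K := mul_nonneg hs0.le hK0.le
  calc K ^ s * (wn 1 r u * K) = K ^ s * K * wn 1 r u := by ring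
    _ ≤ K ^ s * K * ((K ^ 2) ^ r * wn (K ^ 2) r u) := by gcongr
    _ = K ^ (2 * r + 1) * (K ^ s * wn (K ^ 2) r u) := by ring
    _ ≤ K ^ (2 * r + 1) * (K ^ (r + s) * n0 u + K ^ r * wn (K ^ 2) s u) := by gcongr
    _ = K ^ s * (n0 u * K ^ (3 * r + 1)) + wn (K ^ 2) s u * K ^ (3 * r + 1) := by ring
    _ ≤ K ^ s * g + g * K ^ s := by gcongr
    _ = K ^ s * (2 * g) := by ring

namespace KamState

lemma Step.n0_m_le {K N : ℝ} {z z' : KamState} {m : ℝ → ℂ} (h : Step K N z z' m) (hK : 1 ≤ K) :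
    n0 m ≤ K ^ 80 * (2 * n0 z.β) := by
  have hb := n0_nonneg z.β
  refine h.n0_m.trans ?_
  calc K ^ 35 * n0 z.β ≤ K ^ 80 * n0 z.β := by gcongr; norm_num
    _ ≤ K ^ 80 * (2 * n0 z.β) := by gcongr; linarith

variable {α ρ : ℝ} {A B : ℝ → ℂ} {K : ℕ → ℝ} {q : ℕ → ℕ} {r S : ℕ} {e : ℝ}
  {z : ℕ → KamState} {m : ℕ → ℝ → ℂ}

namespace Run

lemma n0_psi_sub_le (hz : Run α ρ A B K r S e z m) (hs : IsScale α K q) (hK0 : kamThr 0 ≤ K 0)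
    (h : ℕ) : n0 (fun x => (z (h + 1)).ψ x - (z h).ψ x) ≤ K h ^ 80 * (2 * n0 (z h).β) := by
  have h1 := ((hz.step h).bounds 0 (hK0.trans (hs.zero_le h))).2.1
  simp only [wn_zero] at h1
  have := (hz.good h).step_size_zero_le
  have hK : 0 ≤ K h := le_trans zero_le_one (hs.one_le h)
  exact h1.trans (mul_le_mul_of_nonneg_left this (pow_nonneg hK _))

/-- Quantitative increments at the regularity of the main estimate. -/
lemma wn_increment_le (hz : Run α ρ A B K r S e z m) (hs : IsScale α K q) (he0 : 0 ≤ e)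
    (hr : 200 ≤ r) (hS : S + 2 = 50 * r) (hK0 : kamThr 0 ≤ K 0) (hKS : kamThr S ≤ K 0) (h : ℕ) :
    wn 1 r (m h) ≤ 2 * e * (K h)⁻¹ ∧
      wn 1 r (fun x => (z (h + 1)).ψ x - (z h).ψ x) ≤ 2 * e * (K h)⁻¹ := by
  have hle := hs.zero_le h
  obtain ⟨-, h4096, -, -⟩ := le_of_kamThr_le hK0
  have hK := hs.one_le h
  have hKn : 0 ≤ K h := by linarith
  have h2 : 2 ≤ K h := by linarith
  have hb := n0_nonneg (z h).β
  have hV : ∀ u : ℝ → ℂ, n0 u ≤ K h ^ 80 * (2 * n0 (z h).β) → n0 u * K h ^ (3 * r + 1) ≤ e := by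
    intro u hu
    have hp : (0:ℝ) ≤ n0 (z h).β * K h ^ (3 * r + 81) := mul_nonneg hb (pow_nonneg hKn _)
    calc n0 u * K h ^ (3 * r + 1) ≤ K h ^ 80 * (2 * n0 (z h).β) * K h ^ (3 * r + 1) := by gcongr
      _ = n0 (z h).β * K h ^ (3 * r + 81) * 2 := by ring
      _ ≤ n0 (z h).β * K h ^ (3 * r + 81) * K h := by gcongr
      _ = n0 (z h).β * K h ^ (3 * r + 82) := by ring
      _ ≤ e := (hz.good h).n0_beta_mul_pow hK (by omega)
  have hW : ∀ w : ℝ, w ≤ K h ^ 80 * (wn (K h ^ 2) S (z h).β + n0 (z h).β * wn (K h ^ 2) S (z h).ψ) →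
      w * K h ^ (3 * r + 1) ≤ e * K h ^ S := by
    intro w hw
    have h3 := hw.trans ((hz.good h).step_size_le hs h2 he0)
    calc w * K h ^ (3 * r + 1) ≤ e * K h ^ 89 * K h ^ (3 * r + 1) := by gcongr
      _ = e * K h ^ (3 * r + 90) := by ring
      _ ≤ e * K h ^ S := by gcongr 2; omega
  obtain ⟨h3, h4, -, -⟩ := (hz.step h).bounds S (hKS.trans hle)
  exact ⟨wn_one_le_of_bounds hK (by omega) (hz.step h).hm (hV _ ((hz.step h).n0_m_le hK)) (hW _ h3),
    wn_one_le_of_bounds hK (by omega) ((hz.good (h + 1)).hψ.sub (hz.good h).hψ)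
      (hV _ (hz.n0_psi_sub_le hs hK0 h)) (hW _ h4)⟩

lemma exists_growth (hz : Run α ρ A B K r S e z m) (hs : IsScale α K q) (he : e ≤ 1 / 10)
    (hK0 : kamThr 0 ≤ K 0) (s : ℕ) : ∃ G : ℝ, 0 ≤ G ∧ ∀ h,
      wn (K h ^ 2) s (z h).β + wn (K h ^ 2) s (z h).ψ ≤ G * K h ^ 8 := by
  obtain ⟨-, h4096, -, -⟩ := le_of_kamThr_le hK0
  obtain ⟨h₀, hh⟩ := hs.eventually_ge (by linarith) (kamThr s)
  have hM : ∀ h, 1 ≤ K h ^ 2 := fun h => one_le_pow₀ (hs.one_le h)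
  set W : ℕ → ℝ := fun h => wn (K h ^ 2) s (z h).β + wn (K h ^ 2) s (z h).ψ with hW
  have hW0 : ∀ h, 0 ≤ W h := fun h => add_nonneg (wn_nonneg (hM h) _ _) (wn_nonneg (hM h) _ _)
  have hG : 0 ≤ ∑ i ∈ Finset.range (h₀ + 1), W i := Finset.sum_nonneg fun i _ => hW0 i
  refine ⟨∑ i ∈ Finset.range (h₀ + 1), W i, hG, ?_⟩
  have hlow : ∀ h ≤ h₀, W h ≤ (∑ i ∈ Finset.range (h₀ + 1), W i) * K h ^ 8 := fun h hle =>
    (Finset.single_le_sum (fun i _ => hW0 i) (Finset.mem_range.2 (by omega))).trans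
      (le_mul_of_one_le_right hG (one_le_pow₀ (hs.one_le h)))
  intro h
  rcases le_total h h₀ with hle | hle
  · exact hlow h hle
  induction h, hle using Nat.le_induction with
  | base => exact hlow h₀ le_rfl
  | succ h hle ih =>
    set G := ∑ i ∈ Finset.range (h₀ + 1), W i
    have hK := hs.one_le h
    have hKn : 0 ≤ K h := by linarith
    have hgr := hs.growth h
    obtain ⟨-, h4, h5, -⟩ := (hz.step h).bounds s (hh h hle)
    have hb1 : n0 (z h).β ≤ 1 := by
      have := (hz.good h).n0_beta_mul_pow hK (Nat.zero_le _)
      rw [pow_zero, mul_one] at this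
      linarith
    have hwψ := wn_nonneg (hM h) s (z h).ψ
    have hD : K h ^ 80 * (wn (K h ^ 2) s (z h).β + n0 (z h).β * wn (K h ^ 2) s (z h).ψ) ≤
        K h ^ 80 * W h := by
      have : n0 (z h).β * wn (K h ^ 2) s (z h).ψ ≤ wn (K h ^ 2) s (z h).ψ :=
        mul_le_of_le_one_left hwψ hb1
      exact mul_le_mul_of_nonneg_left (add_le_add_right this _) (pow_nonneg hKn _)
    have hMp : K h ^ 2 ≤ K (h + 1) ^ 2 := by
      have : K h ≤ K (h + 1) := (le_self_pow₀ hK (by norm_num)).trans hgr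
      gcongr
    have a1 := (wn_antitone (hM h) hMp s (hz.good (h + 1)).hβ).trans (h5.trans hD)
    have a2 : wn (K (h + 1) ^ 2) s (z (h + 1)).ψ ≤ W h + K h ^ 80 * W h := by
      refine (wn_antitone (hM h) hMp s (hz.good (h + 1)).hψ).trans ?_
      have h1 := wn_add_le (hM h) s (hz.good h).hψ ((hz.good (h + 1)).hψ.sub (hz.good h).hψ)
      simp only [add_sub_cancel] at h1
      have := wn_nonneg (hM h) s (z h).β
      have : wn (K h ^ 2) s (z h).ψ ≤ W h := by rw [hW]; linarith
      linarith [h4.trans hD]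
    have h80 : 1 ≤ K h ^ 80 := one_le_pow₀ hK
    have h3K : 3 ≤ K h := by linarith [hs.zero_le h]
    have hKG : (0:ℝ) ≤ G * K h ^ 88 := mul_nonneg hG (pow_nonneg hKn _)
    have hp80 : (0:ℝ) ≤ K h ^ 80 := by linarith
    calc W (h + 1) ≤ K h ^ 80 * W h + (1 * W h + K h ^ 80 * W h) := by
          rw [one_mul]; exact add_le_add a1 a2
      _ ≤ K h ^ 80 * W h + (K h ^ 80 * W h + K h ^ 80 * W h) := by
          gcongr
          exact hW0 h
      _ = 3 * (K h ^ 80 * W h) := by ring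
      _ ≤ 3 * (K h ^ 80 * (G * K h ^ 8)) := by gcongr
      _ = 3 * (G * K h ^ 88) := by ring
      _ ≤ K h * (G * K h ^ 88) := by gcongr
      _ = G * K h ^ 89 := by ring
      _ ≤ G * K h ^ 96 := by gcongr; norm_num
      _ = G * (K h ^ 12) ^ 8 := by ring
      _ ≤ G * K (h + 1) ^ 8 := by gcongr

lemma step_size_le_growth (hz : Run α ρ A B K r S e z m) (hs : IsScale α K q) (he : e ≤ 1 / 10)
    {s : ℕ} {G : ℝ} {h : ℕ}
    (hG : wn (K h ^ 2) s (z h).β + wn (K h ^ 2) s (z h).ψ ≤ G * K h ^ 8) :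
    K h ^ 80 * (wn (K h ^ 2) s (z h).β + n0 (z h).β * wn (K h ^ 2) s (z h).ψ) ≤ G * K h ^ 88 := by
  have hK := hs.one_le h
  have hKn : 0 ≤ K h := by linarith
  have hb1 : n0 (z h).β ≤ 1 := by
    have := (hz.good h).n0_beta_mul_pow hK (Nat.zero_le _)
    rw [pow_zero, mul_one] at this
    linarith
  have hwψ := wn_nonneg (M := K h ^ 2) (one_le_pow₀ hK) s (z h).ψ
  have : n0 (z h).β * wn (K h ^ 2) s (z h).ψ ≤ wn (K h ^ 2) s (z h).ψ :=
    mul_le_of_le_one_left hwψ hb1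
  calc _ ≤ K h ^ 80 * (G * K h ^ 8) := by gcongr; linarith
    _ = _ := by ring

lemma exists_n0_beta_decay (hz : Run α ρ A B K r S e z m) (hs : IsScale α K q) (he : e ≤ 1 / 10)
    (hK0 : kamThr 0 ≤ K 0) (t : ℕ) : ∃ G : ℝ, 0 ≤ G ∧ ∃ h₀, ∀ h, h₀ ≤ h →
      n0 (z h).β * K h ^ t ≤ G := by
  obtain ⟨-, h4096, -, -⟩ := le_of_kamThr_le hK0
  obtain ⟨h₀, hh⟩ := hs.eventually_ge (by linarith) (kamThr (4 * (t + 8)))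
  obtain ⟨G, hG, hg⟩ := hz.exists_growth hs he hK0 (4 * (t + 8))
  refine ⟨G, hG, h₀ + 1, fun h' hh' => ?_⟩
  obtain ⟨h, rfl⟩ : ∃ h, h' = h + 1 := ⟨h' - 1, by omega⟩
  have hK := hs.one_le h
  have hKn : 0 ≤ K h := by linarith
  have hKp := hs.one_le (h + 1)
  have hgr := hs.growth h
  obtain ⟨hN1, hN2, hN3⟩ := floor_sqrt_ratio (by linarith [hs.zero_le h]) hgr
  obtain ⟨-, -, -, h6⟩ := (hz.step h).bounds _ (hh h (by omega))
  have h7 := hz.step_size_le_growth hs he (hg h)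
  have h1 := pow_mul_pow_le_one (by positivity) hN2 (by linarith) hN3 (s := 4 * (t + 8))
    (t := t + 8) le_rfl
  set X := K h ^ 2 / (⌊√(K (h + 1))⌋₊ : ℝ)
  have hX : 0 ≤ X := by positivity
  have h8 : K h ^ 88 ≤ K (h + 1) ^ 8 := by
    calc K h ^ 88 ≤ K h ^ 96 := by gcongr; norm_num
      _ = (K h ^ 12) ^ 8 := by ring
      _ ≤ _ := by gcongr
  have hXs : 0 ≤ X ^ (4 * (t + 8)) := by positivity
  calc n0 (z (h + 1)).β * K (h + 1) ^ t ≤ X ^ (4 * (t + 8)) * (G * K (h + 1) ^ 8) * K (h + 1) ^ t := by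
        gcongr
        refine h6.trans (mul_le_mul_of_nonneg_left (h7.trans ?_) hXs)
        gcongr
    _ = G * (X ^ (4 * (t + 8)) * K (h + 1) ^ (t + 8)) := by ring
    _ ≤ G * 1 := by gcongr
    _ = G := mul_one _

lemma summable_increments (hz : Run α ρ A B K r S e z m) (hs : IsScale α K q) (he : e ≤ 1 / 10)
    (hK0 : kamThr 0 ≤ K 0) (p : ℕ) : Summable (fun h => wn 1 p (m h)) ∧
      Summable (fun h => wn 1 p (fun x => (z (h + 1)).ψ x - (z h).ψ x)) := by
  obtain ⟨-, h4096, -, -⟩ := le_of_kamThr_le hK0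
  have h20 : 2 ≤ K 0 := by linarith
  obtain ⟨h₁, hh₁⟩ := hs.eventually_ge h20 (kamThr (3 * p + 89))
  obtain ⟨G₁, hG₁, hg₁⟩ := hz.exists_growth hs he hK0 (3 * p + 89)
  obtain ⟨G₂, hG₂, h₂, hg₂⟩ := hz.exists_n0_beta_decay hs he hK0 (3 * p + 81)
  have key : ∀ h, max h₁ h₂ ≤ h → wn 1 p (m h) ≤ 2 * (G₁ + 2 * G₂) * (K h)⁻¹ ∧
      wn 1 p (fun x => (z (h + 1)).ψ x - (z h).ψ x) ≤ 2 * (G₁ + 2 * G₂) * (K h)⁻¹ := by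
    intro h hh
    have hK := hs.one_le h
    have hKn : 0 ≤ K h := by linarith
    have hV : ∀ u : ℝ → ℂ, n0 u ≤ K h ^ 80 * (2 * n0 (z h).β) →
        n0 u * K h ^ (3 * p + 1) ≤ G₁ + 2 * G₂ := by
      intro u hu
      calc n0 u * K h ^ (3 * p + 1) ≤ K h ^ 80 * (2 * n0 (z h).β) * K h ^ (3 * p + 1) := by gcongr
        _ = 2 * (n0 (z h).β * K h ^ (3 * p + 81)) := by ring
        _ ≤ 2 * G₂ := by
          have := hg₂ h ((le_max_right _ _).trans hh)
          gcongr
        _ ≤ _ := by linarith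
    have hW : ∀ w : ℝ, w ≤ K h ^ 80 * (wn (K h ^ 2) (3 * p + 89) (z h).β +
        n0 (z h).β * wn (K h ^ 2) (3 * p + 89) (z h).ψ) →
        w * K h ^ (3 * p + 1) ≤ (G₁ + 2 * G₂) * K h ^ (3 * p + 89) := by
      intro w hw
      have h3 := hw.trans (hz.step_size_le_growth hs he (hg₁ h))
      calc w * K h ^ (3 * p + 1) ≤ G₁ * K h ^ 88 * K h ^ (3 * p + 1) := by gcongr
        _ = G₁ * K h ^ (3 * p + 89) := by ring
        _ ≤ (G₁ + 2 * G₂) * K h ^ (3 * p + 89) := by gcongr; linarith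
    obtain ⟨h3, h4, -, -⟩ := (hz.step h).bounds _ (hh₁ h ((le_max_left _ _).trans hh))
    exact ⟨wn_one_le_of_bounds hK (by omega) (hz.step h).hm (hV _ ((hz.step h).n0_m_le hK))
      (hW _ h3), wn_one_le_of_bounds hK (by omega) ((hz.good (h + 1)).hψ.sub (hz.good h).hψ)
      (hV _ (hz.n0_psi_sub_le hs hK0 h)) (hW _ h4)⟩
  have hsum : Summable (fun h => 2 * (G₁ + 2 * G₂) * (K h)⁻¹) := by
    refine Summable.mul_left _ (Summable.of_nonneg_of_le (fun h => ?_) (inv_scale_le hs h20)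
      (summable_geometric_two.mul_left _))
    have := hs.one_le h
    positivity
  constructor
  · refine Summable.of_norm_bounded_eventually_nat hsum ?_
    filter_upwards [eventually_ge_atTop (max h₁ h₂)] with h hh
    rw [Real.norm_of_nonneg (wn_nonneg le_rfl _ _)]
    exact (key h hh).1
  · refine Summable.of_norm_bounded_eventually_nat hsum ?_
    filter_upwards [eventually_ge_atTop (max h₁ h₂)] with h hh
    rw [Real.norm_of_nonneg (wn_nonneg le_rfl _ _)]
    exact (key h hh).2

end Run
end KamState

lemma exists_smooth_limit {u : ℕ → ℝ → ℂ} (hu : ∀ h, SP (u h))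
    (hs : ∀ p, Summable (fun h => wn 1 p (fun x => u (h + 1) x - u h x))) :
    ∃ U : ℝ → ℂ, SP U ∧ (∀ x, Tendsto (fun h => u h x) atTop (nhds (U x))) ∧
      ∀ p, wn 1 p (fun x => U x - u 0 x) ≤ ∑' h, wn 1 p (fun x => u (h + 1) x - u h x) := by
  obtain ⟨h1, h2⟩ := SP_series (fun h => (hu (h + 1)).sub (hu h)) hs
  refine ⟨fun x => u 0 x + ∑' h, (u (h + 1) x - u h x), (hu 0).add h1, fun x => ?_, fun p => ?_⟩
  · have h3 := (h2 x).tendsto_sum_nat.const_add (u 0 x)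
    refine h3.congr fun n => ?_
    rw [Finset.sum_range_sub (fun h => u h x)]
    ring
  · simp only [add_sub_cancel_left]
    exact wn_series le_rfl p (fun h => (hu (h + 1)).sub (hu h)) h1 h2 (hs p)

namespace KamState

lemma tsum_inv_scale_le {α : ℝ} {K : ℕ → ℝ} {q : ℕ → ℕ} (hs : IsScale α K q) (h2 : 2 ≤ K 0)
    {x : ℕ → ℝ} {e : ℝ} (hx0 : ∀ h, 0 ≤ x h) (he0 : 0 ≤ e) (hx : ∀ h, x h ≤ 2 * e * (K h)⁻¹) :
    ∑' h, x h ≤ 4 * e * (K 0)⁻¹ := by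
  have h1 : ∀ h, x h ≤ 2 * e * (K 0)⁻¹ * (1 / 2) ^ h := fun h => by
    refine (hx h).trans ?_
    have := inv_scale_le hs h2 h
    calc 2 * e * (K h)⁻¹ ≤ 2 * e * ((K 0)⁻¹ * (1 / 2) ^ h) := by gcongr
      _ = _ := by ring
  have h3 := summable_geometric_two.mul_left (2 * e * (K 0)⁻¹)
  refine ((Summable.of_nonneg_of_le hx0 h1 h3).tsum_le_tsum h1 h3).trans_eq ?_
  rw [tsum_mul_left, tsum_geometric_two]; ring

namespace Run
variable {α ρ : ℝ} {A B : ℝ → ℂ} {K : ℕ → ℝ} {q : ℕ → ℕ} {r S : ℕ} {e : ℝ}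
  {z : ℕ → KamState} {m : ℕ → ℝ → ℂ}

lemma wn_cd_le (hz : Run α ρ A B K r S e z m) {p : ℕ} (hs : Summable (fun h => wn 1 p (m h)))
    (h : ℕ) : wn 1 p (z h).c + wn 1 p (z h).d ≤
      (wn 1 p (z 0).c + wn 1 p (z 0).d) * Real.exp (∑' h, wn 1 p (m h)) := by
  have hm0 : ∀ h, 0 ≤ wn 1 p (m h) := fun h => wn_nonneg le_rfl _ _
  have h00 : 0 ≤ wn 1 p (z 0).c + wn 1 p (z 0).d :=
    add_nonneg (wn_nonneg le_rfl _ _) (wn_nonneg le_rfl _ _)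
  have key : ∀ h, wn 1 p (z h).c + wn 1 p (z h).d ≤
      (wn 1 p (z 0).c + wn 1 p (z 0).d) * Real.exp (∑ i ∈ Finset.range h, wn 1 p (m i)) := by
    intro h
    induction h with
    | zero => simp
    | succ h ih =>
      have hc := (hz.good h).hc
      have hd := (hz.good h).hd
      have hm := (hz.step h).hm
      have a1 := wn_sub_le le_rfl p hc (hm.mul hd.conj)
      have a2 := wn_sub_le le_rfl p hd (hm.mul hc.conj)
      have b1 := wn_mul_le le_rfl p hm hd.conj
      have b2 := wn_mul_le le_rfl p hm hc.conj
      rw [wn_conj] at b1 b2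
      rw [funext (hz.step h).c_eq, funext (hz.step h).d_eq, Finset.sum_range_succ, Real.exp_add,
        ← mul_assoc]
      have h1 := Real.add_one_le_exp (wn 1 p (m h))
      have := hm0 h
      have h5 : 0 ≤ wn 1 p (z h).c + wn 1 p (z h).d :=
        add_nonneg (wn_nonneg le_rfl _ _) (wn_nonneg le_rfl _ _)
      calc _ ≤ (wn 1 p (z h).c + wn 1 p (z h).d) * (wn 1 p (m h) + 1) := by linarith
        _ ≤ _ := by gcongr
  refine (key h).trans ?_
  have := hs.sum_le_tsum (Finset.range h) (fun i _ => hm0 i)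
  gcongr

lemma wn_cd_increment_le (hz : Run α ρ A B K r S e z m) {p : ℕ}
    (hs : Summable (fun h => wn 1 p (m h))) (h : ℕ) :
    wn 1 p (fun x => (z (h + 1)).c x - (z h).c x) ≤ wn 1 p (m h) *
      ((wn 1 p (z 0).c + wn 1 p (z 0).d) * Real.exp (∑' h, wn 1 p (m h))) ∧
    wn 1 p (fun x => (z (h + 1)).d x - (z h).d x) ≤ wn 1 p (m h) *
      ((wn 1 p (z 0).c + wn 1 p (z 0).d) * Real.exp (∑' h, wn 1 p (m h))) := by
  have h1 := hz.wn_cd_le hs h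
  have hc := (hz.good h).hc
  have hd := (hz.good h).hd
  have hm := (hz.step h).hm
  have b1 := wn_mul_le le_rfl p hm hd.conj
  have b2 := wn_mul_le le_rfl p hm hc.conj
  rw [wn_conj] at b1 b2
  have hm0 : 0 ≤ wn 1 p (m h) := wn_nonneg le_rfl _ _
  have hc0 : 0 ≤ wn 1 p (z h).c := wn_nonneg le_rfl _ _
  have hd0 : 0 ≤ wn 1 p (z h).d := wn_nonneg le_rfl _ _
  have e1 : (fun x => (z (h + 1)).c x - (z h).c x) =
      fun x => -(m h x * (starRingEnd ℂ) ((z h).d x)) := by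
    funext x; rw [(hz.step h).c_eq]; ring
  have e2 : (fun x => (z (h + 1)).d x - (z h).d x) =
      fun x => -(m h x * (starRingEnd ℂ) ((z h).c x)) := by
    funext x; rw [(hz.step h).d_eq]; ring
  rw [e1, e2, wn_neg, wn_neg]
  constructor
  · refine b1.trans ?_
    gcongr
    linarith
  · refine b2.trans ?_
    gcongr
    linarith

end Run

/-- The limit conjugacy of a run started from the trivial conjugacy. -/
theorem Run.exists_limit {α ρ : ℝ} {A B : ℝ → ℂ} {K : ℕ → ℝ} {q : ℕ → ℕ} {r S : ℕ} {e : ℝ}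
    {z : ℕ → KamState} {m : ℕ → ℝ → ℂ} (hz : Run α ρ A B K r S e z m) (hs : IsScale α K q)
    (he0 : 0 ≤ e) (he : e ≤ 1 / 10) (hr : 200 ≤ r) (hS : S + 2 = 50 * r) (hK0 : kamThr 0 ≤ K 0)
    (hKS : kamThr S ≤ K 0) (hc0 : (z 0).c = fun _ => 1) (hd0 : (z 0).d = fun _ => 0) :
    ∃ c d ψ : ℝ → ℂ, SP c ∧ SP d ∧ SP ψ ∧ (∀ x, (ψ x).im = 0) ∧
      wn 1 r (fun x => c x - 1) ≤ 12 * e * (K 0)⁻¹ ∧ wn 1 r d ≤ 12 * e * (K 0)⁻¹ ∧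
      wn 1 r (fun x => ψ x - (z 0).ψ x) ≤ 4 * e * (K 0)⁻¹ ∧
      ∀ x w, ∃ l : ℝ, 0 ≤ l ∧ act (c (x + α)) (d (x + α)) (act (A x) (B x) w) =
        l * (phaseExp ρ ψ x * act (c x) (d x) w) := by
  obtain ⟨-, h4096, -, -⟩ := le_of_kamThr_le hK0
  have h20 : 2 ≤ K 0 := by linarith
  have hsm := fun p => (hz.summable_increments hs he hK0 p).1
  have hinc := fun h => hz.wn_increment_le hs he0 hr hS hK0 hKS h
  have hK0' : 0 ≤ (K 0)⁻¹ := by have := hs.one_le 0; positivity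
  have hKi : (K 0)⁻¹ ≤ 1 / 4096 := by
    rw [inv_le_comm₀ (by linarith) (by norm_num)]; linarith
  obtain ⟨c, hc, hct, hcb⟩ := exists_smooth_limit (fun h => (hz.good h).hc) fun p =>
    Summable.of_nonneg_of_le (fun h => wn_nonneg le_rfl _ _)
      (fun h => (hz.wn_cd_increment_le (hsm p) h).1) ((hsm p).mul_right _)
  obtain ⟨d, hd, hdt, hdb⟩ := exists_smooth_limit (fun h => (hz.good h).hd) fun p =>
    Summable.of_nonneg_of_le (fun h => wn_nonneg le_rfl _ _)
      (fun h => (hz.wn_cd_increment_le (hsm p) h).2) ((hsm p).mul_right _)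
  obtain ⟨ψ, hψ, hψt, hψb⟩ := exists_smooth_limit (fun h => (hz.good h).hψ) fun p =>
    (hz.summable_increments hs he hK0 p).2
  have hsum : ∑' h, wn 1 r (m h) ≤ 4 * e * (K 0)⁻¹ :=
    tsum_inv_scale_le hs h20 (fun h => wn_nonneg le_rfl _ _) he0 (fun h => (hinc h).1)
  have hsum0 : 0 ≤ ∑' h, wn 1 r (m h) := tsum_nonneg fun h => wn_nonneg le_rfl _ _
  have hexp : (wn 1 r (z 0).c + wn 1 r (z 0).d) * Real.exp (∑' h, wn 1 r (m h)) ≤ 3 := by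
    have h1 : ∑' h, wn 1 r (m h) ≤ 1 := by nlinarith
    have h3 : Real.exp (∑' h, wn 1 r (m h)) ≤ Real.exp 1 := Real.exp_le_exp.2 h1
    rw [hc0, hd0, wn_const, wn_const, norm_one, norm_zero]
    linarith [Real.exp_one_lt_d9]
  have hbd : ∀ u : ℕ → ℝ → ℂ, (∀ h, wn 1 r (u h) ≤ wn 1 r (m h) *
      ((wn 1 r (z 0).c + wn 1 r (z 0).d) * Real.exp (∑' h, wn 1 r (m h)))) →
      ∑' h, wn 1 r (u h) ≤ 12 * e * (K 0)⁻¹ := by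
    intro u hu
    have h1 : ∀ h, wn 1 r (u h) ≤ wn 1 r (m h) * 3 := fun h => (hu h).trans (by
      have := wn_nonneg le_rfl r (m h)
      gcongr)
    have h3 := (hsm r).mul_right 3
    have h4 := (Summable.of_nonneg_of_le (fun h => wn_nonneg le_rfl _ _) h1 h3).tsum_le_tsum h1 h3
    rw [tsum_mul_right] at h4
    linarith
  have hcr : wn 1 r (fun x => c x - 1) ≤ 12 * e * (K 0)⁻¹ := by
    have h1 := (hcb r).trans (hbd _ fun h => (hz.wn_cd_increment_le (hsm r) h).1)
    simpa only [hc0] using h1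
  have hdr : wn 1 r d ≤ 12 * e * (K 0)⁻¹ := by
    have h1 := (hdb r).trans (hbd _ fun h => (hz.wn_cd_increment_le (hsm r) h).2)
    simpa only [hd0, sub_zero] using h1
  have hsmall : 12 * e * (K 0)⁻¹ ≤ 1 / 100 := by nlinarith
  have hβt : ∀ x, Tendsto (fun h => (z h).β x) atTop (nhds 0) := by
    intro x
    refine squeeze_zero_norm (a := fun h => e * (K h)⁻¹) (fun h => ?_) ?_
    · refine (norm_le_n0 (hz.good h).hβ x).trans ?_
      have hK := hs.one_le h
      rw [← div_eq_mul_inv, le_div_iff₀ (by linarith)]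
      simpa using (hz.good h).n0_beta_mul_pow hK (n := 1) (by omega)
    · have h1 : Tendsto (fun h => e * ((K 0)⁻¹ * (1 / 2) ^ h)) atTop (nhds (e * ((K 0)⁻¹ * 0))) :=
        ((tendsto_pow_atTop_nhds_zero_of_lt_one (by norm_num) (by norm_num)).const_mul _).const_mul _
      rw [mul_zero, mul_zero] at h1
      refine squeeze_zero (fun h => ?_) (fun h => ?_) h1
      · have := hs.one_le h
        positivity
      · have := inv_scale_le hs h20 h
        gcongr
  refine ⟨c, d, ψ, hc, hd, hψ, fun x => ?_, hcr, hdr, (hψb r).trans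
    (tsum_inv_scale_le hs h20 (fun h => wn_nonneg le_rfl _ _) he0 fun h => (hinc h).2), ?_⟩
  · have h1 := (Complex.continuous_im.tendsto _).comp (hψt x)
    refine tendsto_nhds_unique h1 ?_
    refine tendsto_const_nhds.congr fun h => ?_
    exact ((hz.good h).real x).symm
  · intro x w
    have hact : ∀ {c₁ d₁ : ℕ → ℂ} {c₂ d₂ : ℂ} {w₁ : ℕ → ℂ} {w₂ : ℂ}, Tendsto c₁ atTop (nhds c₂) →
        Tendsto d₁ atTop (nhds d₂) → Tendsto w₁ atTop (nhds w₂) →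
        Tendsto (fun h => act (c₁ h) (d₁ h) (w₁ h)) atTop (nhds (act c₂ d₂ w₂)) := by
      intro c₁ d₁ c₂ d₂ w₁ w₂ t1 t2 t3
      exact (t1.mul t3).add (t2.mul ((Complex.continuous_conj.tendsto _).comp t3))
    have hL := hact (hct (x + α)) (hdt (x + α)) (tendsto_const_nhds (x := act (A x) (B x) w))
    have hP : Tendsto (fun h => phaseExp ρ (z h).ψ x) atTop (nhds (phaseExp ρ ψ x)) := by
      unfold phaseExp
      exact (Complex.continuous_exp.tendsto _).comp (((hψt x).const_add _).const_mul _)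
    have hF : Tendsto (fun h => fibreMap ρ (z h).ψ (z h).β x (act ((z h).c x) ((z h).d x) w)) atTop
        (nhds (phaseExp ρ ψ x * act (c x) (d x) w)) := by
      have h1 := hact hP ((hβt x).mul ((Complex.continuous_conj.tendsto _).comp hP))
        (hact (hct x) (hdt x) (tendsto_const_nhds (x := w)))
      have e1 : act (phaseExp ρ ψ x) (0 * (starRingEnd ℂ) (phaseExp ρ ψ x)) (act (c x) (d x) w) =
          phaseExp ρ ψ x * act (c x) (d x) w := by
        rw [act, zero_mul, zero_mul, add_zero]
      rw [e1] at h1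
      exact h1
    rcases eq_or_ne (phaseExp ρ ψ x * act (c x) (d x) w) 0 with h0 | h0
    · have hw : w = 0 := by
        by_contra hw
        have hE : phaseExp ρ ψ x ≠ 0 := Complex.exp_ne_zero _
        have h1 : act (c x) (d x) w = 0 := (mul_eq_zero.1 h0).resolve_left hE
        have h3 : w = -((c x - 1) * w + d x * (starRingEnd ℂ) w) := by
          rw [act] at h1
          linear_combination h1
        have h4 : ‖w‖ ≤ (1 / 100 + 1 / 100) * ‖w‖ := by
          conv_lhs => rw [h3]
          rw [norm_neg]
          refine (norm_add_le _ _).trans ?_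
          rw [norm_mul, norm_mul, RCLike.norm_conj, ← add_mul]
          have b1 := (norm_le_n0 (hc.sub (SP_const 1)) x).trans
            ((n0_le_wn le_rfl r (hc.sub (SP_const 1))).trans (hcr.trans hsmall))
          have b2 := (norm_le_n0 hd x).trans ((n0_le_wn le_rfl r hd).trans (hdr.trans hsmall))
          gcongr
        have h5 : 0 < ‖w‖ := norm_pos_iff.2 hw
        linarith
      refine ⟨0, le_rfl, ?_⟩
      subst hw
      simp [act]
    · have hl : ∀ h, ∃ l : ℝ, 0 ≤ l ∧ act ((z h).c (x + α)) ((z h).d (x + α)) (act (A x) (B x) w) =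
          l * fibreMap ρ (z h).ψ (z h).β x (act ((z h).c x) ((z h).d x) w) := fun h => by
        obtain ⟨l, h1, h2⟩ := (hz.good h).conj x w
        exact ⟨l, h1.le, h2⟩
      choose l hl0 hl using hl
      have hn : Tendsto (fun h => (‖act ((z h).c (x + α)) ((z h).d (x + α)) (act (A x) (B x) w)‖ : ℝ) /
          ‖fibreMap ρ (z h).ψ (z h).β x (act ((z h).c x) ((z h).d x) w)‖) atTop (nhds
            (‖act (c (x + α)) (d (x + α)) (act (A x) (B x) w)‖ /
              ‖phaseExp ρ ψ x * act (c x) (d x) w‖)) :=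
        hL.norm.div hF.norm (norm_ne_zero_iff.2 h0)
      have hlt : Tendsto l atTop (nhds (‖act (c (x + α)) (d (x + α)) (act (A x) (B x) w)‖ /
              ‖phaseExp ρ ψ x * act (c x) (d x) w‖)) := by
        refine hn.congr' ?_
        filter_upwards [hF.eventually_ne h0] with h hne
        rw [hl h, norm_mul, Complex.norm_real, Real.norm_of_nonneg (hl0 h),
          mul_div_assoc, div_self (norm_ne_zero_iff.2 hne), mul_one]
      refine ⟨‖act (c (x + α)) (d (x + α)) (act (A x) (B x) w)‖ /
        ‖phaseExp ρ ψ x * act (c x) (d x) w‖, by positivity, tendsto_nhds_unique hL ?_⟩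
      refine Tendsto.congr (fun h => (hl h).symm) (Tendsto.mul ?_ hF)
      exact (Complex.continuous_ofReal.tendsto _).comp hlt

end KamState

lemma phaseExp_add_int {ρ₀ ρ : ℝ} {ψ ψ' : ℝ → ℂ} {x : ℝ} {j : ℤ}
    (h : (ρ₀ : ℂ) + ψ x + j = ρ + ψ' x) : phaseExp ρ ψ' x = phaseExp ρ₀ ψ x := by
  rw [phaseExp, phaseExp, Complex.exp_eq_exp_iff_exists_int]
  exact ⟨j, by rw [← h]; ring⟩

/-- The polar form of a cocycle close to a constant rotation. -/
lemma exists_polar_form (θ : ℝ) {v b : ℝ → ℂ} (hv : SP v) (hb : SP b) {S : ℕ} {Y : ℝ}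
    (hvY : wn 1 S v ≤ Y) (hbY : wn 1 S b ≤ Y) (hY : 2 ^ (S + 1) * Y ≤ 1 / 2) :
    ∃ y β : ℝ → ℂ, SP y ∧ SP β ∧ (∀ x, (y x).im = 0) ∧ wn 1 S y ≤ Y ∧ wn 1 S β ≤ 2 * Y ∧
      ∀ x w, ∃ l : ℝ, 0 < l ∧ act (cis θ * (1 + v x)) (b x) w =
        l * fibreMap 0 (fun x => θ + y x) β x w := by
  have hY0 : 0 ≤ Y := (wn_nonneg le_rfl S v).trans hvY
  have hsm : 2 ^ (S + 1) * n0 v ≤ 1 / 2 := by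
    have := n0_le_wn le_rfl S hv
    refine le_trans ?_ hY
    gcongr
    linarith
  have hY4 : Y ≤ 1 / 4 := by
    have h1 : (2:ℝ) ≤ 2 ^ (S + 1) := by
      rw [pow_succ]
      have : (1:ℝ) ≤ 2 ^ S := one_le_pow₀ (by norm_num)
      linarith
    nlinarith
  have hlt := norm_lt_one_of_small hv hsm
  have SL := hv.log_one_add hlt
  have SI := hv.inv_one_add hlt
  have hyeq : ∀ x, ((4 * π * Complex.I)⁻¹ : ℂ) * (Complex.log (1 + v x) -
      (starRingEnd ℂ) (Complex.log (1 + v x))) =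
      (Complex.log (1 + v x) - (starRingEnd ℂ) (Complex.log (1 + v x))) /
        (4 * π * Complex.I) := fun x => by rw [div_eq_inv_mul]
  refine ⟨fun x => (4 * π * Complex.I)⁻¹ * (Complex.log (1 + v x) -
      (starRingEnd ℂ) (Complex.log (1 + v x))),
    fun x => b x * (cis θ * (starRingEnd ℂ) ((1 + v x)⁻¹)),
    (SP_const _).mul (SL.sub SL.conj), hb.mul ((SP_const _).mul SI.conj), fun x => ?_, ?_, ?_,
    fun x w => ⟨‖1 + v x‖, norm_pos_iff.2 (one_add_ne_zero_of_norm_lt (hlt x)), ?_⟩⟩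
  · beta_reduce
    rw [hyeq, im_sub_conj_div, Complex.ofReal_im]
  · rw [wn_const_mul]
    have h1 := wn_sub_le le_rfl S SL SL.conj
    rw [wn_conj] at h1
    have h2 := wn_log_one_add_le le_rfl S hv hsm
    have h3 : ‖((4 * π * Complex.I)⁻¹ : ℂ)‖ ≤ 1 / 4 := by
      rw [norm_inv, norm_mul, norm_mul, Complex.norm_I, Complex.norm_real, mul_one, norm_of_nonneg
        pi_pos.le, one_div, show ‖(4:ℂ)‖ = 4 by norm_num]
      gcongr
      linarith [pi_gt_three]
    calc _ ≤ 1 / 4 * (4 * Y) :=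
          mul_le_mul h3 (by linarith) (wn_nonneg le_rfl S _) (by norm_num)
      _ = Y := by ring
  · have h1 := wn_mul_le le_rfl S hb ((SP_const (cis θ)).mul SI.conj)
    rw [wn_const_mul, norm_cis, one_mul, wn_conj] at h1
    have h2 := wn_inv_one_add_sub_one_le le_rfl S hv hsm
    have h3 := wn_add_le le_rfl S (SP_const 1) (SI.sub (SP_const 1))
    rw [wn_const, norm_one] at h3
    simp only [add_sub_cancel] at h3
    have h4 : wn 1 S (fun x => (1 + v x)⁻¹) ≤ 2 := by linarith
    refine h1.trans ?_
    rw [mul_comm 2 Y]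
    have := wn_nonneg le_rfl S (fun x => (1 + v x)⁻¹)
    gcongr
  · have hne := one_add_ne_zero_of_norm_lt (hlt x)
    have h1 := norm_mul_exp_arg (1 + v x)
    rw [← hyeq] at h1
    have hE : phaseExp 0 (fun x => (θ:ℂ) + (4 * π * Complex.I)⁻¹ * (Complex.log (1 + v x) -
        (starRingEnd ℂ) (Complex.log (1 + v x)))) x = cis θ * Complex.exp (2 * π * Complex.I *
        ((4 * π * Complex.I)⁻¹ * (Complex.log (1 + v x) -
        (starRingEnd ℂ) (Complex.log (1 + v x))))) := by
      rw [phaseExp, cis, ← Complex.exp_add]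
      congr 1
      push_cast
      ring
    have h2 : (‖1 + v x‖ : ℂ) * phaseExp 0 (fun x => (θ:ℂ) + (4 * π * Complex.I)⁻¹ *
        (Complex.log (1 + v x) - (starRingEnd ℂ) (Complex.log (1 + v x)))) x =
        cis θ * (1 + v x) := by
      rw [hE]
      linear_combination cis θ * h1
    have h3 := congrArg (starRingEnd ℂ) h2
    rw [map_mul, map_mul, Complex.conj_ofReal] at h3
    have h4 : (starRingEnd ℂ) ((1 + v x)⁻¹) * (starRingEnd ℂ) (1 + v x) = 1 := by
      rw [← map_mul, inv_mul_cancel₀ hne, map_one]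
    have h5 := cis_mul_conj θ
    simp only [fibreMap, act]
    linear_combination -w * h2 - b x * (cis θ * (starRingEnd ℂ) ((1 + v x)⁻¹)) *
      (starRingEnd ℂ) w * h3 - b x * (starRingEnd ℂ) w * h4 -
      b x * (starRingEnd ℂ) w * (starRingEnd ℂ) ((1 + v x)⁻¹) * (starRingEnd ℂ) (1 + v x) * h5

set_option maxHeartbeats 1000000 in
/-- The complex form of the reducibility theorem. -/
theorem exists_complex_conjugacy {α ρ θ : ℝ} {K : ℕ → ℝ} {q : ℕ → ℕ} {r S : ℕ} {e Y : ℝ}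
    (hs : IsScale α K q) {v b : ℝ → ℂ} (hv : SP v) (hb : SP b)
    (hvY : wn 1 S v ≤ Y) (hbY : wn 1 S b ≤ Y) (hY : 2 ^ (S + 1) * Y ≤ 1 / 2)
    (hYe : 8 * Y * K 0 ^ (12 * r) ≤ e) (he : e ≤ 1 / 1000)
    {f : ℝ → ℝ → ℝ} (hf : Continuous (Function.uncurry f))
    (hlift : ∀ x y, ∃ r : ℝ, 0 < r ∧
      act (cis θ * (1 + v x)) (b x) (cis y) = r * cis (y + f x y))
    (hlim : ∀ x y : ℝ, Tendsto
      (fun n : ℕ => (∑ i ∈ Finset.range n, f (x + i * α) (liftOrbit f α x y i)) / n)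
      atTop (nhds ρ))
    (hr : 200 ≤ r) (hS : S + 2 = 50 * r) (hK0 : kamThr 0 ≤ K 0) (hKS : kamThr S ≤ K 0)
    (hd : ∀ h, ∀ k : ℤ, |k| ≤ (⌊√(K (h + 1))⌋₊ : ℤ) →
      1 ≤ K h ^ 24 * ‖ee k α - Complex.exp (4 * π * Complex.I * ρ)‖) :
    ∃ c d ψ : ℝ → ℂ, SP c ∧ SP d ∧ SP ψ ∧ (∀ x, (ψ x).im = 0) ∧
      wn 1 r (fun x => c x - 1) ≤ 12 * e * (K 0)⁻¹ ∧ wn 1 r d ≤ 12 * e * (K 0)⁻¹ ∧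
      wn 1 r ψ ≤ 5 * e * (K 0)⁻¹ ∧
      ∀ x w, ∃ l : ℝ, 0 ≤ l ∧
        act (c (x + α)) (d (x + α)) (act (cis θ * (1 + v x)) (b x) w) =
        l * (phaseExp ρ ψ x * act (c x) (d x) w) := by
  obtain ⟨-, hK4, -, -⟩ := le_of_kamThr_le hK0
  have hK1 : 1 ≤ K 0 := by linarith
  have hKp : 0 < K 0 := by linarith
  have hY0 : 0 ≤ Y := (wn_nonneg le_rfl S v).trans hvY
  have hKr : K 0 ≤ K 0 ^ (12 * r) := le_self_pow₀ hK1 (by omega)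
  have hK100 : K 0 ^ 100 ≤ K 0 ^ (12 * r) := pow_le_pow_right₀ hK1 (by omega)
  have hYK : 8 * Y * K 0 ≤ e := le_trans (mul_le_mul_of_nonneg_left hKr (by linarith)) hYe
  have hY8 : 8 * Y ≤ e := by
    have := le_mul_of_one_le_right (by linarith : 0 ≤ 8 * Y) hK1
    linarith
  have he0 : 0 ≤ e := by linarith
  obtain ⟨y, β, Sy, Sβ, hyr, hyY, hβY, hpol⟩ := exists_polar_form θ hv hb hvY hbY hY
  have nβ : n0 β ≤ 2 * Y := (n0_le_wn le_rfl S Sβ).trans hβY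
  have ny : n0 y ≤ Y := (n0_le_wn le_rfl S Sy).trans hyY
  have hβx : ∀ x, ‖β x‖ ≤ 2 * Y := fun x => (norm_le_n0 Sβ x).trans nβ
  obtain ⟨j, hj⟩ := exists_int_lift_near hf (ψ := fun x => θ + y x)
    ((SP_const _).add Sy).cont (fun x => by simp [hyr x]) hlift hpol
    (fun x => (hβx x).trans (by linarith))
  set κ : ℝ := θ + j - ρ with hκ
  set ψ : ℝ → ℂ := fun x => (κ:ℂ) + y x with hψ
  have Sψ : SP ψ := (SP_const _).add Sy
  have hψr : ∀ x, (ψ x).im = 0 := fun x => by simp [hψ, hyr x]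
  have hclose : ∀ x t, |f x t - (ρ + (ψ x).re)| ≤ 1 / 10 := fun x t => by
    have := hj x t
    convert this using 2
    simp [hψ, hκ]
    ring
  have hph : ∀ x, phaseExp ρ ψ x = phaseExp 0 (fun x => (θ:ℂ) + y x) x := fun x =>
    phaseExp_add_int (j := j) (by simp [hψ, hκ]; ring)
  have hpol2 : ∀ x w, ∃ l : ℝ, 0 < l ∧ act (cis θ * (1 + v x)) (b x) w =
      l * fibreMap ρ ψ β x w := fun x w => by
    obtain ⟨l, hl, h⟩ := hpol x w
    exact ⟨l, hl, by rw [h, fibreMap, fibreMap, hph]⟩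
  have hact1 : ∀ w, act 1 0 w = w := fun w => by simp [act]
  have hκY : |κ| ≤ 3 * Y := by
    have := rotNum_mean_le (G := fun _ => 0) (c := fun _ => 1) (d := fun _ => 0) (ψ := ψ) (β := β)
      (ψ₀ := fun x => (ψ x).re) (b := 2 * Y) (Γ := 0) (μ := κ) (H := Y) hlift hlim hclose
      (fun x => by rw [sub_self, abs_zero]; norm_num) hψr
      (fun x => by simp)
      (fun x w => by simpa only [hact1] using hpol2 x w) hβx (by linarith)
      (fun x => by simp) (fun x => by simpa [hψ] using (norm_le_n0 Sy x).trans ny)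
    linarith
  have wψ : wn 1 S ψ ≤ 4 * Y := by
    have := wn_add_le le_rfl S (SP_const (κ:ℂ)) Sy
    rw [wn_const, Complex.norm_real, Real.norm_eq_abs] at this
    linarith
  have nψ : n0 ψ ≤ 4 * Y := (n0_le_wn le_rfl S Sψ).trans wψ
  have hM : (1:ℝ) ≤ K 0 ^ 2 := one_le_pow₀ hK1
  have hK8 : (1:ℝ) ≤ K 0 ^ 8 := one_le_pow₀ hK1
  have hgood : KamState.Good α ρ (fun x => cis θ * (1 + v x)) b K r S e 0
      ⟨ψ, β, fun _ => 1, fun _ => 0⟩ :=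
    { hψ := Sψ
      hβ := Sβ
      hc := SP_const 1
      hd := SP_const 0
      real := hψr
      n0_psi := by
        change n0 ψ + _ ≤ _
        norm_num
        linarith
      n0_cd := by
        have h1 : n0 (fun _ : ℝ => (0:ℂ)) = 0 := by
          rw [← wn_zero 1, wn_const, norm_zero]
        simp only [sub_self, h1]
        norm_num
      wn_beta := by
        have h1 := wn_antitone le_rfl hM S Sβ
        have h2 := le_mul_of_one_le_right he0 hK8
        change wn (K 0 ^ 2) S β ≤ _
        linarith
      wn_psi := by
        have h1 := wn_antitone le_rfl hM S Sψ
        change wn (K 0 ^ 2) S ψ ≤ _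
        linarith
      n0_beta := by
        have h1 := mul_le_mul_of_nonneg_right nβ (pow_nonneg hKp.le (12 * r))
        have h2 : 0 ≤ Y * K 0 ^ (12 * r) := mul_nonneg hY0 (pow_nonneg hKp.le _)
        change n0 β * _ ≤ _
        linarith
      high := by
        have h1 := n0_highPart_le (zero_notMem_modeSet (K := K) 0) Sψ
        have h2 := mul_le_mul (h1.trans nψ) hK100 (pow_nonneg hKp.le _) (by linarith)
        have h3 : 0 ≤ Y * K 0 ^ (12 * r) := mul_nonneg hY0 (pow_nonneg hKp.le _)
        change n0 (highPart (modeSet K 0) ψ) * _ ≤ _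
        linarith
      conj := fun x w => by simpa only [hact1] using hpol2 x w }
  have hrot : RotDatum α ρ (fun x => cis θ * (1 + v x)) b f (fun x => (ψ x).re) :=
    { lift := hlift
      lim := hlim
      close := hclose
      small := fun x => by
        have := (Complex.abs_re_le_norm (ψ x)).trans ((norm_le_n0 Sψ x).trans nψ)
        linarith }
  obtain ⟨z, m, hz0, hz⟩ := KamState.exists_run hgood hs hrot he0 (by linarith) hr hS hK0 hKS hd
  obtain ⟨c, d, ψ', Sc, Sd, Sψ', hr', h1, h2, h3, h4⟩ := hz.exists_limit hs he0 (by linarith) hr hS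
    hK0 hKS (by rw [hz0]) (by rw [hz0])
  refine ⟨c, d, ψ', Sc, Sd, Sψ', hr', h1, h2, ?_, h4⟩
  rw [hz0] at h3
  have h5 := wn_add_le le_rfl r (Sψ'.sub Sψ) Sψ
  simp only [sub_add_cancel] at h5
  have h6 := (wn_mono le_rfl (show r ≤ S by omega) Sψ).trans wψ
  have h7 : 4 * Y ≤ e * (K 0)⁻¹ := by
    rw [← div_eq_mul_inv, le_div_iff₀ hKp]
    have : 0 ≤ Y * K 0 := mul_nonneg hY0 hKp.le
    linarith
  have h8 : wn 1 r (fun x => ψ' x - ψ x) ≤ 4 * e * (K 0)⁻¹ := h3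
  linarith

set_option maxHeartbeats 1000000 in
/-- A pair `(c, d)` close to `(1, 0)` can be rescaled so that `|c|² - |d|² = 1`. -/
lemma exists_normalization {c d : ℝ → ℂ} (hc : SP c) (hd : SP d) {r : ℕ} {η : ℝ}
    (hcη : wn 1 r (fun x => c x - 1) ≤ η) (hdη : wn 1 r d ≤ η)
    (hη : 2 ^ (r + 1) * (3 * η) ≤ 1 / 2) :
    ∃ c' d' : ℝ → ℂ, SP c' ∧ SP d' ∧ wn 1 r (fun x => c' x - 1) ≤ 8 * η ∧ wn 1 r d' ≤ 8 * η ∧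
      (∀ x, c' x * (starRingEnd ℂ) (c' x) - d' x * (starRingEnd ℂ) (d' x) = 1) ∧
      ∀ x, ∃ t : ℝ, 0 < t ∧ c' x = t * c x ∧ d' x = t * d x := by
  have hη0 : 0 ≤ η := (wn_nonneg le_rfl r d).trans hdη
  have hη12 : η ≤ 1 / 12 := by
    have h1 : (2:ℝ) ≤ 2 ^ (r + 1) := by
      rw [pow_succ]
      have : (1:ℝ) ≤ 2 ^ r := one_le_pow₀ (by norm_num)
      linarith
    nlinarith
  set u : ℝ → ℂ := fun x => c x - 1 with hu
  have Su : SP u := hc.sub (SP_const 1)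
  set p : ℝ → ℂ := fun x => (u x + (starRingEnd ℂ) (u x)) +
    (u x * (starRingEnd ℂ) (u x) - d x * (starRingEnd ℂ) (d x)) with hp
  have Sp : SP p := (Su.add Su.conj).add ((Su.mul Su.conj).sub (hd.mul hd.conj))
  have hpeq : ∀ x, 1 + p x = c x * (starRingEnd ℂ) (c x) - d x * (starRingEnd ℂ) (d x) :=
    fun x => by
      simp only [hp, hu, map_sub, map_one]
      ring
  have wp : wn 1 r p ≤ 3 * η := by
    have h1 := wn_add_le le_rfl r (Su.add Su.conj) ((Su.mul Su.conj).sub (hd.mul hd.conj))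
    have h2 := wn_add_le le_rfl r Su Su.conj
    have h3 := wn_sub_le le_rfl r (Su.mul Su.conj) (hd.mul hd.conj)
    have h4 := wn_mul_le le_rfl r Su Su.conj
    have h5 := wn_mul_le le_rfl r hd hd.conj
    rw [wn_conj] at h2 h4 h5
    have h6 := mul_le_mul hcη hcη (wn_nonneg le_rfl r u) hη0
    have h7 := mul_le_mul hdη hdη (wn_nonneg le_rfl r d) hη0
    have h8 : η * η ≤ 1 / 12 * η := mul_le_mul_of_nonneg_right hη12 hη0
    linarith
  have hsm : 2 ^ (r + 1) * n0 p ≤ 1 / 2 := by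
    refine le_trans ?_ hη
    gcongr
    exact (n0_le_wn le_rfl r Sp).trans wp
  have hlt := norm_lt_one_of_small Sp hsm
  have SL := Sp.log_one_add hlt
  set L : ℝ → ℂ := fun x => (-(1 / 2)) * Complex.log (1 + p x) with hL
  have SL' : SP L := (SP_const _).mul SL
  have wL : wn 1 r L ≤ 3 * η := by
    rw [hL, wn_const_mul]
    have := wn_log_one_add_le le_rfl r Sp hsm
    norm_num
    linarith
  have hsm2 : 2 ^ (r + 1) * n0 L ≤ 1 / 2 := by
    refine le_trans ?_ hη
    gcongr
    exact (n0_le_wn le_rfl r SL').trans wL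
  have wlam : wn 1 r (fun x => Complex.exp (L x) - 1) ≤ 6 * η := by
    have := wn_exp_sub_one_le le_rfl r SL' hsm2
    linarith
  have Slam := SL'.cexp
  have Slam1 := Slam.sub (SP_const 1)
  have hreal : ∀ x, Complex.exp (L x) =
      ((Real.exp (-(1 / 2) * Real.log (1 + (p x).re)) : ℝ) : ℂ) := fun x => by
    have h1 : p x = ((p x).re : ℂ) := by
      have : (p x).im = 0 := by
        have h2 := congrArg Complex.im (hpeq x)
        rw [Complex.mul_conj, Complex.mul_conj] at h2
        simpa using h2
      exact Complex.ext rfl (by simpa using this)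
    have h2 : 0 ≤ 1 + (p x).re := by
      have := (abs_le.1 ((Complex.abs_re_le_norm (p x)).trans (hlt x).le)).1
      linarith
    rw [Complex.ofReal_exp, Complex.ofReal_mul, Complex.ofReal_log h2, hL]
    beta_reduce
    rw [Complex.ofReal_add, ← h1]
    push_cast
    rfl
  refine ⟨fun x => Complex.exp (L x) * c x, fun x => Complex.exp (L x) * d x, Slam.mul hc,
    Slam.mul hd, ?_, ?_, fun x => ?_, fun x => ⟨_, Real.exp_pos _, by beta_reduce; rw [hreal],
      by beta_reduce; rw [hreal]⟩⟩
  · have h1 : (fun x => Complex.exp (L x) * c x - 1) = fun x =>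
        ((Complex.exp (L x) - 1) + (Complex.exp (L x) - 1) * u x) + u x := by
      funext x
      simp only [hu]
      ring
    rw [h1]
    have h2 := wn_add_le le_rfl r (Slam1.add (Slam1.mul Su)) Su
    have h3 := wn_add_le le_rfl r Slam1 (Slam1.mul Su)
    have h4 := wn_mul_le le_rfl r Slam1 Su
    have h5 := mul_le_mul wlam hcη (wn_nonneg le_rfl r u) (by linarith)
    have h8 : η * η ≤ 1 / 12 * η := mul_le_mul_of_nonneg_right hη12 hη0
    linarith
  · have h1 : (fun x => Complex.exp (L x) * d x) = fun x =>
        (Complex.exp (L x) - 1) * d x + d x := by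
      funext x
      ring
    rw [h1]
    have h3 := wn_add_le le_rfl r (Slam1.mul hd) hd
    have h4 := wn_mul_le le_rfl r Slam1 hd
    have h5 := mul_le_mul wlam hdη (wn_nonneg le_rfl r d) (by linarith)
    have h8 : η * η ≤ 1 / 12 * η := mul_le_mul_of_nonneg_right hη12 hη0
    linarith
  · have hne := one_add_ne_zero_of_norm_lt (hlt x)
    have h1 : Complex.exp (L x) * Complex.exp (L x) * (1 + p x) = 1 := by
      rw [← Complex.exp_add, show L x + L x = -Complex.log (1 + p x) by simp only [hL]; ring,
        Complex.exp_neg, Complex.exp_log hne, inv_mul_cancel₀ hne]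
    have h2 : (starRingEnd ℂ) (Complex.exp (L x)) = Complex.exp (L x) := by
      rw [hreal, Complex.conj_ofReal]
    rw [map_mul, map_mul, h2]
    rw [hpeq] at h1
    linear_combination h1

section Cnorm

variable {E F : Type*} [NormedAddCommGroup E] [NormedSpace ℝ E] [NormedAddCommGroup F]
  [NormedSpace ℝ F]

lemma bddAbove_norm_iteratedDeriv {u : ℝ → E} (hu : ContDiff ℝ (⊤ : ℕ∞) u)
    (hp : Function.Periodic u 1) (n : ℕ) :
    BddAbove (Set.range fun x => ‖iteratedDeriv n u x‖) := by
  have hper : Function.Periodic (iteratedDeriv n u) 1 := fun x => by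
    have h := congrFun (iteratedDeriv_comp_add_const n u 1) x
    rwa [show (fun z => u (z + 1)) = u from funext hp, eq_comm] at h
  have hcont : Continuous (iteratedDeriv n u) :=
    hu.continuous_iteratedDeriv n (by exact_mod_cast le_top)
  obtain ⟨H, hH⟩ := (isCompact_Icc (a := (0:ℝ)) (b := 1)).exists_bound_of_continuousOn
    hcont.continuousOn
  refine ⟨H, ?_⟩
  rintro _ ⟨x, rfl⟩
  obtain ⟨y, hy, hxy⟩ := hper.exists_mem_Ico₀ one_pos x
  simp only [hxy]
  exact hH y ⟨hy.1, hy.2.le⟩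

lemma norm_iteratedDeriv_le_Cnorm {u : ℝ → E} (hu : ContDiff ℝ (⊤ : ℕ∞) u)
    (hp : Function.Periodic u 1) {n k : ℕ} (h : n ≤ k) (x : ℝ) :
    ‖iteratedDeriv n u x‖ ≤ Cnorm k u := by
  refine (le_ciSup (bddAbove_norm_iteratedDeriv hu hp n) x).trans ?_
  exact Finset.single_le_sum (f := fun n => ⨆ x, ‖iteratedDeriv n u x‖)
    (fun i _ => Real.iSup_nonneg fun x => norm_nonneg _) (by simpa [Nat.lt_succ_iff] using h)

lemma Cnorm_le {u : ℝ → E} {k : ℕ} {C : ℝ} (h : ∀ n ≤ k, ∀ x, ‖iteratedDeriv n u x‖ ≤ C) :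
    Cnorm k u ≤ (k + 1) * C := by
  refine (Finset.sum_le_card_nsmul _ _ C fun n hn => ciSup_le (h n ?_)).trans_eq ?_
  · simpa [Nat.lt_succ_iff] using hn
  · simp

/-- The operator norm, with the topologies fixed by the norms. -/
noncomputable def clmNorm (T : E →L[ℝ] F) : ℝ := ‖T‖

lemma clmNorm_nonneg (T : E →L[ℝ] F) : 0 ≤ clmNorm T := norm_nonneg T

lemma norm_iteratedDeriv_clm_le (T : E →L[ℝ] F) {u : ℝ → E} (hu : ContDiff ℝ (⊤ : ℕ∞) u)
    (n : ℕ) (x : ℝ) : ‖iteratedDeriv n (fun x => T (u x)) x‖ ≤ clmNorm T * ‖iteratedDeriv n u x‖ := by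
  rw [← norm_iteratedFDeriv_eq_norm_iteratedDeriv, ← norm_iteratedFDeriv_eq_norm_iteratedDeriv]
  exact T.norm_iteratedFDeriv_comp_left hu.contDiffAt (by exact_mod_cast le_top)

lemma SP_clm (T : E →L[ℝ] ℂ) {u : ℝ → E} (hu : ContDiff ℝ (⊤ : ℕ∞) u)
    (hp : Function.Periodic u 1) : SP (fun x => T (u x)) :=
  ⟨T.contDiff.comp hu, fun x => by simp only [hp x]⟩

lemma wn_clm_le (T : E →L[ℝ] ℂ) {u : ℝ → E} (hu : ContDiff ℝ (⊤ : ℕ∞) u)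
    (hp : Function.Periodic u 1) (s : ℕ) :
    wn 1 s (fun x => T (u x)) ≤ 2 ^ (s + 5) * (clmNorm T * Cnorm (s + 2) u) := by
  have h : ∀ n ≤ s + 2, ∀ x, ‖iteratedDeriv n (fun x => T (u x)) x‖ ≤ clmNorm T * Cnorm (s + 2) u :=
    fun n hn x => (norm_iteratedDeriv_clm_le T hu n x).trans
      (mul_le_mul_of_nonneg_left (norm_iteratedDeriv_le_Cnorm hu hp hn x) (clmNorm_nonneg _))
  have := (wn_summable_and_le (SP_clm T hu hp) le_rfl s (H := clmNorm T * Cnorm (s + 2) u)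
    (fun x => by simpa using h 0 (Nat.zero_le _) x)
    (fun x => by simpa using h (s + 2) le_rfl x)).2
  simpa using this

lemma norm_iteratedDeriv_clm_le_wn (T : ℂ →L[ℝ] F) {u : ℝ → ℂ} (hu : SP u) {n r : ℕ} (h : n ≤ r)
    (x : ℝ) : ‖iteratedDeriv n (fun x => T (u x)) x‖ ≤ clmNorm T * ((2 * π) ^ r * wn 1 r u) := by
  refine (norm_iteratedDeriv_clm_le T hu.1 n x).trans ?_
  have h1 := norm_iteratedDeriv_le hu n x
  have h2 := wn_mono le_rfl h hu
  have h3 : (2 * π) ^ n ≤ (2 * π) ^ r := pow_le_pow_right₀ (by linarith [pi_gt_three]) h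
  have h4 := wn_nonneg le_rfl n u
  refine mul_le_mul_of_nonneg_left (h1.trans ?_) (clmNorm_nonneg _)
  exact mul_le_mul h3 h2 h4 (by positivity)

end Cnorm

/-- The complex-linear part of a matrix. -/
noncomputable def matLin : Matrix (Fin 2) (Fin 2) ℝ →L[ℝ] ℂ :=
  LinearMap.toContinuousLinearMap
    { toFun := fun M => ⟨(M 0 0 + M 1 1) / 2, (M 1 0 - M 0 1) / 2⟩
      map_add' := fun M N => by
        apply Complex.ext <;> simp <;> ring
      map_smul' := fun t M => by
        apply Complex.ext <;> simp <;> ring }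

/-- The complex-antilinear part of a matrix. -/
noncomputable def matAnti : Matrix (Fin 2) (Fin 2) ℝ →L[ℝ] ℂ :=
  LinearMap.toContinuousLinearMap
    { toFun := fun M => ⟨(M 0 0 - M 1 1) / 2, (M 1 0 + M 0 1) / 2⟩
      map_add' := fun M N => by
        apply Complex.ext <;> simp <;> ring
      map_smul' := fun t M => by
        apply Complex.ext <;> simp <;> ring }

/-- The matrix of `w ↦ c w`. -/
noncomputable def linMat : ℂ →L[ℝ] Matrix (Fin 2) (Fin 2) ℝ :=
  LinearMap.toContinuousLinearMap
    { toFun := fun c => !![c.re, -c.im; c.im, c.re]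
      map_add' := fun c d => by
        ext i j; fin_cases i <;> fin_cases j <;> simp; ring
      map_smul' := fun t c => by
        ext i j; fin_cases i <;> fin_cases j <;> simp }

/-- The matrix of `w ↦ d w̄`. -/
noncomputable def antiMat : ℂ →L[ℝ] Matrix (Fin 2) (Fin 2) ℝ :=
  LinearMap.toContinuousLinearMap
    { toFun := fun c => !![c.re, c.im; c.im, -c.re]
      map_add' := fun c d => by
        ext i j; fin_cases i <;> fin_cases j <;> simp; ring
      map_smul' := fun t c => by
        ext i j; fin_cases i <;> fin_cases j <;> simp }

lemma matLin_apply (M : Matrix (Fin 2) (Fin 2) ℝ) :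
    matLin M = ⟨(M 0 0 + M 1 1) / 2, (M 1 0 - M 0 1) / 2⟩ := rfl

lemma matAnti_apply (M : Matrix (Fin 2) (Fin 2) ℝ) :
    matAnti M = ⟨(M 0 0 - M 1 1) / 2, (M 1 0 + M 0 1) / 2⟩ := rfl

lemma linMat_apply (c : ℂ) : linMat c = !![c.re, -c.im; c.im, c.re] := rfl

lemma antiMat_apply (c : ℂ) : antiMat c = !![c.re, c.im; c.im, -c.re] := rfl

/-- The identification of the plane with `ℂ`. -/
def toC (v : Fin 2 → ℝ) : ℂ := ⟨v 0, v 1⟩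

lemma toC_injective : Function.Injective toC := fun v w h => by
  have h0 := congrArg Complex.re h
  have h1 := congrArg Complex.im h
  ext i
  fin_cases i
  · exact h0
  · exact h1

lemma toC_smul (t : ℝ) (v : Fin 2 → ℝ) : toC (t • v) = t * toC v := by
  apply Complex.ext <;> simp [toC]

lemma toC_mulVec (M : Matrix (Fin 2) (Fin 2) ℝ) (v : Fin 2 → ℝ) :
    toC (M.mulVec v) = act (matLin M) (matAnti M) (toC v) := by
  apply Complex.ext <;>
    simp [toC, act, matLin_apply, matAnti_apply, Matrix.mulVec, dotProduct, Fin.sum_univ_two] <;>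
    ring

lemma toC_mulVec_add (c d : ℂ) (v : Fin 2 → ℝ) :
    toC ((linMat c + antiMat d).mulVec v) = act c d (toC v) := by
  apply Complex.ext <;>
    simp [toC, act, linMat_apply, antiMat_apply, Matrix.mulVec, dotProduct, Fin.sum_univ_two] <;>
    ring

lemma det_linMat_add_antiMat {c d : ℂ}
    (h : c * (starRingEnd ℂ) c - d * (starRingEnd ℂ) d = 1) : (linMat c + antiMat d).det = 1 := by
  have h1 := congrArg Complex.re h
  simp at h1
  rw [Matrix.det_fin_two, linMat_apply, antiMat_apply]
  simp
  linarith

lemma toC_unitVec (y : ℝ) : toC (unitVec y) = cis y := by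
  rw [cis, show (2 * π * Complex.I * y : ℂ) = ((2 * π * y : ℝ) : ℂ) * Complex.I by
      push_cast; ring, Complex.exp_mul_I, ← Complex.ofReal_cos,
    ← Complex.ofReal_sin]
  apply Complex.ext <;> simp only [toC, unitVec, Complex.add_re, Complex.add_im, Complex.re_ofReal_mul,
    Complex.im_ofReal_mul, Complex.ofReal_re, Complex.ofReal_im, Complex.I_re, Complex.I_im] <;> simp

lemma matLin_Rot (θ : ℝ) : matLin (Rot θ) = cis θ := by
  rw [← toC_unitVec]
  apply Complex.ext <;> simp [matLin_apply, Rot, toC, unitVec]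

lemma matAnti_Rot (θ : ℝ) : matAnti (Rot θ) = 0 := by
  apply Complex.ext <;> simp [matAnti_apply, Rot]

lemma toC_Rot_mulVec (θ : ℝ) (v : Fin 2 → ℝ) : toC ((Rot θ).mulVec v) = cis θ * toC v := by
  rw [toC_mulVec, matLin_Rot, matAnti_Rot, act, zero_mul, add_zero]

lemma det_Rot (θ : ℝ) : (Rot θ).det = 1 := by
  rw [Rot, Matrix.det_fin_two_of]
  linarith [Real.cos_sq_add_sin_sq (2 * π * θ)]

/-- Two unimodular matrices with the same projective action and orientation of rays agree. -/
lemma eq_of_mulVec_eq_smul {X Y : Matrix (Fin 2) (Fin 2) ℝ} (hX : X.det = 1) (hY : Y.det = 1)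
    (h : ∀ v, ∃ l : ℝ, 0 ≤ l ∧ X.mulVec v = l • Y.mulVec v) : X = Y := by
  obtain ⟨l, hl, h1⟩ := h ![1, 0]
  obtain ⟨m, -, h2⟩ := h ![0, 1]
  obtain ⟨n, -, h3⟩ := h ![1, 1]
  have a0 := congrFun h1 0
  have a1 := congrFun h1 1
  have b0 := congrFun h2 0
  have b1 := congrFun h2 1
  have c0 := congrFun h3 0
  have c1 := congrFun h3 1
  simp [Matrix.mulVec, dotProduct, Fin.sum_univ_two] at a0 a1 b0 b1 c0 c1
  rw [Matrix.det_fin_two] at hX hY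
  rw [a0, b0] at c0
  rw [a1, b1] at c1
  have hln : l = n := by
    linear_combination Y 1 1 * c0 - Y 0 1 * c1 - (l - n) * hY
  have hmn : m = n := by
    linear_combination Y 0 0 * c1 - Y 1 0 * c0 - (m - n) * hY
  have hl1 : l = 1 := by
    rw [a0, a1, b0, b1, hmn, ← hln] at hX
    have : l * l = 1 := by linear_combination hX - l * l * hY
    nlinarith
  have hm1 : m = 1 := by rw [hmn, ← hln, hl1]
  rw [hl1, one_mul] at a0 a1
  rw [hm1, one_mul] at b0 b1
  ext i j
  fin_cases i <;> fin_cases j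
  · exact a0
  · exact b0
  · exact a1
  · exact b1

/-- The second Melnikov-type condition in exponential form. -/
lemma one_le_mul_norm_of_mem_good_set {α ρ : ℝ} {K : ℕ → ℝ} {q : ℕ → ℕ} (hs : IsScale α K q)
    (hQ : ∀ h, ∀ k : ℤ, |(k:ℝ)| ≤ √(K (h + 1)) →
      1 / K h ^ 24 ≤ distToInt (2 * Int.fract ρ - k * α)) (h : ℕ) (k : ℤ)
    (hk : |k| ≤ (⌊√(K (h + 1))⌋₊ : ℤ)) :
    1 ≤ K h ^ 24 * ‖ee k α - Complex.exp (4 * π * Complex.I * ρ)‖ := by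
  have hKp : 0 < K h ^ 24 := pow_pos (by linarith [hs.one_le h]) _
  have h1 : |(k:ℝ)| ≤ √(K (h + 1)) := by
    have h2 : |(k:ℝ)| ≤ ((⌊√(K (h + 1))⌋₊ : ℤ) : ℝ) := by
      rw [← Int.cast_abs]
      exact_mod_cast hk
    refine h2.trans ?_
    rw [Int.cast_natCast]
    exact Nat.floor_le (Real.sqrt_nonneg _)
  have h3 := hQ h k h1
  have h4 : distToInt (2 * Int.fract ρ - k * α) = distToInt (2 * ρ - k * α) := by
    rw [← distToInt_add_int (2 * Int.fract ρ - k * α) (2 * ⌊ρ⌋)]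
    congr 1
    have := Int.floor_add_fract ρ
    push_cast
    linear_combination 2 * this
  have h5 := distToInt_le_norm_exp_sub_one (2 * ρ - k * α)
  have h6 : ‖Complex.exp (2 * π * Complex.I * ((2 * ρ - k * α : ℝ) : ℂ)) - 1‖ =
      ‖ee k α - Complex.exp (4 * π * Complex.I * ρ)‖ := by
    have h7 : Complex.exp (4 * π * Complex.I * ρ) =
        ee k α * Complex.exp (2 * π * Complex.I * ((2 * ρ - k * α : ℝ) : ℂ)) := by
      rw [ee, ← Complex.exp_add]
      congr 1
      push_cast
      ring
    rw [h7, show ee k α - ee k α * Complex.exp (2 * π * Complex.I * ((2 * ρ - k * α : ℝ) : ℂ)) =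
      -(ee k α * (Complex.exp (2 * π * Complex.I * ((2 * ρ - k * α : ℝ) : ℂ)) - 1)) by ring,
      norm_neg, norm_mul, norm_ee, one_mul]
  rw [h4] at h3
  rw [← h6, ← div_le_iff₀' hKp]
  exact h3.trans h5

set_option maxHeartbeats 1000000 in
/-- The reducibility theorem in matrix form, at a given arithmetic scale. -/
theorem exists_matrix_conjugacy {α ρ θ : ℝ} {K : ℕ → ℝ} {q : ℕ → ℕ} {r S : ℕ} {e Y : ℝ}
    (hs : IsScale α K q) {A : ℝ → Matrix (Fin 2) (Fin 2) ℝ} (hA : ContDiff ℝ (⊤ : ℕ∞) A)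
    (hAp : Function.Periodic A 1) (hAd : ∀ x, (A x).det = 1)
    (hAY : 2 ^ (S + 5) * ((clmNorm matLin + clmNorm matAnti) * Cnorm (S + 2) (fun x => A x - Rot θ)) ≤ Y)
    (hY : 2 ^ (S + 1) * Y ≤ 1 / 2) (hYe : 8 * Y * K 0 ^ (12 * r) ≤ e) (he : e ≤ 1 / 1000)
    (hρ : IsRotNumRep α A ρ)
    (hr : 200 ≤ r) (hS : S + 2 = 50 * r) (hK0 : kamThr 0 ≤ K 0) (hKS : kamThr S ≤ K 0)
    (hd : ∀ h, ∀ k : ℤ, |k| ≤ (⌊√(K (h + 1))⌋₊ : ℤ) →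
      1 ≤ K h ^ 24 * ‖ee k α - Complex.exp (4 * π * Complex.I * ρ)‖) :
    ∃ c d ψ : ℝ → ℂ, SP c ∧ SP d ∧ SP ψ ∧
      (∀ x, c x * (starRingEnd ℂ) (c x) - d x * (starRingEnd ℂ) (d x) = 1) ∧
      wn 1 r (fun x => c x - 1) ≤ 96 * (e * (K 0)⁻¹) ∧ wn 1 r d ≤ 96 * (e * (K 0)⁻¹) ∧
      wn 1 r ψ ≤ 5 * (e * (K 0)⁻¹) ∧
      ∀ x, (linMat (c (x + α)) + antiMat (d (x + α))) * A x =
        Rot (ρ + (ψ x).re) * (linMat (c x) + antiMat (d x)) := by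
  obtain ⟨hK8, hK4, -, -⟩ := le_of_kamThr_le hKS
  have hKp : 0 < K 0 := by linarith
  set D : ℝ → Matrix (Fin 2) (Fin 2) ℝ := fun x => A x - Rot θ with hD
  have hDs : ContDiff ℝ (⊤ : ℕ∞) D := hA.sub contDiff_const
  have hDp : Function.Periodic D 1 := fun x => by simp only [hD, hAp x]
  have hC0 : 0 ≤ Cnorm (S + 2) D := Finset.sum_nonneg fun i _ =>
    Real.iSup_nonneg fun x => norm_nonneg _
  set b : ℝ → ℂ := fun x => matAnti (D x) with hb
  set v : ℝ → ℂ := fun x => (starRingEnd ℂ) (cis θ) * matLin (D x) with hv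
  have Sv : SP v := (SP_const _).mul (SP_clm matLin hDs hDp)
  have Sb : SP b := SP_clm matAnti hDs hDp
  have hvY : wn 1 S v ≤ Y := by
    rw [hv, wn_const_mul, RCLike.norm_conj, norm_cis, one_mul]
    refine (wn_clm_le matLin hDs hDp S).trans (le_trans ?_ hAY)
    gcongr
    exact le_add_of_nonneg_right (clmNorm_nonneg _)
  have hbY : wn 1 S b ≤ Y := by
    refine (wn_clm_le matAnti hDs hDp S).trans (le_trans ?_ hAY)
    gcongr
    exact le_add_of_nonneg_left (clmNorm_nonneg _)
  have hAl : ∀ x, matLin (A x) = cis θ * (1 + v x) := fun x => by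
    simp only [hv, hD, map_sub, matLin_Rot]
    linear_combination (cis θ - matLin (A x)) * cis_mul_conj θ
  have hAa : ∀ x, matAnti (A x) = b x := fun x => by
    simp only [hb, hD, map_sub, matAnti_Rot, sub_zero]
  obtain ⟨f, hf, -, hlift, hlim⟩ := hρ
  obtain ⟨c, d, ψ, Sc, Sd, Sψ, hψr, h1, h2, h3, h4⟩ :=
    exists_complex_conjugacy (θ := θ) hs Sv Sb hvY hbY hY hYe he hf
    (fun x y => by
      obtain ⟨t, ht, h⟩ := hlift x y
      refine ⟨t, ht, ?_⟩
      have := congrArg toC h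
      rwa [toC_mulVec, toC_smul, toC_unitVec, toC_unitVec, hAl, hAa] at this)
    hlim hr hS hK0 hKS hd
  have he0 : 0 ≤ e * (K 0)⁻¹ := by
    have := (wn_nonneg le_rfl r ψ).trans h3
    linarith
  have hη : 2 ^ (r + 1) * (3 * (12 * e * (K 0)⁻¹)) ≤ 1 / 2 := by
    have h5 : (2:ℝ) ^ (r + 1) ≤ K 0 := by
      refine le_trans ?_ hK8
      calc (2:ℝ) ^ (r + 1) ≤ 2 ^ (S + 4) := pow_le_pow_right₀ (by norm_num) (by omega)
        _ ≤ 8 ^ (S + 4) := pow_le_pow_left₀ (by norm_num) (by norm_num) _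
    calc 2 ^ (r + 1) * (3 * (12 * e * (K 0)⁻¹)) ≤ K 0 * (3 * (12 * e * (K 0)⁻¹)) :=
          mul_le_mul_of_nonneg_right h5 (by linarith)
      _ = 36 * e := by linear_combination 36 * e * mul_inv_cancel₀ hKp.ne'
      _ ≤ 1 / 2 := by linarith
  obtain ⟨c', d', Sc', Sd', g1, g2, g3, g4⟩ := exists_normalization Sc Sd h1 h2 hη
  refine ⟨c', d', ψ, Sc', Sd', Sψ, g3, by linarith, by linarith, by linarith, fun x => ?_⟩
  refine eq_of_mulVec_eq_smul ?_ ?_ fun w => ?_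
  · rw [Matrix.det_mul, det_linMat_add_antiMat (g3 _), hAd, one_mul]
  · rw [Matrix.det_mul, det_linMat_add_antiMat (g3 _), det_Rot, one_mul]
  · obtain ⟨l, hl, h⟩ := h4 x (toC w)
    obtain ⟨t, ht, t1, t2⟩ := g4 x
    obtain ⟨t', ht', t1', t2'⟩ := g4 (x + α)
    refine ⟨t' * l / t, by positivity, toC_injective ?_⟩
    have htc : (t:ℂ) ≠ 0 := by exact_mod_cast ht.ne'
    have hph : phaseExp ρ ψ x = cis (ρ + (ψ x).re) := phaseExp_eq_cis ρ (hψr x)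
    rw [← Matrix.mulVec_mulVec, toC_mulVec_add, toC_mulVec, hAl, hAa, toC_smul,
      ← Matrix.mulVec_mulVec, toC_Rot_mulVec, toC_mulVec_add, t1, t2, t1', t2', ← hph]
    have hsc : ∀ (t : ℝ) (c d w : ℂ), act (t * c) (t * d) w = t * act c d w := fun t c d w => by
      simp only [act]; ring
    rw [hsc, hsc, h]
    push_cast
    field_simp

lemma Cnorm_re_le {ψ : ℝ → ℂ} (Sψ : SP ψ) (r : ℕ) :
    Cnorm r (fun x => (ψ x).re) ≤
      (r + 1) * (clmNorm Complex.reCLM * ((2 * π) ^ r * wn 1 r ψ)) :=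
  Cnorm_le fun _ hn x => norm_iteratedDeriv_clm_le_wn Complex.reCLM Sψ hn x

lemma contDiff_linMat_add_antiMat {c d : ℝ → ℂ} (Sc : SP c) (Sd : SP d) :
    ContDiff ℝ (⊤ : ℕ∞) (fun x => linMat (c x) + antiMat (d x)) :=
  (ContinuousLinearMap.contDiff (E := ℂ) (F := Matrix (Fin 2) (Fin 2) ℝ) linMat |>.comp Sc.1).add
    (ContinuousLinearMap.contDiff (E := ℂ) (F := Matrix (Fin 2) (Fin 2) ℝ) antiMat |>.comp Sd.1)

lemma Cnorm_linMat_add_antiMat_sub_one_le {c d : ℝ → ℂ} (Sc : SP c) (Sd : SP d) (r : ℕ) :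
    Cnorm r (fun x => linMat (c x) + antiMat (d x) - 1) ≤
      (r + 1) * (clmNorm linMat * ((2 * π) ^ r * wn 1 r (fun x => c x - 1)) +
        clmNorm antiMat * ((2 * π) ^ r * wn 1 r d)) := by
  have Sc1 : SP (fun x => c x - 1) := Sc.sub (SP_const 1)
  have h1 : (fun x => linMat (c x) + antiMat (d x) - 1) =
      (fun x => linMat (c x - 1)) + fun x => antiMat (d x) := by
    funext x
    simp only [Pi.add_apply, map_sub]
    have : linMat 1 = 1 := by
      rw [linMat_apply]
      ext i j
      fin_cases i <;> fin_cases j <;> simp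
    rw [this]
    abel
  rw [h1]
  refine Cnorm_le fun n hn x => ?_
  have h2 : ContDiff ℝ (⊤ : ℕ∞) (fun x => linMat (c x - 1)) :=
    ContinuousLinearMap.contDiff (E := ℂ) (F := Matrix (Fin 2) (Fin 2) ℝ) linMat |>.comp Sc1.1
  have h3 : ContDiff ℝ (⊤ : ℕ∞) (fun x => antiMat (d x)) :=
    ContinuousLinearMap.contDiff (E := ℂ) (F := Matrix (Fin 2) (Fin 2) ℝ) antiMat |>.comp Sd.1
  have hle : ((n : ℕ∞) : WithTop ℕ∞) ≤ ((⊤ : ℕ∞) : WithTop ℕ∞) := by exact_mod_cast le_top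
  rw [iteratedDeriv_add (h2.contDiffAt.of_le hle) (h3.contDiffAt.of_le hle)]
  exact (norm_add_le _ _).trans (add_le_add (norm_iteratedDeriv_clm_le_wn linMat Sc1 hn x)
    (norm_iteratedDeriv_clm_le_wn antiMat Sd hn x))

lemma kamThr_nonneg (s : ℕ) : 0 ≤ kamThr s := by
  have h1 := expConst_nonneg s
  have h2 := expConst_nonneg 0
  unfold kamThr
  positivity

/-- Theorem 1: rotations-reducibility for close-to-constant smooth quasi-periodic
`SL(2,ℝ)` cocycles, for rotation numbers in a set `Q(α)` of almost full measure. -/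
theorem statement0 (ε : ℝ) (hε : 0 < ε) (r₀ : ℕ) (hr₀ : 200 ≤ r₀) :
    ∃ ε₀ : ℝ, 0 < ε₀ ∧ ∀ α : ℝ, Irrational α →
      ∃ Q : Set ℝ, Q ⊆ Set.Ico (0:ℝ) 1 ∧ MeasurableSet Q ∧
        volume (Set.Ico (0:ℝ) 1 \ Q) < ENNReal.ofReal ε ∧
        ∀ A₀ : ℝ → Matrix (Fin 2) (Fin 2) ℝ, ∀ R : Matrix (Fin 2) (Fin 2) ℝ,
          ContDiff ℝ (⊤ : ℕ∞) A₀ → Function.Periodic A₀ 1 → (∀ x, (A₀ x).det = 1) →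
          (∃ θ : ℝ, R = Rot θ) →
          (∃ ρ₀ : ℝ, IsRotNumRep α A₀ ρ₀ ∧ Int.fract ρ₀ ∈ Q) →
          Cnorm (50 * r₀) (fun x => A₀ x - R) < ε₀ →
          ∃ B : ℝ → Matrix (Fin 2) (Fin 2) ℝ, ∃ φ : ℝ → ℝ, ∃ ρ : ℝ,
            ContDiff ℝ (⊤ : ℕ∞) B ∧ Function.Periodic B 1 ∧ (∀ x, (B x).det = 1) ∧
            ContDiff ℝ (⊤ : ℕ∞) φ ∧ Function.Periodic φ 1 ∧
            (∀ x, B (x + α) * A₀ x * (B x)⁻¹ = Rot (φ x)) ∧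
            IsRotNumRep α A₀ ρ ∧
            Cnorm r₀ (fun x => φ x - ρ) < Real.sqrt ε₀ ∧
            Cnorm r₀ (fun x => B x - 1) < Real.sqrt ε₀ := by
  obtain ⟨S, hS⟩ : ∃ S, S + 2 = 50 * r₀ := ⟨50 * r₀ - 2, by omega⟩
  obtain ⟨D, hD⟩ : ∃ D, D = 2 ^ (S + 5) * (clmNorm matLin + clmNorm matAnti) := ⟨_, rfl⟩
  obtain ⟨F, hF⟩ : ∃ F : ℝ, F = (r₀ + 1) * ((2 * π) ^ r₀ *
    ((clmNorm Complex.reCLM + clmNorm linMat + clmNorm antiMat) * 96)) := ⟨_, rfl⟩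
  have hm1 := clmNorm_nonneg (E := Matrix (Fin 2) (Fin 2) ℝ) matLin
  have hm2 := clmNorm_nonneg (E := Matrix (Fin 2) (Fin 2) ℝ) matAnti
  have hm3 := clmNorm_nonneg (F := Matrix (Fin 2) (Fin 2) ℝ) linMat
  have hm4 := clmNorm_nonneg (F := Matrix (Fin 2) (Fin 2) ℝ) antiMat
  have hm5 := clmNorm_nonneg Complex.reCLM
  have hD0 : 0 ≤ D := by rw [hD]; positivity
  have hF0 : 0 ≤ F := by rw [hF]; positivity
  have hk0 := kamThr_nonneg 0
  have hkS := kamThr_nonneg S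
  have hε17 : 0 < 17 / ε := by positivity
  obtain ⟨K₀, hK₀⟩ : ∃ K₀, K₀ = kamThr 0 + kamThr S + 17 / ε + 2 + 8 * D + F := ⟨_, rfl⟩
  have hK1 : 1 ≤ K₀ := by linarith
  have hKp : 0 < K₀ := by linarith
  obtain ⟨hK8, hK4, -, -⟩ := le_of_kamThr_le (show kamThr S ≤ K₀ by linarith)
  obtain ⟨e, he⟩ : ∃ e, e = (K₀ ^ (12 * r₀ + 1))⁻¹ := ⟨_, rfl⟩
  have hep : 0 < e := by rw [he]; positivity
  have hek : K₀ ^ (12 * r₀) * e = K₀⁻¹ := by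
    rw [he, pow_succ, mul_inv, ← mul_assoc, mul_inv_cancel₀ (pow_pos hKp _).ne', one_mul]
  have heK : e ≤ K₀⁻¹ := by
    rw [← hek]
    exact le_mul_of_one_le_left hep.le (one_le_pow₀ hK1)
  have hFe : F * (e * K₀⁻¹) < e := by
    have h1 : F < K₀ := by linarith
    have h2 : F * K₀⁻¹ < 1 := by
      rw [← div_eq_mul_inv, div_lt_one hKp]
      exact h1
    calc F * (e * K₀⁻¹) = e * (F * K₀⁻¹) := by ring
      _ < e * 1 := mul_lt_mul_of_pos_left h2 hep
      _ = e := mul_one e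
  have hDe : 8 * (D * e ^ 2) * K₀ ^ (12 * r₀) ≤ e := by
    have h2 : 8 * D * K₀⁻¹ ≤ 1 := by
      rw [← div_eq_mul_inv, div_le_one hKp]
      linarith
    calc 8 * (D * e ^ 2) * K₀ ^ (12 * r₀) = 8 * D * e * (K₀ ^ (12 * r₀) * e) := by ring
      _ = e * (8 * D * K₀⁻¹) := by rw [hek]; ring
      _ ≤ e * 1 := mul_le_mul_of_nonneg_left h2 hep.le
      _ = e := mul_one e
  have he1 : e ≤ 1 / 1000 := by
    refine heK.trans ?_
    rw [inv_le_comm₀ hKp (by norm_num)]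
    refine le_trans (by norm_num) hK4
  have hY : 2 ^ (S + 1) * (D * e ^ 2) ≤ 1 / 2 := by
    have h1 : (2:ℝ) ^ (S + 1) ≤ K₀ ^ (12 * r₀) := by
      calc (2:ℝ) ^ (S + 1) ≤ 2 ^ (S + 4) := pow_le_pow_right₀ (by norm_num) (by omega)
        _ ≤ 8 ^ (S + 4) := pow_le_pow_left₀ (by norm_num) (by norm_num) _
        _ ≤ K₀ := hK8
        _ ≤ K₀ ^ (12 * r₀) := le_self_pow₀ hK1 (by omega)
    have h2 := mul_le_mul_of_nonneg_right h1 (show 0 ≤ D * e ^ 2 by positivity)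
    linarith
  refine ⟨e ^ 2, by positivity, fun α hα => ?_⟩
  obtain ⟨K, q, hK, hs⟩ := exists_isScale hα hK1
  obtain ⟨Q, hQ1, hQ2, hQ3, hQ4⟩ := exists_good_set hs (by rw [hK]; linarith) hε (by
    rw [hK]
    have : ε * (17 / ε) = 17 := by field_simp
    have h1 : ε * (17 / ε) ≤ ε * K₀ := mul_le_mul_of_nonneg_left (by linarith) hε.le
    linarith)
  refine ⟨Q, hQ1, hQ2, hQ3, ?_⟩
  rintro A₀ _ hA hAp hAd ⟨θ, rfl⟩ ⟨ρ, hρ, hρQ⟩ hC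
  rw [← hS] at hC
  obtain ⟨c, d, ψ, Sc, Sd, Sψ, h1, h2, h3, h4, h5⟩ := exists_matrix_conjugacy (θ := θ)
    (Y := D * e ^ 2) (e := e) hs hA hAp hAd
    (by
      rw [← mul_assoc, ← hD]
      exact mul_le_mul_of_nonneg_left hC.le hD0) hY (by rw [hK]; exact hDe) he1 hρ hr₀ hS
    (by rw [hK]; linarith) (by rw [hK]; linarith)
    (one_le_mul_norm_of_mem_good_set hs (hQ4 _ hρQ))
  rw [hK] at h2 h3 h4
  have hx : 0 ≤ e * K₀⁻¹ := by positivity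
  have hdet : ∀ x, (linMat (c x) + antiMat (d x)).det = 1 := fun x =>
    det_linMat_add_antiMat (h1 x)
  refine ⟨fun x => linMat (c x) + antiMat (d x), fun x => ρ + (ψ x).re, ρ,
    contDiff_linMat_add_antiMat Sc Sd, fun x => by simp only [Sc.2 x, Sd.2 x], hdet,
    contDiff_const.add (Complex.reCLM.contDiff.comp Sψ.1), fun x => by simp only [Sψ.2 x],
    fun x => ?_, hρ, ?_, ?_⟩
  · simp only [h5]
    exact Matrix.mul_nonsing_inv_cancel_right _ _ (by rw [hdet]; exact isUnit_one)
  · rw [Real.sqrt_sq hep.le]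
    simp only [add_sub_cancel_left]
    refine (Cnorm_re_le Sψ r₀).trans_lt (lt_of_le_of_lt ?_ hFe)
    rw [hF]
    simp only [mul_assoc]
    gcongr ?_ * ?_
    rw [mul_left_comm]
    gcongr ?_ * ?_
    nlinarith [mul_nonneg hm3 hx, mul_nonneg hm4 hx, mul_nonneg hm5 hx,
      mul_le_mul_of_nonneg_left h4 hm5]
  · rw [Real.sqrt_sq hep.le]
    refine (Cnorm_linMat_add_antiMat_sub_one_le Sc Sd r₀).trans_lt (lt_of_le_of_lt ?_ hFe)
    rw [hF]
    simp only [mul_assoc]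
    gcongr ?_ * ?_
    rw [mul_left_comm, mul_left_comm (clmNorm antiMat), ← mul_add]
    gcongr ?_ * ?_
    nlinarith [mul_nonneg hm3 hx, mul_nonneg hm4 hx, mul_nonneg hm5 hx,
      mul_le_mul_of_nonneg_left h2 hm3, mul_le_mul_of_nonneg_left h3 hm4]
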